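/- Fix θ ∈ ℝ. For ℓ ∈ ℕ define the four sets of positive reals Z₁⁺(ℓ) = {k > 0 : J_ℓ(k) − e^{θ} J_{ℓ+1}(k) = 0}, Z₂⁺(ℓ) = {k > 0 : J_ℓ(k) + e^{−θ} J_{ℓ+1}(k) = 0}, Z₁⁻(ℓ) = {k > 0 : J_ℓ(k) + e^{θ} J_{ℓ+1}(k) = 0}, Z₂⁻(ℓ) = {k > 0 : J_ℓ(k) − e^{−θ} J_{ℓ+1}(k) = 0}. Then: (i) for every s ∈ ℂ with Re s > 2, all the sums ∑_{ℓ=0}^∞ ∑_{k ∈ Z₁⁺(ℓ)} k^{−s}, etc., converge absolutely, so that η(s) := ∑_{ℓ=0}^∞ [ ∑_{k ∈ Z₁⁺(ℓ)} k^{−s} + ∑_{k ∈ Z₂⁺(ℓ)} k^{−s} − ∑_{k ∈ Z₁⁻(ℓ)} k^{−s} − ∑_{k ∈ Z₂⁻(ℓ)} k^{−s} ] is well defined; (ii) there exist a finite set F ⊂ ℂ with 0 ∉ F and a function h holomorphic on {s ∈ ℂ : Re s > −1/2} ∖ F such that h(s) = η(s) for all s with Re s > 2, and h(0) = −(1/2)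 tanh(θ/2). (h(0) is the spectral asymmetry η(0, i∂̸) of the Euclidean Dirac operator on the two-dimensional unit disk with chiral bag boundary conditions with parameter θ; the sets Z^±(ℓ) are the moduli of its positive and negative eigenvalues.) -/

import Mathlib

/-- Bessel function of the first kind of nonnegative integer order `m`,
`J_m(x) = ∑_k (−1)^k (x/2)^{m+2k} / (k! (m+k)!)`. -/
noncomputable def besselJn (m : ℕ) (x : ℝ) : ℝ :=
  ∑' k : ℕ, (-1 : ℝ) ^ k * (x / 2) ^ (m + 2 * k) /
    ((k.factorial : ℝ) * ((m + k).factorial : ℝ))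

/-- Moduli of positive eigenvalues, first family: `J_ℓ(k) − e^θ J_{ℓ+1}(k) = 0`. -/
def Z1p (θ : ℝ) (ℓ : ℕ) : Set ℝ :=
  {k | 0 < k ∧ besselJn ℓ k - Real.exp θ * besselJn (ℓ + 1) k = 0}

/-- Moduli of positive eigenvalues, second family: `J_ℓ(k) + e^{−θ} J_{ℓ+1}(k) = 0`. -/
def Z2p (θ : ℝ) (ℓ : ℕ) : Set ℝ :=
  {k | 0 < k ∧ besselJn ℓ k + Real.exp (-θ) * besselJn (ℓ + 1) k = 0}

/-- Moduli of negative eigenvalues, first family: `J_ℓ(k) + e^θ J_{ℓ+1}(k) = 0`. -/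
def Z1m (θ : ℝ) (ℓ : ℕ) : Set ℝ :=
  {k | 0 < k ∧ besselJn ℓ k + Real.exp θ * besselJn (ℓ + 1) k = 0}

/-- Moduli of negative eigenvalues, second family: `J_ℓ(k) − e^{−θ} J_{ℓ+1}(k) = 0`. -/
def Z2m (θ : ℝ) (ℓ : ℕ) : Set ℝ :=
  {k | 0 < k ∧ besselJn ℓ k - Real.exp (-θ) * besselJn (ℓ + 1) k = 0}

section DiskEta

open Filter Topology Metric in
/-- A nonvanishing holomorphic function of controlled size on a large disk has nearly constant
logarithmic derivative near the centre. -/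
theorem norm_logDeriv_sub_le {g : ℂ → ℂ} {R M : ℝ} (hR : 0 < R) (hM : 0 < M)
    (hg : DifferentiableOn ℂ g (ball 0 R)) (h0 : ∀ z ∈ ball (0 : ℂ) R, g z ≠ 0) (g0 : g 0 = 1)
    (hb : ∀ z ∈ ball (0 : ℂ) R, ‖g z‖ ≤ Real.exp M) {z : ℂ} (hz : ‖z‖ < R / 4) :
    ‖logDeriv g z - logDeriv g 0‖ ≤ 128 * M / R ^ 2 * ‖z‖ := by
  have hopen : IsOpen (ball (0 : ℂ) R) := isOpen_ball
  have hzero : (0 : ℂ) ∈ ball (0 : ℂ) R := by simpa using hR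
  have hld : DifferentiableOn ℂ (logDeriv g) (ball 0 R) := (hg.deriv hopen).div hg h0
  obtain ⟨L, hL0, hL⟩ := hld.isExactOn_ball.with_val_at 0 0
  have hLd : DifferentiableOn ℂ L (ball 0 R) :=
    fun w hw => (hL w hw).differentiableAt.differentiableWithinAt
  have hexp : ∀ w ∈ ball (0 : ℂ) R, g w = Complex.exp (L w) := by
    have hder : ∀ w ∈ ball (0 : ℂ) R,
        HasDerivAt (fun w => g w * Complex.exp (-L w)) 0 w := by
      intro w hw
      have h1 := (hg.differentiableAt (hopen.mem_nhds hw)).hasDerivAt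
      have h2 := (hL w hw).neg.cexp
      refine (h1.mul h2).congr_deriv ?_
      have := h0 w hw
      simp only [logDeriv_apply, Pi.neg_apply]
      field_simp
      ring
    intro w hw
    have hconst := (convex_ball (0 : ℂ) R).is_const_of_fderivWithin_eq_zero (𝕜 := ℂ)
      (f := fun w => g w * Complex.exp (-L w))
      (fun x hx => (hder x hx).differentiableAt.differentiableWithinAt)
      (fun x hx => by
        rw [fderivWithin_of_isOpen hopen hx]
        ext
        simpa using (hder x hx).deriv) hw hzero
    simp only [g0, hL0, neg_zero, Complex.exp_zero, mul_one] at hconst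
    calc g w = g w * Complex.exp (-L w) * Complex.exp (L w) := by
          rw [mul_assoc, ← Complex.exp_add]; simp
      _ = _ := by rw [hconst, one_mul]
  have hre : Set.MapsTo L (ball 0 R) {z | z.re ≤ M} := by
    intro w hw
    have := hb w hw
    rwa [hexp w hw, Complex.norm_exp, Real.exp_le_exp] at this
  have hbd : ∀ w : ℂ, ‖w‖ < R / 2 → ‖L w‖ ≤ 2 * M := by
    intro w hw
    refine (Complex.borelCaratheodory_zero hM hLd hre hR (by simp; linarith) hL0).trans ?_
    rw [div_le_iff₀ (by linarith)]
    nlinarith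
  have hderiv : ∀ w : ℂ, ‖w‖ < R / 4 → ‖logDeriv g w‖ ≤ 16 * M / R := by
    intro w hw
    have hsub : ∀ v ∈ ball w (R / 4), ‖v‖ < R / 2 := by
      intro v hv
      rw [mem_ball, dist_eq_norm] at hv
      calc ‖v‖ = ‖(v - w) + w‖ := by ring_nf
        _ ≤ ‖v - w‖ + ‖w‖ := norm_add_le _ _
        _ < R / 2 := by linarith
    rw [← (hL w (by simp; linarith)).deriv]
    have := Complex.norm_deriv_le_div_of_mapsTo_ball (f := L) (c := w) (R₁ := R / 4) (R₂ := 4 * M)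
      (hLd.mono fun v hv => by have := hsub v hv; simp; linarith)
      (fun v hv => by
        rw [mem_closedBall, dist_eq_norm]
        have h1 := hbd v (hsub v hv)
        have h2 := hbd w (by linarith)
        linarith [norm_sub_le (L v) (L w)]) (by linarith)
    refine this.trans_eq ?_
    field_simp
    ring
  have := Complex.dist_le_div_mul_dist_of_mapsTo_ball (f := logDeriv g) (c := 0) (R₁ := R / 4)
      (R₂ := 32 * M / R) (z := z)
      (hld.mono fun v hv => by simp at hv ⊢; linarith)
      (fun v hv => by
        rw [mem_closedBall, dist_eq_norm]
        have h1 := hderiv v (by simpa using hv)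
        have h2 := hderiv 0 (by simp; linarith)
        calc _ ≤ _ := norm_sub_le _ _
          _ ≤ 16 * M / R + 16 * M / R := add_le_add h1 h2
          _ = _ := by ring) (by simpa using hz)
  rw [dist_eq_norm, dist_eq_norm, sub_zero] at this
  refine this.trans_eq ?_
  field_simp
  ring

/-- Dividing finitely many zeros out of an entire function. -/
theorem exists_eq_mul_prod_one_sub_div {f : ℂ → ℂ} (hf : Differentiable ℂ f) (S : Finset ℂ)
    (hS : ∀ μ ∈ S, f μ = 0 ∧ μ ≠ 0) :
    ∃ g : ℂ → ℂ, Differentiable ℂ g ∧ ∀ z, f z = g z * ∏ μ ∈ S, (1 - z / μ) := by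
  classical
  induction S using Finset.induction_on with
  | empty => exact ⟨f, hf, by simp⟩
  | insert μ S hμ ih =>
    obtain ⟨g, hg, hfg⟩ := ih fun ν hν => hS ν (Finset.mem_insert_of_mem hν)
    obtain ⟨hμ0, hμne⟩ := hS μ (Finset.mem_insert_self _ _)
    have hgμ : g μ = 0 := by
      have h := hfg μ
      rw [hμ0] at h
      rcases mul_eq_zero.1 h.symm with h | h
      · exact h
      · obtain ⟨ν, hν, h1⟩ := Finset.prod_eq_zero_iff.1 h
        have hν0 := (hS ν (Finset.mem_insert_of_mem hν)).2
        rw [sub_eq_zero, eq_comm, div_eq_one_iff_eq hν0] at h1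
        exact absurd (h1 ▸ hν) hμ
    refine ⟨fun z => -μ * dslope g μ z, ?_, fun z => ?_⟩
    · refine Differentiable.const_mul ?_ _
      rw [← differentiableOn_univ] at hg ⊢
      exact (Complex.differentiableOn_dslope Filter.univ_mem).2 hg
    · have h := sub_smul_dslope g μ z
      rw [hgμ, sub_zero, smul_eq_mul] at h
      rw [hfg, Finset.prod_insert hμ, ← h]
      field_simp
      ring

open Filter Topology Metric in
/-- The zeros of a nonzero entire function in a disk are finite in number. -/
theorem finite_zeros_ball {f : ℂ → ℂ} (hf : Differentiable ℂ f) (h0 : f 0 ≠ 0) (R : ℝ) :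
    {z : ℂ | f z = 0 ∧ ‖z‖ < R}.Finite := by
  by_contra hinf
  obtain ⟨x, -, hx⟩ := Set.Infinite.exists_accPt_of_subset_isCompact hinf
    (isCompact_closedBall (0 : ℂ) R) (fun z hz => by simpa using hz.2.le)
  have hfr : ∃ᶠ z in 𝓝[≠] x, f z = 0 :=
    (accPt_iff_frequently_nhdsNE.1 hx).mono fun z hz => hz.1
  have := (hf.differentiableOn (s := Set.univ)).analyticOnNhd
    isOpen_univ |>.eqOn_zero_of_preconnected_of_frequently_eq_zero isPreconnected_univ
    (Set.mem_univ x) hfr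
  exact h0 (this (Set.mem_univ 0))

open Filter Topology Metric in
/-- Mittag-Leffler expansion of the logarithmic derivative of an entire function of exponential
type with simple zeros. -/
theorem tendsto_sum_zeros_logDeriv {f : ℂ → ℂ} (hf : Differentiable ℂ f) (h0 : f 0 = 1) {C : ℝ}
    (hC : ∀ z, ‖f z‖ ≤ Real.exp (C * (1 + ‖z‖))) (hs : ∀ z, f z = 0 → deriv f z ≠ 0)
    {ι : Type*} (e : ι → ℂ) (he : Function.Injective e) (hr : ∀ z, f z = 0 ↔ z ∈ Set.range e)
    (S : ℕ → Finset ι) (hS : ∀ n i, i ∈ S n ↔ ‖e i‖ < n) {z : ℂ} (hz : f z ≠ 0) :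
    Tendsto (fun n => ∑ i ∈ S n, (1 / (z - e i) + 1 / e i)) atTop
      (𝓝 (logDeriv f z - logDeriv f 0)) := by
  classical
  have hez : ∀ i, f (e i) = 0 := fun i => (hr _).2 ⟨i, rfl⟩
  have hene : ∀ i, e i ≠ 0 := fun i h => by have := hez i; rw [h, h0] at this; simp at this
  have hCpos : 0 ≤ C := by
    have := hC 0
    rw [h0] at this
    simpa using this
  have key : ∀ n : ℕ, 4 * ‖z‖ < n →
      ‖(logDeriv f z - logDeriv f 0) - ∑ i ∈ S n, (1 / (z - e i) + 1 / e i)‖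
        ≤ 128 * (C * (1 + 2 * n) + 1) / (n : ℝ) ^ 2 * ‖z‖ := by
    intro n hn
    have hnpos : (0 : ℝ) < n := lt_of_le_of_lt (by positivity) hn
    obtain ⟨g, hg, hfg⟩ := exists_eq_mul_prod_one_sub_div hf ((S n).image e) (by
      intro μ hμ
      obtain ⟨i, -, rfl⟩ := Finset.mem_image.1 hμ
      exact ⟨hez i, hene i⟩)
    simp only [Finset.prod_image he.injOn] at hfg
    set P : ℂ → ℂ := fun z => ∏ i ∈ S n, (1 - z / e i) with hP
    have hPd : Differentiable ℂ P := by
      refine Differentiable.fun_finsetProd fun i _ => ?_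
      fun_prop
    have hfgP : f = fun z => g z * P z := funext hfg
    have hg0 : g 0 = 1 := by have := hfg 0; simpa [h0] using this.symm
    have hgne : ∀ w ∈ ball (0 : ℂ) n, g w ≠ 0 := by
      intro w hw hgw
      have hfw : f w = 0 := by rw [hfg, hgw, zero_mul]
      obtain ⟨i, rfl⟩ := (hr w).1 hfw
      have hPi : P (e i) = 0 :=
        Finset.prod_eq_zero ((hS n i).2 (by simpa using hw)) (by simp [hene i])
      apply hs _ hfw
      rw [hfgP]
      have := ((hg (e i)).hasDerivAt.fun_mul (hPd (e i)).hasDerivAt).deriv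
      rw [hgw, hPi] at this
      simpa using this
    have hgb : ∀ w ∈ ball (0 : ℂ) n, ‖g w‖ ≤ Real.exp (C * (1 + 2 * n) + 1) := by
      intro w hw
      have hmax := Complex.norm_le_of_forall_mem_frontier_norm_le (U := ball (0 : ℂ) (2 * n))
        (C := Real.exp (C * (1 + 2 * n) + 1)) isBounded_ball
        (hg.diffContOnCl) (fun v hv => by
          rw [frontier_ball _ (by positivity), mem_sphere_zero_iff_norm] at hv
          have hPge : 1 ≤ ‖P v‖ := by
            rw [hP]
            simp only [norm_prod]
            refine Finset.one_le_prod fun i hi => ?_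
            have hi' := (hS n i).1 hi
            have hi0 : 0 < ‖e i‖ := norm_pos_iff.2 (hene i)
            have h2 : 2 ≤ ‖v / e i‖ := by
              rw [norm_div, hv, le_div_iff₀ hi0]; linarith
            have := norm_sub_norm_le (v / e i) 1
            rw [norm_sub_rev] at this
            simp only [norm_one] at this
            linarith
          calc ‖g v‖ ≤ ‖g v‖ * ‖P v‖ := le_mul_of_one_le_right (norm_nonneg _) hPge
            _ = ‖f v‖ := by rw [hfg v, norm_mul]
            _ ≤ _ := hC v
            _ ≤ _ := by rw [hv]; exact Real.exp_le_exp.2 (by linarith))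
        (z := w) (subset_closure (by simp at hw ⊢; linarith))
      exact hmax
    have hlem := norm_logDeriv_sub_le hnpos (by positivity) hg.differentiableOn hgne hg0 hgb
      (z := z) (by linarith)
    have hld : ∀ w, f w ≠ 0 → logDeriv f w = logDeriv g w + ∑ i ∈ S n, 1 / (w - e i) := by
      intro w hw
      have hw' := hw
      rw [hfg] at hw'
      have hgw := left_ne_zero_of_mul hw'
      have hPw := right_ne_zero_of_mul hw'
      have hPi : ∀ i ∈ S n, 1 - w / e i ≠ 0 := Finset.prod_ne_zero_iff.1 hPw
      rw [hfgP, logDeriv_mul w hgw hPw (hg w) (hPd w), hP,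
        logDeriv_prod (f := fun i w => 1 - w / e i) hPi (fun i _ => by fun_prop)]
      congr 1
      refine Finset.sum_congr rfl fun i hi => ?_
      have h1 := hPi i hi
      have h2 := hene i
      have h3 : w - e i ≠ 0 := by
        rw [sub_ne_zero]; rintro rfl; exact hw (hez i)
      have hd : deriv (fun w => 1 - w / e i) w = -(1 / e i) := by
        simp
      rw [logDeriv_apply, hd]
      rw [show 1 - w / e i = -(w - e i) / e i by field_simp; ring]
      field_simp
    rw [hld z hz, hld 0 (by simp [h0]), Finset.sum_add_distrib]
    simp only [zero_sub, one_div, inv_neg, Finset.sum_neg_distrib]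
    convert hlem using 2
    ring
  rw [tendsto_iff_norm_sub_tendsto_zero]
  have hlim : Tendsto (fun n : ℕ => 128 * (C * (1 + 2 * (n : ℝ)) + 1) / (n : ℝ) ^ 2 * ‖z‖)
      atTop (𝓝 0) := by
    have h1 : Tendsto (fun n : ℕ => ((n : ℝ))⁻¹) atTop (𝓝 0) := tendsto_inv_atTop_nhds_zero_nat
    have h2 : Tendsto (fun n : ℕ => (128 * (C + 1) * ((n : ℝ)⁻¹ * (n : ℝ)⁻¹) +
        256 * C * (n : ℝ)⁻¹) * ‖z‖) atTop (𝓝 ((128 * (C + 1) * (0 * 0) + 256 * C * 0) * ‖z‖)) :=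
      (((h1.mul h1).const_mul _).add (h1.const_mul _)).mul_const _
    simp only [mul_zero, add_zero, zero_mul] at h2
    refine h2.congr' ?_
    filter_upwards [eventually_gt_atTop 0] with n hn
    have : (n : ℝ) ≠ 0 := by positivity
    field_simp
    ring
  refine squeeze_zero' (Eventually.of_forall fun _ => norm_nonneg _) ?_ hlim
  filter_upwards [tendsto_natCast_atTop_atTop.eventually_gt_atTop (4 * ‖z‖)] with n hn
  rw [norm_sub_rev]
  exact key n hn

open Filter Topology Metric in
/-- Partial fractions on the imaginary axis for an entire function of exponential type all of
whose zeros are real and simple. -/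
theorem hasSum_real_zeros_logDeriv {f : ℂ → ℂ} (hf : Differentiable ℂ f) (h0 : f 0 = 1) {C : ℝ}
    (hC : ∀ z, ‖f z‖ ≤ Real.exp (C * (1 + ‖z‖))) (hs : ∀ z, f z = 0 → deriv f z ≠ 0)
    (hreal : ∀ z, f z = 0 → z.im = 0) {y : ℝ} (hy : 0 < y) :
    HasSum (fun x : {x : ℝ // f x = 0} => y / ((x : ℝ) ^ 2 + y ^ 2))
        ((logDeriv f 0).im - (logDeriv f (y * Complex.I)).im) ∧
      HasSum (fun x : {x : ℝ // f x = 0} => y ^ 2 / ((x : ℝ) * ((x : ℝ) ^ 2 + y ^ 2)))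
        ((logDeriv f (y * Complex.I)).re - (logDeriv f 0).re) := by
  classical
  set e : {x : ℝ // f x = 0} → ℂ := fun x => ((x : ℝ) : ℂ) with he
  have hinj : Function.Injective e := fun x y h => Subtype.ext (Complex.ofReal_injective h)
  have hr : ∀ z, f z = 0 ↔ z ∈ Set.range e := by
    intro z
    constructor
    · intro h
      have hz : ((z.re : ℝ) : ℂ) = z := Complex.ext (by simp) (by simp [hreal z h])
      exact ⟨⟨z.re, by rw [hz]; exact h⟩, hz⟩
    · rintro ⟨x, rfl⟩
      exact x.2
  have hne : ∀ x : {x : ℝ // f x = 0}, (x : ℝ) ≠ 0 := fun x h => by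
    have := x.2
    rw [h] at this
    simp [h0] at this
  have hfin : ∀ n : ℕ, {x : {x : ℝ // f x = 0} | ‖e x‖ < n}.Finite := fun n =>
    ((finite_zeros_ball hf (by simp [h0]) n).preimage hinj.injOn).subset
      fun x hx => ⟨x.2, hx⟩
  set S : ℕ → Finset {x : ℝ // f x = 0} := fun n => (hfin n).toFinset with hS
  have hSmem : ∀ n x, x ∈ S n ↔ ‖e x‖ < n := fun n x => by simp [hS]
  have hStop : Tendsto S atTop atTop := by
    refine tendsto_atTop_finset_of_monotone (fun m n hmn x hx => ?_) fun x => ?_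
    · rw [hSmem] at hx ⊢
      exact hx.trans_le (by exact_mod_cast hmn)
    · obtain ⟨n, hn⟩ := exists_nat_gt ‖e x‖
      exact ⟨n, (hSmem n x).2 hn⟩
  have hIy : f (y * Complex.I) ≠ 0 := fun h => hy.ne' (by simpa using hreal _ h)
  have hlim := tendsto_sum_zeros_logDeriv hf h0 hC hs e hinj hr S hSmem hIy
  have hterm : ∀ x : {x : ℝ // f x = 0}, 1 / (y * Complex.I - e x) + 1 / e x =
      ((y ^ 2 / ((x : ℝ) * ((x : ℝ) ^ 2 + y ^ 2)) : ℝ) : ℂ) -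
        ((y / ((x : ℝ) ^ 2 + y ^ 2) : ℝ) : ℂ) * Complex.I := by
    intro x
    have hx := hne x
    have hxc : ((x : ℝ) : ℂ) ≠ 0 := by exact_mod_cast hx
    have hq : ((x : ℝ) : ℂ) ^ 2 + (y : ℂ) ^ 2 ≠ 0 := by
      have : (0 : ℝ) < (x : ℝ) ^ 2 + y ^ 2 := by positivity
      exact_mod_cast this.ne'
    have hd : (y : ℂ) * Complex.I - ((x : ℝ) : ℂ) ≠ 0 := fun h => by
      have := congrArg Complex.im h
      simp at this
      exact hy.ne' this
    simp only [he]
    push_cast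
    rw [div_add_div _ _ hd hxc]
    field_simp
    linear_combination ((y : ℂ) ^ 2 * (x : ℝ)) * Complex.I_sq
  have h1 : ∀ n, ∑ x ∈ S n, y / ((x : ℝ) ^ 2 + y ^ 2) =
      -(∑ x ∈ S n, (1 / (y * Complex.I - e x) + 1 / e x)).im := by
    intro n
    simp only [hterm, Complex.im_sum, ← Finset.sum_neg_distrib]
    refine Finset.sum_congr rfl fun x _ => ?_
    simp [-Complex.ofReal_div]
  have h2 : ∀ n, ∑ x ∈ S n, y ^ 2 / ((x : ℝ) * ((x : ℝ) ^ 2 + y ^ 2)) =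
      (∑ x ∈ S n, (1 / (y * Complex.I - e x) + 1 / e x)).re := by
    intro n
    simp only [hterm, Complex.re_sum]
    refine Finset.sum_congr rfl fun x _ => ?_
    simp [-Complex.ofReal_div]
  have hl1 : Tendsto (fun n => ∑ x ∈ S n, y / ((x : ℝ) ^ 2 + y ^ 2)) atTop
      (𝓝 ((logDeriv f 0).im - (logDeriv f (y * Complex.I)).im)) := by
    simp only [h1]
    have := (Complex.continuous_im.tendsto _).comp hlim
    rw [← neg_sub, ← Complex.sub_im]
    exact this.neg
  have hl2 : Tendsto (fun n => ∑ x ∈ S n, y ^ 2 / ((x : ℝ) * ((x : ℝ) ^ 2 + y ^ 2))) atTop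
      (𝓝 ((logDeriv f (y * Complex.I)).re - (logDeriv f 0).re)) := by
    simp only [h2]
    rw [← Complex.sub_re]
    exact (Complex.continuous_re.tendsto _).comp hlim
  have hnonneg : ∀ x : {x : ℝ // f x = 0}, 0 ≤ y / ((x : ℝ) ^ 2 + y ^ 2) := fun x => by positivity
  have hmono : Monotone (fun n => ∑ x ∈ S n, y / ((x : ℝ) ^ 2 + y ^ 2)) := by
    intro m n hmn
    refine Finset.sum_le_sum_of_subset_of_nonneg (fun x hx => ?_) fun x _ _ => hnonneg x
    rw [hSmem] at hx ⊢
    exact hx.trans_le (by exact_mod_cast hmn)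
  have hsum1 : Summable (fun x : {x : ℝ // f x = 0} => y / ((x : ℝ) ^ 2 + y ^ 2)) := by
    refine summable_of_sum_le hnonneg
      (c := (logDeriv f 0).im - (logDeriv f (y * Complex.I)).im) fun u => ?_
    obtain ⟨n, hn⟩ := (hStop.eventually_ge_atTop u).exists
    exact (Finset.sum_le_sum_of_subset_of_nonneg hn fun x _ _ => hnonneg x).trans
      (hmono.ge_of_tendsto hl1 n)
  obtain ⟨c, hc, hcz⟩ : ∃ c > 0, ∀ z : ℂ, ‖z‖ < c → f z ≠ 0 := by
    have : ∀ᶠ z in 𝓝 (0 : ℂ), f z ≠ 0 := hf.continuous.continuousAt.eventually_ne (by simp [h0])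
    obtain ⟨c, hc, hcz⟩ := Metric.eventually_nhds_iff.1 this
    exact ⟨c, hc, fun z hz => hcz (by simpa using hz)⟩
  have hsum2 : Summable
      (fun x : {x : ℝ // f x = 0} => y ^ 2 / ((x : ℝ) * ((x : ℝ) ^ 2 + y ^ 2))) := by
    refine Summable.of_norm_bounded (hsum1.mul_left (y / c)) fun x => ?_
    have hxc : c ≤ |(x : ℝ)| := by
      by_contra! h
      exact hcz (x : ℝ) (by simpa using h) x.2
    have hq : (0 : ℝ) < (x : ℝ) ^ 2 + y ^ 2 := by positivity
    rw [Real.norm_eq_abs, abs_div, abs_mul, abs_of_pos hq, abs_of_pos (by positivity : 0 < y ^ 2),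
      div_mul_div_comm, sq]
    gcongr
  exact ⟨(tendsto_nhds_unique (hsum1.hasSum.comp hStop) hl1) ▸ hsum1.hasSum,
    (tendsto_nhds_unique (hsum2.hasSum.comp hStop) hl2) ▸ hsum2.hasSum⟩

/-- The entire function `∑ w ^ k / (k! (m + k)!)`, in terms of which
`J_m(x) = (x / 2) ^ m * besselCore m (-(x / 2) ^ 2)`. -/
noncomputable def besselCore {𝕜 : Type*} [RCLike 𝕜] (m : ℕ) (w : 𝕜) : 𝕜 :=
  ∑' k : ℕ, w ^ k / ((k.factorial : 𝕜) * ((m + k).factorial : 𝕜))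

section BesselCore

variable {𝕜 : Type*} [RCLike 𝕜]

theorem norm_besselCore_term_le (m k : ℕ) (w : 𝕜) :
    ‖w ^ k / ((k.factorial : 𝕜) * ((m + k).factorial : 𝕜))‖ ≤ ‖w‖ ^ k / k.factorial := by
  rw [norm_div, norm_pow, norm_mul, RCLike.norm_natCast, RCLike.norm_natCast]
  have h1 : (0 : ℝ) < k.factorial := by exact_mod_cast k.factorial_pos
  have h2 : (1 : ℝ) ≤ (m + k).factorial := by exact_mod_cast (m + k).factorial_pos
  gcongr
  nlinarith

theorem summable_besselCore (m : ℕ) (w : 𝕜) :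
    Summable fun k : ℕ => w ^ k / ((k.factorial : 𝕜) * ((m + k).factorial : 𝕜)) :=
  .of_norm_bounded (Real.summable_pow_div_factorial ‖w‖) fun k => norm_besselCore_term_le m k w

theorem besselCore_ofReal (m : ℕ) (x : ℝ) : besselCore m (x : 𝕜) = ((besselCore m x : ℝ) : 𝕜) := by
  simp only [besselCore, RCLike.ofReal_tsum]
  push_cast
  rfl

theorem besselCore_zero (m : ℕ) : besselCore m (0 : 𝕜) = 1 / (m.factorial : 𝕜) := by
  rw [besselCore, tsum_eq_single 0 (fun k hk => by simp [hk])]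
  simp

theorem hasDerivAt_besselCore (m : ℕ) (w : 𝕜) :
    HasDerivAt (besselCore m) (besselCore (m + 1) w) w := by
  have hshift : ∀ y : 𝕜, besselCore (m + 1) y = ∑' k : ℕ, (k : 𝕜) * y ^ (k - 1) /
      ((k.factorial : 𝕜) * ((m + k).factorial : 𝕜)) := by
    intro y
    have hterm : ∀ k : ℕ, ((k + 1 : ℕ) : 𝕜) * y ^ (k + 1 - 1) /
        (((k + 1).factorial : 𝕜) * ((m + (k + 1)).factorial : 𝕜)) =
        y ^ k / ((k.factorial : 𝕜) * ((m + 1 + k).factorial : 𝕜)) := by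
      intro k
      have h1 : (k.factorial : 𝕜) ≠ 0 := by exact_mod_cast k.factorial_ne_zero
      have h2 : ((m + 1 + k).factorial : 𝕜) ≠ 0 := by exact_mod_cast (m + 1 + k).factorial_ne_zero
      have h3 : ((k + 1 : ℕ) : 𝕜) ≠ 0 := by exact_mod_cast k.succ_ne_zero
      rw [Nat.factorial_succ, show m + (k + 1) = m + 1 + k by ring, Nat.cast_mul]
      simp only [add_tsub_cancel_right]
      field_simp
    have hs : Summable fun k : ℕ => (k : 𝕜) * y ^ (k - 1) /
        ((k.factorial : 𝕜) * ((m + k).factorial : 𝕜)) := by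
      rw [← summable_nat_add_iff 1]
      simp only [hterm]
      exact summable_besselCore (m + 1) y
    rw [hs.tsum_eq_zero_add]
    simp only [hterm]
    simp [besselCore]
  rw [hshift]
  set R := ‖w‖ + 1
  have hsR : Summable fun k : ℕ => (k : ℝ) * R ^ (k - 1) / (k.factorial : ℝ) := by
    rw [← summable_nat_add_iff 1]
    refine (Real.summable_pow_div_factorial R).congr fun k => ?_
    have h1 : (k.factorial : ℝ) ≠ 0 := by exact_mod_cast k.factorial_ne_zero
    have h3 : ((k + 1 : ℕ) : ℝ) ≠ 0 := by exact_mod_cast k.succ_ne_zero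
    rw [Nat.factorial_succ, Nat.cast_mul]
    simp only [add_tsub_cancel_right]
    field_simp
  refine hasDerivAt_tsum_of_isPreconnected (u := fun k : ℕ => (k : ℝ) * R ^ (k - 1) / k.factorial)
    (g := fun (k : ℕ) (y : 𝕜) => y ^ k / ((k.factorial : 𝕜) * ((m + k).factorial : 𝕜)))
    (g' := fun (k : ℕ) (y : 𝕜) => (k : 𝕜) * y ^ (k - 1) /
      ((k.factorial : 𝕜) * ((m + k).factorial : 𝕜))) (t := Metric.ball 0 R) (y₀ := 0) hsR
    Metric.isOpen_ball ((convex_ball (0 : 𝕜) R).isPreconnected) ?_ ?_ ?_ ?_ ?_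
  · intro k y _
    exact (hasDerivAt_pow k y).div_const _
  · intro k y hy
    have hy' : ‖y‖ ≤ R := by simpa using (Metric.mem_ball.1 hy).le
    rw [norm_div, norm_mul, norm_pow, norm_mul, RCLike.norm_natCast, RCLike.norm_natCast,
      RCLike.norm_natCast]
    have h1 : (0 : ℝ) < k.factorial := by exact_mod_cast k.factorial_pos
    have h2 : (1 : ℝ) ≤ (m + k).factorial := by exact_mod_cast (m + k).factorial_pos
    gcongr
    nlinarith
  · simp [R]; positivity
  · exact summable_besselCore m 0
  · simp [R]

theorem besselCore_recurrence (m : ℕ) (w : 𝕜) :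
    besselCore m w = (m + 1) * besselCore (m + 1) w + w * besselCore (m + 2) w := by
  have h1 := summable_besselCore (m + 1) w
  have h2 := summable_besselCore (m + 2) w
  have hs : Summable fun k : ℕ => (k : 𝕜) * (w ^ k /
      ((k.factorial : 𝕜) * ((m + 1 + k).factorial : 𝕜))) := by
    rw [← summable_nat_add_iff 1]
    refine (h2.mul_left w).congr fun k => ?_
    have h1 : (k.factorial : 𝕜) ≠ 0 := by exact_mod_cast k.factorial_ne_zero
    have h2 : ((m + 2 + k).factorial : 𝕜) ≠ 0 := by exact_mod_cast (m + 2 + k).factorial_ne_zero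
    have h3 : ((k + 1 : ℕ) : 𝕜) ≠ 0 := by exact_mod_cast k.succ_ne_zero
    rw [Nat.factorial_succ, show m + 1 + (k + 1) = m + 2 + k by ring, Nat.cast_mul]
    field_simp
    ring
  have hw : w * besselCore (m + 2) w = ∑' k : ℕ, (k : 𝕜) * (w ^ k /
      ((k.factorial : 𝕜) * ((m + 1 + k).factorial : 𝕜))) := by
    rw [hs.tsum_eq_zero_add, besselCore, ← tsum_mul_left]
    simp only [Nat.cast_zero, zero_mul, zero_add]
    refine tsum_congr fun k => ?_
    have h1 : (k.factorial : 𝕜) ≠ 0 := by exact_mod_cast k.factorial_ne_zero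
    have h2 : ((m + 2 + k).factorial : 𝕜) ≠ 0 := by exact_mod_cast (m + 2 + k).factorial_ne_zero
    have h3 : ((k + 1 : ℕ) : 𝕜) ≠ 0 := by exact_mod_cast k.succ_ne_zero
    rw [Nat.factorial_succ, show m + 1 + (k + 1) = m + 2 + k by ring, Nat.cast_mul]
    field_simp
    ring
  rw [hw, besselCore, besselCore, ← tsum_mul_left, ← (h1.mul_left _).tsum_add hs]
  refine tsum_congr fun k => ?_
  have h1 : (k.factorial : 𝕜) ≠ 0 := by exact_mod_cast k.factorial_ne_zero
  have h2 : ((m + k).factorial : 𝕜) ≠ 0 := by exact_mod_cast (m + k).factorial_ne_zero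
  have h3 : ((m + k + 1 : ℕ) : 𝕜) ≠ 0 := by exact_mod_cast (m + k).succ_ne_zero
  rw [show m + 1 + k = m + k + 1 by ring, Nat.factorial_succ, Nat.cast_mul]
  push_cast at h3 ⊢
  field_simp
  ring

theorem norm_besselCore_sq_le (m : ℕ) (w z : 𝕜) (hw : ‖w‖ = (‖z‖ / 2) ^ 2) :
    ‖besselCore m w‖ ≤ Real.exp ‖z‖ := by
  have hterm : ∀ k : ℕ, ‖w ^ k / ((k.factorial : 𝕜) * ((m + k).factorial : 𝕜))‖ ≤
      ‖z‖ ^ (2 * k) / ((2 * k).factorial : ℝ) := by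
    intro k
    rw [norm_div, norm_pow, norm_mul, RCLike.norm_natCast, RCLike.norm_natCast, hw,
      ← pow_mul, div_pow, div_div]
    have h1 : (2 * k).factorial ≤ 2 ^ (2 * k) * (k.factorial * (m + k).factorial) := by
      have hc := Nat.choose_mul_factorial_mul_factorial (n := 2 * k) (k := k) (by omega)
      rw [show 2 * k - k = k by omega] at hc
      rw [← hc, mul_assoc]
      exact Nat.mul_le_mul (Nat.choose_le_two_pow _ _)
        (Nat.mul_le_mul_left _ (Nat.factorial_le (by omega)))
    have h2 : (0 : ℝ) < (2 * k).factorial := by exact_mod_cast Nat.factorial_pos _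
    gcongr
    exact_mod_cast h1
  have hs := Real.summable_pow_div_factorial ‖z‖
  have hinj : Function.Injective fun k : ℕ => 2 * k := fun a b h => by simpa using h
  refine (tsum_of_norm_bounded (hs.comp_injective hinj).hasSum hterm).trans ?_
  rw [Real.exp_eq_exp_ℝ, NormedSpace.exp_eq_tsum_div]
  exact tsum_comp_le_tsum_of_inj hs (fun k => by positivity) hinj

theorem hasDerivAt_besselCore_sq (m : ℕ) (c z : 𝕜) :
    HasDerivAt (fun z : 𝕜 => besselCore m (c * (z / 2) ^ 2))
      (c * (z / 2 * besselCore (m + 1) (c * (z / 2) ^ 2))) z := by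
  have h := ((((hasDerivAt_id z).div_const 2).pow 2).const_mul c)
  have h2 := (hasDerivAt_besselCore m (c * (z / 2) ^ 2)).comp z h
  refine h2.congr_deriv ?_
  simp
  ring

theorem hasDerivAt_mul_besselCore_sq (m : ℕ) (c z : 𝕜) :
    HasDerivAt (fun z : 𝕜 => z / 2 * besselCore (m + 1) (c * (z / 2) ^ 2))
      (besselCore m (c * (z / 2) ^ 2) -
        (2 * m + 1) / 2 * besselCore (m + 1) (c * (z / 2) ^ 2)) z := by
  have h := ((hasDerivAt_id z).div_const 2).fun_mul (hasDerivAt_besselCore_sq (m + 1) c z)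
  refine h.congr_deriv ?_
  rw [besselCore_recurrence m]
  simp
  ring

end BesselCore

section RotatedBessel

variable {𝕜 : Type*} [RCLike 𝕜]

/-- For `c = -1` this is `(z / 2) ^ (-ℓ) * J_ℓ(z)`, for `c = 1` it is `(z / 2) ^ (-ℓ) * I_ℓ(z)`. -/
noncomputable def besselA (ℓ : ℕ) (c z : 𝕜) : 𝕜 := besselCore ℓ (c * (z / 2) ^ 2)

/-- For `c = -1` this is `(z / 2) ^ (-ℓ) * J_{ℓ+1}(z)`, for `c = 1` it is
`(z / 2) ^ (-ℓ) * I_{ℓ+1}(z)`. -/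
noncomputable def besselB (ℓ : ℕ) (c z : 𝕜) : 𝕜 := z / 2 * besselCore (ℓ + 1) (c * (z / 2) ^ 2)

theorem hasDerivAt_besselA (ℓ : ℕ) (c z : 𝕜) :
    HasDerivAt (besselA ℓ c) (c * besselB ℓ c z) z :=
  hasDerivAt_besselCore_sq ℓ c z

theorem hasDerivAt_besselB (ℓ : ℕ) (c z : 𝕜) :
    HasDerivAt (besselB ℓ c)
      (besselA ℓ c z - (2 * ℓ + 1) / 2 * besselCore (ℓ + 1) (c * (z / 2) ^ 2)) z :=
  hasDerivAt_mul_besselCore_sq ℓ c z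

theorem continuous_besselA (ℓ : ℕ) (c : 𝕜) : Continuous (besselA ℓ c) :=
  continuous_iff_continuousAt.2 fun z => (hasDerivAt_besselA ℓ c z).continuousAt

theorem continuous_besselB (ℓ : ℕ) (c : 𝕜) : Continuous (besselB ℓ c) :=
  continuous_iff_continuousAt.2 fun z => (hasDerivAt_besselB ℓ c z).continuousAt

theorem besselA_zero (ℓ : ℕ) (c : 𝕜) : besselA ℓ c 0 = 1 / (ℓ.factorial : 𝕜) := by
  simp [besselA, besselCore_zero]

theorem besselB_zero (ℓ : ℕ) (c : 𝕜) : besselB ℓ c 0 = 0 := by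
  simp [besselB]

theorem besselA_neg (ℓ : ℕ) (c z : 𝕜) : besselA ℓ c (-z) = besselA ℓ c z := by
  simp [besselA, neg_div]

theorem besselB_neg (ℓ : ℕ) (c z : 𝕜) : besselB ℓ c (-z) = -besselB ℓ c z := by
  simp [besselB, neg_div]

theorem besselA_ofReal (ℓ : ℕ) (x : ℝ) :
    besselA ℓ (-1) (x : ℂ) = ((besselA ℓ (-1) x : ℝ) : ℂ) := by
  have h := besselCore_ofReal (𝕜 := ℂ) ℓ (-1 * (x / 2) ^ 2)
  simp only [besselA]
  push_cast at h
  simpa using h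

theorem besselB_ofReal (ℓ : ℕ) (x : ℝ) :
    besselB ℓ (-1) (x : ℂ) = ((besselB ℓ (-1) x : ℝ) : ℂ) := by
  have h := besselCore_ofReal (𝕜 := ℂ) (ℓ + 1) (-1 * (x / 2) ^ 2)
  simp only [besselB]
  push_cast at h ⊢
  exact congrArg _ (by simpa using h)

end RotatedBessel

theorem pos_of_hasDerivAt_pow_mul {f g : ℝ → ℝ} {n : ℕ} {x : ℝ} (hx : 0 < x)
    (hd : ∀ t, HasDerivAt f (t ^ n * g t) t) (hg : Continuous g) (h0 : f 0 = 0)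
    (hgn : ∀ t ∈ Set.Ioo 0 x, 0 ≤ g t) (hg0 : 0 < g 0) : 0 < f x := by
  have hcont : Continuous fun t : ℝ => t ^ n * g t := by fun_prop
  have hFTC := intervalIntegral.integral_eq_sub_of_hasDerivAt (a := 0) (b := x)
    (fun t _ => hd t) (hcont.intervalIntegrable _ _)
  rw [h0, sub_zero] at hFTC
  rw [← hFTC]
  have hx' : 0 ≤ g x := by
    have hcl : Set.Icc (0 : ℝ) x ⊆ g ⁻¹' Set.Ici 0 := by
      rw [← closure_Ioo hx.ne]
      exact closure_minimal (fun t ht => hgn t ht) (isClosed_Ici.preimage hg)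
    exact hcl (Set.right_mem_Icc.2 hx.le)
  refine intervalIntegral.integral_pos hx hcont.continuousOn ?_ ?_
  · intro t ht
    rcases ht.2.eq_or_lt with rfl | h
    · exact mul_nonneg (pow_nonneg hx.le _) hx'
    · exact mul_nonneg (pow_nonneg ht.1.le _) (hgn t ⟨ht.1, h⟩)
  · have h1 : ∀ᶠ t in nhdsWithin (0 : ℝ) (Set.Ioi 0), 0 < g t :=
      (hg.tendsto 0).eventually (lt_mem_nhds hg0) |>.filter_mono nhdsWithin_le_nhds
    have h2 : ∀ᶠ t in nhdsWithin (0 : ℝ) (Set.Ioi 0), t ∈ Set.Ioo 0 x := Ioo_mem_nhdsGT hx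
    obtain ⟨t, ht1, ht2⟩ := (h1.and h2).exists
    exact ⟨t, ⟨ht2.1.le, ht2.2.le⟩, mul_pos (pow_pos ht2.1 _) ht1⟩

theorem besselA_besselB_ineq_of_pos (ℓ : ℕ) {x : ℝ} (hx : 0 < x) :
    (2 * ℓ + 1) * (besselA ℓ (-1) x * besselB ℓ (-1) x) <
      x * (besselA ℓ (-1) x ^ 2 + besselB ℓ (-1) x ^ 2) := by
  have key := pos_of_hasDerivAt_pow_mul (n := 2 * ℓ + 1) hx
    (f := fun t => t ^ (2 * ℓ + 1) * (t * (besselA ℓ (-1) t ^ 2 + besselB ℓ (-1) t ^ 2) -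
      (2 * ℓ + 1) * (besselA ℓ (-1) t * besselB ℓ (-1) t)))
    (g := fun t => besselA ℓ (-1) t ^ 2 + besselB ℓ (-1) t ^ 2) ?_ ?_ (by simp)
    (fun t _ => by positivity) (by simp [besselA_zero, besselB_zero]; positivity)
  · have := pos_of_mul_pos_right key (by positivity)
    linarith
  · intro t
    have hA := hasDerivAt_besselA ℓ (-1 : ℝ) t
    have hB := hasDerivAt_besselB ℓ (-1 : ℝ) t
    have h := (hasDerivAt_pow (2 * ℓ + 1) t).fun_mul
      (((hasDerivAt_id t).fun_mul ((hA.fun_pow 2).fun_add (hB.fun_pow 2))).fun_sub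
        ((hA.fun_mul hB).const_mul (2 * (ℓ : ℝ) + 1)))
    refine h.congr_deriv ?_
    simp only [besselB, id]
    push_cast
    simp only [pow_succ]
    ring
  · exact ((continuous_besselA ℓ _).pow 2).add ((continuous_besselB ℓ _).pow 2)

theorem besselA_besselB_ineq (ℓ : ℕ) {x : ℝ} (hx : x ≠ 0) :
    x * ((2 * ℓ + 1) * (besselA ℓ (-1) x * besselB ℓ (-1) x)) <
      x ^ 2 * (besselA ℓ (-1) x ^ 2 + besselB ℓ (-1) x ^ 2) := by
  rcases hx.lt_or_gt with h | h
  · have := besselA_besselB_ineq_of_pos ℓ (neg_pos.2 h)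
    rw [besselA_neg, besselB_neg] at this
    nlinarith
  · have := besselA_besselB_ineq_of_pos ℓ h
    nlinarith

/-- The entire function whose positive zeros are those of `J_ℓ - a J_{ℓ+1}` and whose negative zeros
are the negatives of the positive zeros of `J_ℓ + a J_{ℓ+1}`. -/
noncomputable def bagFun (ℓ : ℕ) (a : ℝ) (z : ℂ) : ℂ :=
  ℓ.factorial * (besselA ℓ (-1) z - a * besselB ℓ (-1) z)

theorem bagFun_zero (ℓ : ℕ) (a : ℝ) : bagFun ℓ a 0 = 1 := by
  have : (ℓ.factorial : ℂ) ≠ 0 := by exact_mod_cast ℓ.factorial_ne_zero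
  simp [bagFun, besselA_zero, besselB_zero, this]

theorem hasDerivAt_bagFun (ℓ : ℕ) (a : ℝ) (z : ℂ) :
    HasDerivAt (bagFun ℓ a) (ℓ.factorial * (-besselB ℓ (-1) z - a * (besselA ℓ (-1) z -
      (2 * ℓ + 1) / 2 * besselCore (ℓ + 1) (-1 * (z / 2) ^ 2)))) z := by
  refine (((hasDerivAt_besselA ℓ (-1) z).fun_sub
    ((hasDerivAt_besselB ℓ (-1) z).const_mul (a : ℂ))).const_mul (ℓ.factorial : ℂ)).congr_deriv ?_
  ring

theorem differentiable_bagFun (ℓ : ℕ) (a : ℝ) : Differentiable ℂ (bagFun ℓ a) :=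
  fun z => (hasDerivAt_bagFun ℓ a z).differentiableAt

theorem bagFun_eq_zero_iff (ℓ : ℕ) (a : ℝ) (z : ℂ) :
    bagFun ℓ a z = 0 ↔ besselA ℓ (-1) z = a * besselB ℓ (-1) z := by
  have : (ℓ.factorial : ℂ) ≠ 0 := by exact_mod_cast ℓ.factorial_ne_zero
  simp [bagFun, this, sub_eq_zero]

theorem bagFun_ofReal_eq_zero_iff (ℓ : ℕ) (a x : ℝ) :
    bagFun ℓ a x = 0 ↔ besselA ℓ (-1) x = a * besselB ℓ (-1) x := by
  rw [bagFun_eq_zero_iff, besselA_ofReal, besselB_ofReal]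
  norm_cast

theorem norm_bagFun_le (ℓ : ℕ) (a : ℝ) :
    ∃ C : ℝ, ∀ z, ‖bagFun ℓ a z‖ ≤ Real.exp (C * (1 + ‖z‖)) := by
  refine ⟨Real.log ℓ.factorial + |a| + 1, fun z => ?_⟩
  have hf : (1 : ℝ) ≤ ℓ.factorial := by exact_mod_cast ℓ.factorial_pos
  have hw : ‖(-1 : ℂ) * (z / 2) ^ 2‖ = (‖z‖ / 2) ^ 2 := by simp
  have hA : ‖besselA ℓ (-1) z‖ ≤ Real.exp ‖z‖ := norm_besselCore_sq_le ℓ _ z hw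
  have hB : ‖besselB ℓ (-1) z‖ ≤ ‖z‖ / 2 * Real.exp ‖z‖ := by
    rw [besselB, norm_mul]
    have := norm_besselCore_sq_le (ℓ + 1) _ z hw
    simp only [Complex.norm_div, Complex.norm_ofNat]
    gcongr
  have h1 : ‖bagFun ℓ a z‖ ≤ ℓ.factorial * (1 + |a| * ‖z‖) * Real.exp ‖z‖ := by
    rw [bagFun, norm_mul, RCLike.norm_natCast, mul_assoc]
    gcongr
    refine (norm_sub_le _ _).trans ?_
    rw [norm_mul, Complex.norm_real, Real.norm_eq_abs]
    have h2 : |a| * ‖besselB ℓ (-1) z‖ ≤ |a| * (‖z‖ / 2 * Real.exp ‖z‖) := by gcongr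
    have h3 : 0 ≤ |a| * ‖z‖ * Real.exp ‖z‖ := by positivity
    linarith
  refine h1.trans ?_
  have h4 : (ℓ.factorial : ℝ) = Real.exp (Real.log ℓ.factorial) := (Real.exp_log (by linarith)).symm
  have h5 : 1 + |a| * ‖z‖ ≤ Real.exp (|a| * ‖z‖) := by
    linarith [Real.add_one_le_exp (|a| * ‖z‖)]
  have h6 := Real.log_nonneg hf
  calc _ ≤ Real.exp (Real.log ℓ.factorial) * Real.exp (|a| * ‖z‖) * Real.exp ‖z‖ := by
        rw [← h4]; gcongr
    _ = Real.exp (Real.log ℓ.factorial + |a| * ‖z‖ + ‖z‖) := by rw [← Real.exp_add, ← Real.exp_add]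
    _ ≤ _ := by
        gcongr
        have := norm_nonneg z
        have := abs_nonneg a
        nlinarith

theorem im_eq_zero_of_bagFun_eq_zero (ℓ : ℕ) (a : ℝ) {z : ℂ} (hz : bagFun ℓ a z = 0) :
    z.im = 0 := by
  by_contra him
  have key := pos_of_hasDerivAt_pow_mul (n := 2 * ℓ + 1) zero_lt_one
    (f := fun t : ℝ => t ^ (2 * ℓ + 1) * (z.im * ((starRingEnd ℂ) (besselA ℓ (-1) (t * z)) *
      besselB ℓ (-1) (t * z)).im))
    (g := fun t => z.im ^ 2 * (Complex.normSq (besselA ℓ (-1) (t * z)) +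
      Complex.normSq (besselB ℓ (-1) (t * z)))) ?_ ?_ (by simp)
    (fun t _ => mul_nonneg (sq_nonneg _)
      (add_nonneg (Complex.normSq_nonneg _) (Complex.normSq_nonneg _))) ?_
  · rw [bagFun_eq_zero_iff] at hz
    simp only [one_pow, Complex.ofReal_one, one_mul, hz] at key
    simp only [map_mul, Complex.conj_ofReal, mul_assoc] at key
    rw [← Complex.normSq_eq_conj_mul_self, ← Complex.ofReal_mul, Complex.ofReal_im] at key
    simp at key
  · intro t
    have hlin : HasDerivAt (fun t : ℝ => (t : ℂ) * z) z t := by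
      simpa using (Complex.ofRealCLM.hasDerivAt (x := t)).mul_const z
    have hA := (hasDerivAt_besselA ℓ (-1 : ℂ) (t * z)).comp_of_eq t hlin rfl
    have hB := (hasDerivAt_besselB ℓ (-1 : ℂ) (t * z)).comp_of_eq t hlin rfl
    have hAc := (Complex.conjCLE.toContinuousLinearMap.hasFDerivAt.comp_hasDerivAt t hA)
    have hI := Complex.imCLM.hasFDerivAt.comp_hasDerivAt t (hAc.fun_mul hB)
    have h := (hasDerivAt_pow (2 * ℓ + 1) t).fun_mul (hI.const_mul z.im)
    refine h.congr_deriv ?_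
    simp only [besselB, Function.comp, ContinuousLinearEquiv.coe_coe, Complex.imCLM_apply,
      Complex.conjCLE_apply]
    generalize besselA ℓ (-1) (t * z) = A
    generalize besselCore (ℓ + 1) (-1 * ((t : ℂ) * z / 2) ^ 2) = v
    simp [Complex.normSq_apply, -map_mul, -map_div₀]
    ring
  · have hA := (continuous_besselA ℓ (-1 : ℂ))
    have hB := (continuous_besselB ℓ (-1 : ℂ))
    have := Complex.continuous_normSq
    fun_prop
  · have : (ℓ.factorial : ℂ) ≠ 0 := by exact_mod_cast ℓ.factorial_ne_zero
    simp only [Complex.ofReal_zero, zero_mul, besselA_zero, besselB_zero, map_zero, add_zero]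
    exact mul_pos (by positivity) (Complex.normSq_pos.2 (by simpa using this))

theorem deriv_bagFun_ne_zero (ℓ : ℕ) (a : ℝ) {z : ℂ} (hz : bagFun ℓ a z = 0) :
    deriv (bagFun ℓ a) z ≠ 0 := by
  obtain ⟨x, rfl⟩ : ∃ x : ℝ, z = x :=
    ⟨z.re, Complex.ext rfl (by simpa using im_eq_zero_of_bagFun_eq_zero ℓ a hz)⟩
  have hx : x ≠ 0 := by
    rintro rfl
    simp [bagFun_zero] at hz
  rw [bagFun_ofReal_eq_zero_iff] at hz
  have hq := besselA_besselB_ineq ℓ hx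
  intro h
  rw [(hasDerivAt_bagFun ℓ a x).deriv] at h
  have hf : (ℓ.factorial : ℂ) ≠ 0 := by exact_mod_cast ℓ.factorial_ne_zero
  have h1 := (mul_eq_zero.1 h).resolve_left hf
  have h2 : (x : ℂ) * (-besselB ℓ (-1) (x : ℂ) - a * besselA ℓ (-1) (x : ℂ)) +
      a * (2 * ℓ + 1) * besselB ℓ (-1) (x : ℂ) = 0 := by
    have h3 : besselB ℓ (-1) (x : ℂ) = x / 2 * besselCore (ℓ + 1) (-1 * ((x : ℂ) / 2) ^ 2) := rfl
    linear_combination (x : ℂ) * h1 + a * (2 * ℓ + 1) * h3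
  rw [besselA_ofReal, besselB_ofReal] at h2
  have h4 : x * (-besselB ℓ (-1) x - a * besselA ℓ (-1) x) +
      a * (2 * ℓ + 1) * besselB ℓ (-1) x = 0 := by exact_mod_cast h2
  rw [hz] at h4 hq
  have h5 := congrArg (fun t => t * (x * besselB ℓ (-1) x)) h4
  simp only [zero_mul] at h5
  nlinarith

/-- A zero of `besselA - a * besselB` with sign opposite to that of `a` is at least `ℓ + 1 / 2`. -/
theorem le_of_besselA_eq_neg_mul (ℓ : ℕ) {a x : ℝ} (ha : a ≤ 0) (hx : 0 < x)
    (h : besselA ℓ (-1) x = a * besselB ℓ (-1) x) : (2 * ℓ + 1) / 2 ≤ x := by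
  by_contra! hlt
  have hAc := continuous_besselA ℓ (-1 : ℝ)
  have hBc := continuous_besselB ℓ (-1 : ℝ)
  have hA0 : 0 < besselA ℓ (-1 : ℝ) 0 := by rw [besselA_zero]; positivity
  have hAB : ∀ t ∈ Set.Icc 0 x, besselB ℓ (-1) t < besselA ℓ (-1) t := by
    intro t ht
    by_contra! hle
    obtain ⟨u, hu, hu0⟩ := intermediate_value_Icc' (f := fun t => besselA ℓ (-1) t -
      besselB ℓ (-1) t) ht.1 (hAc.sub hBc).continuousOn
      (show (0 : ℝ) ∈ Set.Icc _ _ from ⟨by linarith, by simp [besselB_zero, hA0.le]⟩)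
    have hu0' : besselA ℓ (-1) u = besselB ℓ (-1) u := by simpa [sub_eq_zero] using hu0
    have hupos : 0 < u := by
      refine hu.1.lt_of_ne ?_
      rintro rfl
      rw [besselB_zero] at hu0'
      linarith
    have hq := besselA_besselB_ineq_of_pos ℓ hupos
    rw [hu0'] at hq
    have hB2 := sq_nonneg (besselB ℓ (-1) u)
    have : u < (2 * ℓ + 1) / 2 := (hu.2.trans ht.2).trans_lt hlt
    nlinarith
  have hB : 0 < Real.exp (-x) * (x ^ (2 * ℓ + 1) * besselB ℓ (-1) x) := by
    refine pos_of_hasDerivAt_pow_mul (n := 2 * ℓ + 1) hx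
      (f := fun t => Real.exp (-t) * (t ^ (2 * ℓ + 1) * besselB ℓ (-1) t))
      (g := fun t => Real.exp (-t) * (besselA ℓ (-1) t - besselB ℓ (-1) t)) ?_ ?_ (by simp) ?_ ?_
    · intro t
      refine (((hasDerivAt_id t).fun_neg.exp).fun_mul ((hasDerivAt_pow (2 * ℓ + 1) t).fun_mul
        (hasDerivAt_besselB ℓ (-1 : ℝ) t))).congr_deriv ?_
      simp only [besselB, id]
      push_cast
      simp only [pow_succ]
      ring
    · fun_prop
    · exact fun t ht => mul_nonneg (Real.exp_pos _).le
        (by linarith [hAB t (Set.Ioo_subset_Icc_self ht)])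
    · simp [besselB_zero, hA0]
  have hBpos := pos_of_mul_pos_right (pos_of_mul_pos_right hB (Real.exp_pos _).le) (by positivity)
  have := hAB x (Set.right_mem_Icc.2 hx.le)
  nlinarith

theorem abs_le_of_bagFun_eq_zero (ℓ : ℕ) (a : ℝ) {x : ℝ} (h : bagFun ℓ a x = 0) :
    (2 * ℓ + 1) * |a| ≤ (1 + a ^ 2) * |x| := by
  have hx : x ≠ 0 := by
    rintro rfl
    simp [bagFun_zero] at h
  rw [bagFun_ofReal_eq_zero_iff] at h
  have hq := besselA_besselB_ineq ℓ hx
  have hB : 0 < besselB ℓ (-1) x ^ 2 := by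
    refine lt_of_le_of_ne (sq_nonneg _) fun h0 => ?_
    have h0' : besselB ℓ (-1) x = 0 := by simpa using h0.symm
    rw [h, h0'] at hq
    simp at hq
  have h1 : (2 * ℓ + 1) * (a * x) < (1 + a ^ 2) * x ^ 2 := by
    rw [h] at hq
    refine lt_of_mul_lt_mul_right ?_ hB.le
    nlinarith
  have hopp : a * x ≤ 0 → (2 * ℓ + 1) / 2 ≤ |x| := by
    intro hax
    rcases hx.lt_or_gt with hneg | hpos
    · rw [abs_of_neg hneg]
      refine le_of_besselA_eq_neg_mul ℓ (a := -a) (by nlinarith) (neg_pos.2 hneg) ?_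
      rw [besselA_neg, besselB_neg, h]
      ring
    · rw [abs_of_pos hpos]
      exact le_of_besselA_eq_neg_mul ℓ (by nlinarith) hpos h
  rcases le_or_gt (a * x) 0 with hax | hax
  · have h2 := hopp hax
    have h3 : 2 * |a| ≤ 1 + a ^ 2 := by nlinarith [sq_nonneg (|a| - 1), sq_abs a]
    nlinarith [abs_nonneg a, sq_nonneg a]
  · have h4 : a * x = |a| * |x| := by rw [← abs_mul, abs_of_pos hax]
    rw [h4, ← sq_abs x] at h1
    have h5 : 0 < |x| := abs_pos.2 hx
    refine le_of_mul_le_mul_right ?_ h5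
    nlinarith

open Complex in
theorem besselA_mul_I (ℓ : ℕ) (y : ℝ) :
    besselA ℓ (-1) (y * I) = ((besselA ℓ 1 y : ℝ) : ℂ) := by
  have h := besselCore_ofReal (𝕜 := ℂ) ℓ (1 * (y / 2) ^ 2)
  have h2 : (-1 : ℂ) * (y * I / 2) ^ 2 = ((1 * (y / 2) ^ 2 : ℝ) : ℂ) := by
    push_cast
    linear_combination (-(y : ℂ) ^ 2 / 4) * I_sq
  rw [besselA, h2]
  exact h

open Complex in
theorem besselCore_mul_I (ℓ : ℕ) (y : ℝ) :
    besselCore ℓ (-1 * (y * I / 2) ^ 2) = ((besselCore ℓ (1 * (y / 2) ^ 2) : ℝ) : ℂ) :=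
  besselA_mul_I ℓ y

open Complex in
theorem besselB_mul_I (ℓ : ℕ) (y : ℝ) :
    besselB ℓ (-1) (y * I) = I * ((besselB ℓ 1 y : ℝ) : ℂ) := by
  rw [besselB, besselCore_mul_I, besselB]
  push_cast
  ring

theorem besselCore_nonneg (ℓ : ℕ) {w : ℝ} (hw : 0 ≤ w) : 0 ≤ besselCore ℓ w :=
  tsum_nonneg fun k => by positivity

theorem besselA_one_pos (ℓ : ℕ) (y : ℝ) : 0 < besselA ℓ 1 y := by
  have hs := summable_besselCore ℓ (1 * (y / 2) ^ 2)
  have h0 : ∀ k : ℕ, 0 ≤ (1 * (y / 2) ^ 2) ^ k / ((k.factorial : ℝ) * ((ℓ + k).factorial : ℝ)) :=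
    fun k => by positivity
  have h1 : 0 < (1 * (y / 2) ^ 2) ^ 0 /
      (((0 : ℕ).factorial : ℝ) * ((ℓ + 0).factorial : ℝ)) := by
    rw [pow_zero]
    positivity
  exact h1.trans_le (hs.le_tsum 0 fun k _ => h0 k)

/-- The ratio `I_{ℓ+1}(y) / I_ℓ(y)` of modified Bessel functions. -/
noncomputable def besselRatio (ℓ : ℕ) (y : ℝ) : ℝ := besselB ℓ 1 y / besselA ℓ 1 y

/-- The continuous extension of `(2 ℓ + 1) * besselRatio ℓ y / y`. -/
noncomputable def besselRatioDiv (ℓ : ℕ) (y : ℝ) : ℝ :=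
  (2 * ℓ + 1) / 2 * besselCore (ℓ + 1) (1 * (y / 2) ^ 2) / besselA ℓ 1 y

theorem mul_besselRatioDiv (ℓ : ℕ) (y : ℝ) :
    y * besselRatioDiv ℓ y = (2 * ℓ + 1) * besselRatio ℓ y := by
  rw [besselRatioDiv, besselRatio, besselB]
  ring

theorem besselRatioDiv_nonneg (ℓ : ℕ) (y : ℝ) : 0 ≤ besselRatioDiv ℓ y :=
  div_nonneg (mul_nonneg (by positivity) (besselCore_nonneg _ (by positivity)))
    (besselA_one_pos ℓ y).le

theorem besselRatio_zero (ℓ : ℕ) : besselRatio ℓ 0 = 0 := by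
  simp [besselRatio, besselB_zero]

theorem besselRatio_nonneg (ℓ : ℕ) {y : ℝ} (hy : 0 ≤ y) : 0 ≤ besselRatio ℓ y :=
  div_nonneg (mul_nonneg (by positivity) (besselCore_nonneg _ (by positivity)))
    (besselA_one_pos ℓ y).le

theorem besselRatio_le (ℓ : ℕ) {y : ℝ} (hy : 0 ≤ y) : besselRatio ℓ y ≤ y / (2 * (ℓ + 1)) := by
  have hA := besselA_one_pos ℓ y
  rw [besselRatio, div_le_div_iff₀ hA (by positivity), besselB, besselA,
    besselCore_recurrence ℓ]
  have h2 : 0 ≤ y * (1 * (y / 2) ^ 2 * besselCore (ℓ + 2) (1 * (y / 2) ^ 2)) := by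
    have := besselCore_nonneg (ℓ + 2) (w := 1 * (y / 2) ^ 2) (by positivity)
    positivity
  linarith

theorem besselRatioDiv_zero (ℓ : ℕ) :
    besselRatioDiv ℓ 0 = (2 * ℓ + 1) / (2 * (ℓ + 1)) := by
  have h : (ℓ.factorial : ℝ) ≠ 0 := by exact_mod_cast ℓ.factorial_ne_zero
  rw [besselRatioDiv, besselA_zero]
  simp only [zero_div, ne_eq, OfNat.ofNat_ne_zero, not_false_eq_true, zero_pow, mul_zero,
    besselCore_zero, Nat.factorial_succ]
  push_cast
  field_simp

theorem hasDerivAt_besselRatio (ℓ : ℕ) (y : ℝ) :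
    HasDerivAt (besselRatio ℓ) (1 - besselRatio ℓ y ^ 2 - besselRatioDiv ℓ y) y := by
  have hA := (besselA_one_pos ℓ y).ne'
  refine ((hasDerivAt_besselB ℓ 1 y).fun_div (hasDerivAt_besselA ℓ 1 y) hA).congr_deriv ?_
  rw [besselRatio, besselRatioDiv]
  field_simp
  ring

theorem logDeriv_bagFun_mul_I (ℓ : ℕ) (a y : ℝ) :
    logDeriv (bagFun ℓ a) (y * Complex.I) =
      ⟨-(a * (1 - besselRatio ℓ y ^ 2 - besselRatioDiv ℓ y) / (1 + (a * besselRatio ℓ y) ^ 2)),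
        -(besselRatio ℓ y * (1 + a ^ 2 * (1 - besselRatioDiv ℓ y)) /
          (1 + (a * besselRatio ℓ y) ^ 2))⟩ := by
  have hA : (besselA ℓ 1 y : ℝ) ≠ 0 := (besselA_one_pos ℓ y).ne'
  have hf : (ℓ.factorial : ℂ) ≠ 0 := by exact_mod_cast ℓ.factorial_ne_zero
  have hA' : ((besselA ℓ 1 y : ℝ) : ℂ) ≠ 0 := by exact_mod_cast hA
  have hr : besselB ℓ 1 y = besselRatio ℓ y * besselA ℓ 1 y := by rw [besselRatio]; field_simp
  have hu : (2 * ℓ + 1) / 2 * besselCore (ℓ + 1) (1 * (y / 2) ^ 2) =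
      besselRatioDiv ℓ y * besselA ℓ 1 y := by rw [besselRatioDiv]; field_simp
  have hu' : (2 * (ℓ : ℂ) + 1) / 2 * ((besselCore (ℓ + 1) (1 * (y / 2) ^ 2) : ℝ) : ℂ) =
      besselRatioDiv ℓ y * ((besselA ℓ 1 y : ℝ) : ℂ) := by
    have := congrArg (fun t : ℝ => (t : ℂ)) hu
    push_cast at this
    exact this
  rw [logDeriv_apply, (hasDerivAt_bagFun ℓ a _).deriv, bagFun, besselA_mul_I, besselB_mul_I,
    besselCore_mul_I, mul_div_mul_left _ _ hf, hu', hr]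
  set r := besselRatio ℓ y
  set u := besselRatioDiv ℓ y
  have hden : (0 : ℝ) < 1 + (a * r) ^ 2 := by positivity
  have hden' : (1 : ℂ) - a * r * Complex.I ≠ 0 := by
    intro h
    have := congrArg Complex.re h
    simp at this
  have hden'' : ((besselA ℓ 1 y : ℝ) : ℂ) - a * (Complex.I * ((r * besselA ℓ 1 y : ℝ) : ℂ))
      ≠ 0 := by
    have : ((besselA ℓ 1 y : ℝ) : ℂ) - a * (Complex.I * ((r * besselA ℓ 1 y : ℝ) : ℂ)) =
      besselA ℓ 1 y * (1 - a * r * Complex.I) := by push_cast; ring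
    rw [this]
    exact mul_ne_zero hA' hden'
  rw [div_eq_iff hden'']
  generalize besselA ℓ 1 y = A
  apply Complex.ext
  · simp
    field_simp
    ring
  · simp
    field_simp
    ring

/-- The real zeros of `bagFun ℓ a`. -/
abbrev BagZeros (ℓ : ℕ) (a : ℝ) : Type := {x : ℝ // bagFun ℓ a x = 0}

theorem bagZeros_ne_zero {ℓ : ℕ} {a : ℝ} (x : BagZeros ℓ a) : (x : ℝ) ≠ 0 := by
  intro h
  have := x.2
  simp [h, bagFun_zero] at this

theorem hasSum_bagZeros (ℓ : ℕ) (a : ℝ) {y : ℝ} (hy : 0 < y) :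
    HasSum (fun x : BagZeros ℓ a => y / ((x : ℝ) ^ 2 + y ^ 2))
      (besselRatio ℓ y * (1 + a ^ 2 * (1 - besselRatioDiv ℓ y)) / (1 + (a * besselRatio ℓ y) ^ 2)) ∧
    HasSum (fun x : BagZeros ℓ a => y ^ 2 / ((x : ℝ) * ((x : ℝ) ^ 2 + y ^ 2)))
      (a / (2 * (ℓ + 1)) - a * (1 - besselRatio ℓ y ^ 2 - besselRatioDiv ℓ y) /
        (1 + (a * besselRatio ℓ y) ^ 2)) := by
  obtain ⟨C, hC⟩ := norm_bagFun_le ℓ a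
  have h := hasSum_real_zeros_logDeriv (differentiable_bagFun ℓ a) (bagFun_zero ℓ a) hC
    (fun z hz => deriv_bagFun_ne_zero ℓ a hz) (fun z hz => im_eq_zero_of_bagFun_eq_zero ℓ a hz) hy
  have h0 := logDeriv_bagFun_mul_I ℓ a 0
  simp only [Complex.ofReal_zero, zero_mul] at h0
  rw [h0, logDeriv_bagFun_mul_I] at h
  simp only [besselRatio_zero, besselRatioDiv_zero] at h
  convert h using 2
  · ring
  · field_simp
    ring

theorem summable_bagZeros_inv_sq (ℓ : ℕ) {a : ℝ} (ha : a ≠ 0) :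
    Summable (fun x : BagZeros ℓ a => 1 / (x : ℝ) ^ 2) ∧
      ∑' x : BagZeros ℓ a, 1 / (x : ℝ) ^ 2 ≤
        (1 + ((1 + a ^ 2) / (2 * a)) ^ 2) * (1 + a ^ 2) / (2 * (ℓ + 1)) := by
  set y : ℝ := (2 * ℓ + 1) / 2 with hy
  have hy0 : 0 < y := by positivity
  have h := (hasSum_bagZeros ℓ a hy0).1
  set S := besselRatio ℓ y * (1 + a ^ 2 * (1 - besselRatioDiv ℓ y)) /
    (1 + (a * besselRatio ℓ y) ^ 2)
  have hr := besselRatio_nonneg ℓ hy0.le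
  have hu := besselRatioDiv_nonneg ℓ y
  have hS : S ≤ (1 + a ^ 2) * (y / (2 * (ℓ + 1))) := by
    have h1 : S ≤ besselRatio ℓ y * (1 + a ^ 2) := by
      refine (div_le_iff₀ (by positivity)).2 ?_
      have h2 : 0 ≤ besselRatio ℓ y * a ^ 2 * besselRatioDiv ℓ y := by positivity
      have h3 : 0 ≤ besselRatio ℓ y * (1 + a ^ 2) * (a * besselRatio ℓ y) ^ 2 := by positivity
      nlinarith
    have := mul_le_mul_of_nonneg_left (besselRatio_le ℓ hy0.le) (show 0 ≤ 1 + a ^ 2 by positivity)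
    linarith
  set K := 1 + ((1 + a ^ 2) / (2 * a)) ^ 2
  have hb : ∀ x : BagZeros ℓ a, 1 / (x : ℝ) ^ 2 ≤ K / y * (y / ((x : ℝ) ^ 2 + y ^ 2)) := by
    intro x
    have hx : (x : ℝ) ≠ 0 := bagZeros_ne_zero x
    have hle := abs_le_of_bagFun_eq_zero ℓ a x.2
    have hx2 : 0 < (x : ℝ) ^ 2 := by positivity
    have hle2 : y ≤ (1 + a ^ 2) / (2 * |a|) * |(x : ℝ)| := by
      have : 0 < |a| := abs_pos.2 ha
      rw [div_mul_eq_mul_div, le_div_iff₀ (by positivity), hy]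
      linarith
    have hle3 : y ^ 2 ≤ ((1 + a ^ 2) / (2 * a)) ^ 2 * (x : ℝ) ^ 2 := by
      refine (pow_le_pow_left₀ hy0.le hle2 2).trans_eq ?_
      rw [mul_pow, div_pow, div_pow, mul_pow, mul_pow, sq_abs, sq_abs]
    rw [div_mul_div_comm, mul_comm K y, mul_div_mul_left _ _ hy0.ne',
      div_le_div_iff₀ hx2 (by positivity)]
    simp only [K]
    nlinarith
  have hs := h.mul_left (K / y)
  have hsum := Summable.of_nonneg_of_le (fun x => by positivity) hb hs.summable
  refine ⟨hsum, (hsum.tsum_le_tsum hb hs.summable).trans ?_⟩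
  rw [hs.tsum_eq]
  have hK : 0 ≤ K := by positivity
  calc K / y * S ≤ K / y * ((1 + a ^ 2) * (y / (2 * (ℓ + 1)))) := by gcongr
    _ = _ := by field_simp

set_option maxHeartbeats 1000000 in
theorem hasSum_arctan_bagZeros (ℓ : ℕ) {a : ℝ} (ha : a ≠ 0) {y : ℝ} (hy : 0 ≤ y) :
    HasSum (fun x : BagZeros ℓ a => Real.arctan (y / x) - y / x)
      (Real.arctan (a * besselRatio ℓ y) - a * y / (2 * (ℓ + 1))) := by
  have hder : ∀ (x : BagZeros ℓ a) (t : ℝ), HasDerivAt (fun t : ℝ => Real.arctan (t / x) - t / x)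
      (-(t ^ 2 / ((x : ℝ) * ((x : ℝ) ^ 2 + t ^ 2)))) t := by
    intro x t
    have hx := bagZeros_ne_zero x
    have h1 := (hasDerivAt_id t).div_const (x : ℝ)
    refine (h1.arctan.fun_sub h1).congr_deriv ?_
    have h2 : (x : ℝ) ^ 2 + t ^ 2 ≠ 0 := by positivity
    simp only [id]
    field_simp
    ring
  have hbound : ∀ (x : BagZeros ℓ a) (t : ℝ), t ∈ Set.Ioo (-(y + 1)) (y + 1) →
      ‖-(t ^ 2 / ((x : ℝ) * ((x : ℝ) ^ 2 + t ^ 2)))‖ ≤ (y + 1) / 2 * (1 / (x : ℝ) ^ 2) := by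
    intro x t ht
    have hx := bagZeros_ne_zero x
    have hx' : 0 < |(x : ℝ)| := abs_pos.2 hx
    have ht' : |t| ≤ y + 1 := (abs_lt.2 ht).le
    rw [norm_neg, Real.norm_eq_abs, abs_div, abs_mul, abs_of_nonneg (sq_nonneg t),
      abs_of_nonneg (show 0 ≤ (x : ℝ) ^ 2 + t ^ 2 by positivity), div_mul_div_comm,
      div_le_div_iff₀ (by positivity) (by positivity), ← sq_abs t, ← sq_abs (x : ℝ)]
    have h1 : 2 * (|(x : ℝ)| * |t|) ≤ |(x : ℝ)| ^ 2 + |t| ^ 2 := by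
      nlinarith [sq_nonneg (|(x : ℝ)| - |t|)]
    have h2 := abs_nonneg t
    calc |t| ^ 2 * (2 * |(x : ℝ)| ^ 2) = |t| * |(x : ℝ)| * (2 * (|(x : ℝ)| * |t|)) := by ring
      _ ≤ (y + 1) * |(x : ℝ)| * (|(x : ℝ)| ^ 2 + |t| ^ 2) := by gcongr
      _ = _ := by ring
  have h0mem : (0 : ℝ) ∈ Set.Ioo (-(y + 1)) (y + 1) := by constructor <;> linarith
  have hsq := (summable_bagZeros_inv_sq ℓ ha).1.mul_left ((y + 1) / 2)
  have hs0 : Summable fun x : BagZeros ℓ a => Real.arctan (0 / x) - 0 / (x : ℝ) := by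
    simp
  have hS : ∀ t ∈ Set.Ioo (-(y + 1)) (y + 1), HasDerivAt
      (fun t => ∑' x : BagZeros ℓ a, (Real.arctan (t / x) - t / x))
      (∑' x : BagZeros ℓ a, -(t ^ 2 / ((x : ℝ) * ((x : ℝ) ^ 2 + t ^ 2)))) t := fun t ht =>
    hasDerivAt_tsum_of_isPreconnected hsq isOpen_Ioo isPreconnected_Ioo
      (fun x t _ => hder x t) hbound h0mem hs0 ht
  have hsum : Summable fun x : BagZeros ℓ a => Real.arctan (y / x) - y / x :=
    summable_of_summable_hasDerivAt_of_isPreconnected hsq isOpen_Ioo isPreconnected_Ioo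
      (fun x t _ => hder x t) hbound h0mem hs0 ⟨by linarith, by linarith⟩
  have hG : ∀ t : ℝ, HasDerivAt (fun t => Real.arctan (a * besselRatio ℓ t) - a * t / (2 * (ℓ + 1)))
      (a * (1 - besselRatio ℓ t ^ 2 - besselRatioDiv ℓ t) / (1 + (a * besselRatio ℓ t) ^ 2) -
        a / (2 * (ℓ + 1))) t := by
    intro t
    refine (((hasDerivAt_besselRatio ℓ t).const_mul a).arctan.fun_sub
      (((hasDerivAt_id t).const_mul a).div_const (2 * (ℓ + 1)))).congr_deriv ?_
    simp only [mul_one]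
    ring
  have hD : ∀ t ∈ Set.Ico 0 (y + 1), HasDerivAt (fun t => (∑' x : BagZeros ℓ a,
      (Real.arctan (t / x) - t / x)) -
      (Real.arctan (a * besselRatio ℓ t) - a * t / (2 * (ℓ + 1)))) 0 t := by
    intro t ht
    refine ((hS t ⟨by linarith [ht.1], ht.2⟩).fun_sub (hG t)).congr_deriv ?_
    rcases ht.1.eq_or_lt with rfl | htpos
    · simp only [besselRatio_zero, besselRatioDiv_zero, mul_zero, zero_pow, ne_eq,
        OfNat.ofNat_ne_zero, not_false_eq_true, zero_div, neg_zero, tsum_zero, add_zero]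
      field_simp
      ring
    · rw [tsum_neg, (hasSum_bagZeros ℓ a htpos).2.tsum_eq]
      ring
  have hconst := constant_of_has_deriv_right_zero (a := 0) (b := y)
    (fun t ht => (hD t ⟨ht.1, by linarith [ht.2]⟩).continuousAt.continuousWithinAt)
    (fun t ht => (hD t ⟨ht.1, by linarith [ht.2]⟩).hasDerivWithinAt) y ⟨hy, le_rfl⟩
  simp only [besselRatio_zero, mul_zero, zero_div, Real.arctan_zero, sub_zero, tsum_zero] at hconst
  rw [← sub_eq_zero.1 hconst]
  exact hsum.hasSum

/-- A barrier principle for first order differential inequalities. -/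
theorem nonneg_of_deriv_pos_of_neg {W W' : ℝ → ℝ} (hc : ContinuousWithinAt W (Set.Ici 0) 0)
    (h0 : 0 ≤ W 0) (hd : ∀ z, 0 < z → HasDerivAt W (W' z) z)
    (hneg : ∀ z, 0 < z → W z < 0 → 0 < W' z) {z : ℝ} (hz : 0 ≤ z) : 0 ≤ W z := by
  rcases hz.eq_or_lt with rfl | hz
  · exact h0
  refine le_of_forall_pos_le_add fun η hη => ?_
  have h1 : ∀ᶠ x in nhdsWithin (0 : ℝ) (Set.Ioi 0), -η < W x := by
    have : nhdsWithin (0 : ℝ) (Set.Ioi 0) ≤ nhdsWithin 0 (Set.Ici 0) :=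
      nhdsWithin_mono _ Set.Ioi_subset_Ici_self
    exact (hc.eventually (lt_mem_nhds (by linarith))).filter_mono this
  obtain ⟨x, hx1, hx2⟩ := (h1.and (Ioo_mem_nhdsGT hz)).exists
  have hpos : ∀ t ∈ Set.Icc x z, 0 < t := fun t ht => hx2.1.trans_le ht.1
  have := image_le_of_deriv_right_lt_deriv_boundary' (f := fun t => -W t) (f' := fun t => -W' t)
    (B := fun _ => η) (B' := fun _ => 0) (a := x) (b := z)
    (fun t ht => (hd t (hpos t ht)).continuousAt.continuousWithinAt.neg)
    (fun t ht => (hd t (hpos t (Set.Ico_subset_Icc_self ht))).hasDerivWithinAt.neg)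
    (by linarith) continuousOn_const (fun t _ => hasDerivWithinAt_const _ _ _)
    (fun t ht heq => by
      have := hneg t (hpos t (Set.Ico_subset_Icc_self ht)) (by linarith)
      linarith) (Set.right_mem_Icc.2 hx2.2.le)
  linarith

/-- Leading uniform asymptotic profile of the ratio `I_{ν+1/2}(ν z) / I_{ν-1/2}(ν z)`. -/
noncomputable def profileZero (z : ℝ) : ℝ := z / (1 + √(1 + z ^ 2))

/-- First correction to `profileZero`. -/
noncomputable def profileOne (z : ℝ) : ℝ := -(z / (2 * (1 + z ^ 2) * (1 + √(1 + z ^ 2))))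

/-- The residual of the two-term profile in the Riccati equation. -/
noncomputable def profileResidual (z : ℝ) : ℝ :=
  profileOne z ^ 2 - 1 / (2 * (1 + z ^ 2) * (√(1 + z ^ 2) * (1 + √(1 + z ^ 2)))) +
    z ^ 2 / ((1 + z ^ 2) ^ 2 * (1 + √(1 + z ^ 2)))

theorem one_le_sqrt_one_add_sq (z : ℝ) : 1 ≤ √(1 + z ^ 2) :=
  Real.one_le_sqrt.2 (by nlinarith [sq_nonneg z])

theorem sq_sqrt_one_add_sq (z : ℝ) : √(1 + z ^ 2) ^ 2 = 1 + z ^ 2 :=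
  Real.sq_sqrt (by positivity)

theorem hasDerivAt_profileZero (z : ℝ) :
    HasDerivAt profileZero (1 / (√(1 + z ^ 2) * (1 + √(1 + z ^ 2)))) z := by
  have h1 := one_le_sqrt_one_add_sq z
  have h2 := sq_sqrt_one_add_sq z
  have hs : HasDerivAt (fun z : ℝ => √(1 + z ^ 2)) (z / √(1 + z ^ 2)) z := by
    refine ((((hasDerivAt_id z).fun_pow 2).const_add 1).sqrt (by positivity)).congr_deriv ?_
    simp
    ring
  refine ((hasDerivAt_id z).fun_div (hs.const_add 1) (by positivity)).congr_deriv ?_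
  set w := √(1 + z ^ 2)
  simp only [id]
  field_simp
  nlinarith

theorem profileOne_eq (z : ℝ) : profileOne z = -(profileZero z / (2 * (1 + z ^ 2))) := by
  rw [profileOne, profileZero]
  field_simp

theorem hasDerivAt_profileOne (z : ℝ) :
    HasDerivAt profileOne (profileResidual z - profileOne z ^ 2) z := by
  have h1 := one_le_sqrt_one_add_sq z
  have he : profileOne = fun z => -(profileZero z / (2 * (1 + z ^ 2))) := funext profileOne_eq
  rw [profileResidual, he]
  have h3 := (((hasDerivAt_id z).fun_pow 2).const_add 1).const_mul 2
  refine ((hasDerivAt_profileZero z).fun_div h3 (by positivity)).fun_neg.congr_deriv ?_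
  simp only [id, profileZero]
  set w := √(1 + z ^ 2)
  have : 1 + z ^ 2 ≠ 0 := by positivity
  field_simp
  ring

theorem profileZero_nonneg {z : ℝ} (hz : 0 ≤ z) : 0 ≤ profileZero z := by
  have := one_le_sqrt_one_add_sq z
  rw [profileZero]
  positivity

theorem profileZero_le {z : ℝ} (hz : 0 ≤ z) : profileZero z ≤ z / 2 := by
  have := one_le_sqrt_one_add_sq z
  rw [profileZero]
  gcongr
  linarith

theorem profileZero_lt_one (z : ℝ) : profileZero z < 1 := by
  have := one_le_sqrt_one_add_sq z
  rw [profileZero, div_lt_one (by positivity)]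
  nlinarith [sq_sqrt_one_add_sq z]

theorem abs_profileOne_le {z : ℝ} (hz : 0 ≤ z) : |profileOne z| ≤ z / (4 * (1 + z ^ 2)) := by
  have h := profileZero_le hz
  have h0 := profileZero_nonneg hz
  rw [profileOne_eq, abs_neg, abs_of_nonneg (by positivity), div_le_div_iff₀ (by positivity)
    (by positivity)]
  nlinarith [sq_nonneg z]

theorem abs_profileResidual_le {z : ℝ} (hz : 0 ≤ z) : |profileResidual z| ≤ 1 / (1 + z ^ 2) := by
  have h1 := one_le_sqrt_one_add_sq z
  have h2 := sq_sqrt_one_add_sq z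
  have h3 := profileZero_nonneg hz
  have h4 := profileZero_lt_one z
  rw [profileResidual, profileOne_eq]
  set w := √(1 + z ^ 2)
  rw [← h2]
  have hz2 : z ^ 2 = w ^ 2 - 1 := by linarith
  have e1 : (-(profileZero z / (2 * w ^ 2))) ^ 2 ≤ 1 / 4 * (1 / w ^ 2) := by
    rw [neg_sq, div_pow, div_le_iff₀ (by positivity)]
    field_simp
    nlinarith
  have e2 : 1 / (2 * w ^ 2 * (w * (1 + w))) ≤ 1 / 4 * (1 / w ^ 2) := by
    rw [div_mul_div_comm]
    gcongr ?_ / ?_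
    · norm_num
    · nlinarith [sq_nonneg w]
  have e3 : z ^ 2 / ((w ^ 2) ^ 2 * (1 + w)) ≤ 1 / 2 * (1 / w ^ 2) := by
    rw [hz2, div_mul_div_comm, div_le_div_iff₀ (by positivity) (by positivity)]
    have : 0 < w ^ 2 := by positivity
    have : 0 < w ^ 3 := by positivity
    nlinarith [sq_nonneg (w ^ 2), mul_nonneg (sub_nonneg.2 h1) (sq_nonneg (w ^ 2))]
  have e4 : 0 ≤ 1 / (2 * w ^ 2 * (w * (1 + w))) := by positivity
  have e5 : 0 ≤ z ^ 2 / ((w ^ 2) ^ 2 * (1 + w)) := by positivity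
  have e6 := sq_nonneg (-(profileZero z / (2 * w ^ 2)))
  have e7 : 0 < 1 / w ^ 2 := by positivity
  rw [abs_le]
  constructor <;> linarith

theorem abs_profileResidual_add_le {z : ℝ} (hz : 0 ≤ z) :
    |profileResidual z + 1 / 4| ≤ 2 * z ^ 2 := by
  have h1 := one_le_sqrt_one_add_sq z
  have h2 := sq_sqrt_one_add_sq z
  have h3 := profileZero_nonneg hz
  have h4 := profileZero_le hz
  rw [profileResidual, profileOne_eq]
  set w := √(1 + z ^ 2)
  rw [← h2]
  have hw2 : 1 ≤ w ^ 2 := by nlinarith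
  have hz2 : z ^ 2 = w ^ 2 - 1 := by linarith
  have e1 : (-(profileZero z / (2 * w ^ 2))) ^ 2 ≤ z ^ 2 / 4 := by
    rw [neg_sq, div_pow, div_le_iff₀ (by positivity)]
    have h5 : profileZero z ^ 2 ≤ (z / 2) ^ 2 := pow_le_pow_left₀ h3 h4 2
    have h6 : z ^ 2 * 1 ≤ z ^ 2 * (w ^ 2) ^ 2 := by
      gcongr
      nlinarith
    nlinarith
  have e2 : 1 / (2 * w ^ 2 * (w * (1 + w))) ≤ 1 / 4 := by
    gcongr
    nlinarith
  have e2' : 1 / 4 - z ^ 2 / 2 ≤ 1 / (2 * w ^ 2 * (w * (1 + w))) := by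
    rw [le_div_iff₀ (by positivity), hz2]
    have hw0 : 0 ≤ w - 1 := by linarith
    have : 0 ≤ (w - 1) * w := by positivity
    nlinarith [mul_nonneg hw0 (sq_nonneg w), mul_nonneg (mul_nonneg hw0 (sq_nonneg w)) hw0,
      mul_nonneg this (sq_nonneg w), mul_nonneg (sq_nonneg w) (sq_nonneg w),
      mul_nonneg this (mul_nonneg (sq_nonneg w) (sq_nonneg w))]
  have e3 : z ^ 2 / ((w ^ 2) ^ 2 * (1 + w)) ≤ z ^ 2 := by
    refine div_le_self (by positivity) ?_
    nlinarith
  have e5 : 0 ≤ z ^ 2 / ((w ^ 2) ^ 2 * (1 + w)) := by positivity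
  have e6 := sq_nonneg (-(profileZero z / (2 * w ^ 2)))
  have e7 : 0 ≤ z ^ 2 := by positivity
  rw [abs_le]
  constructor <;> linarith

theorem profile_riccati {z : ℝ} (hz : 0 < z) (ε : ℝ) :
    1 - (profileZero z + ε * profileOne z) ^ 2 - 2 * (profileZero z + ε * profileOne z) / z =
      ε * (1 / (√(1 + z ^ 2) * (1 + √(1 + z ^ 2)))) - ε ^ 2 * profileOne z ^ 2 := by
  have h1 := one_le_sqrt_one_add_sq z
  have h2 := sq_sqrt_one_add_sq z
  rw [profileOne, profileZero]
  set w := √(1 + z ^ 2)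
  rw [← h2]
  have hz2 : z ^ 2 = w ^ 2 - 1 := by linarith
  field_simp
  rw [hz2]
  ring

section Riccati

variable {ε : ℝ} {ρ : ℝ → ℝ}

theorem hasDerivAt_sub_profile (hε : 0 < ε)
    (hd : ∀ z, 0 < z → HasDerivAt ρ ((1 - ρ z ^ 2 - 2 * ρ z / z) / ε) z) {z : ℝ} (hz : 0 < z) :
    HasDerivAt (fun z => ρ z - (profileZero z + ε * profileOne z))
      ((-((ρ z - (profileZero z + ε * profileOne z)) *
        (ρ z + (profileZero z + ε * profileOne z) + 2 / z))
          - ε ^ 2 * profileResidual z) / ε) z := by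
  have h := (hd z hz).fun_sub
    ((hasDerivAt_profileZero z).fun_add ((hasDerivAt_profileOne z).const_mul ε))
  refine h.congr_deriv ?_
  have hr := profile_riccati hz ε
  rw [eq_div_iff hε.ne', sub_mul, div_mul_cancel₀ _ hε.ne']
  field_simp at hr ⊢
  linear_combination hr

theorem profile_add_nonneg (hε2 : ε ≤ 2) {z : ℝ} (hz : 0 ≤ z) :
    profileZero z * (z ^ 2 / (1 + z ^ 2)) ≤ profileZero z + ε * profileOne z := by
  have h0 := profileZero_nonneg hz
  have h1 : profileZero z + ε * profileOne z = profileZero z * (1 - ε / (2 * (1 + z ^ 2))) := by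
    rw [profileOne_eq]
    ring
  rw [h1]
  gcongr
  rw [div_le_iff₀ (by positivity), sub_mul, div_mul_eq_mul_div,
    mul_div_mul_right _ _ (by positivity)]
  linarith

theorem continuous_profileZero : Continuous profileZero :=
  continuous_iff_continuousAt.2 fun z => (hasDerivAt_profileZero z).continuousAt

theorem continuous_profileOne : Continuous profileOne :=
  continuous_iff_continuousAt.2 fun z => (hasDerivAt_profileOne z).continuousAt

theorem abs_sub_profile_le (hε : 0 < ε) (hε2 : ε ≤ 2) (hc : Continuous ρ) (h0 : ρ 0 = 0)
    (hnn : ∀ z, 0 ≤ z → 0 ≤ ρ z)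
    (hd : ∀ z, 0 < z → HasDerivAt ρ ((1 - ρ z ^ 2 - 2 * ρ z / z) / ε) z) {z : ℝ} (hz : 0 ≤ z) :
    |ρ z - (profileZero z + ε * profileOne z)| ≤ 2 * ε ^ 2 * (z / (1 + z ^ 2)) := by
  have key : ∀ σ : ℝ, |σ| = 1 → 0 ≤ 2 * ε ^ 2 * (z / (1 + z ^ 2)) +
      σ * (ρ z - (profileZero z + ε * profileOne z)) := by
    intro σ hσ
    have hcp := continuous_profileZero
    have hcp' := continuous_profileOne
    have hc' : Continuous fun z : ℝ => 2 * ε ^ 2 * (z / (1 + z ^ 2)) +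
        σ * (ρ z - (profileZero z + ε * profileOne z)) := by
      have : ∀ z : ℝ, 1 + z ^ 2 ≠ 0 := fun z => by positivity
      fun_prop (disch := assumption)
    refine nonneg_of_deriv_pos_of_neg (W := fun z => 2 * ε ^ 2 * (z / (1 + z ^ 2)) +
        σ * (ρ z - (profileZero z + ε * profileOne z)))
      hc'.continuousAt.continuousWithinAt ?_ (fun z hz =>
      (((hasDerivAt_id z).fun_div (((hasDerivAt_id z).fun_pow 2).const_add 1)
        (by positivity)).const_mul (2 * ε ^ 2)).fun_add
          ((hasDerivAt_sub_profile hε hd hz).const_mul σ)) ?_ hz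
    · simp [h0, profileZero, profileOne]
    · intro z hz hW
      simp only [id] at hW ⊢
      have hp := profile_add_nonneg hε2 hz.le
      have hp0 := profileZero_nonneg hz.le
      have hq := abs_profileResidual_le hz.le
      have hρ := hnn z hz.le
      set δ := ρ z - (profileZero z + ε * profileOne z)
      set R := profileZero z + ε * profileOne z
      set D := ρ z + R + 2 / z with hD
      have hR : 0 ≤ R := le_trans (by positivity) hp
      have hDpos : 0 < D := by positivity
      have hσq : |σ * profileResidual z| ≤ 1 / (1 + z ^ 2) := by rwa [abs_mul, hσ, one_mul]
      have hbar : 1 / 2 * (1 / (1 + z ^ 2)) ≤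
          ε * ((1 - z ^ 2) / (1 + z ^ 2) ^ 2) + D * (z / (1 + z ^ 2)) := by
        have hD1 : profileZero z * (z ^ 2 / (1 + z ^ 2)) + 2 / z ≤ D := by rw [hD]; linarith
        have h1 : (profileZero z * (z ^ 2 / (1 + z ^ 2)) + 2 / z) * (z / (1 + z ^ 2)) ≤
            D * (z / (1 + z ^ 2)) := by gcongr
        have h2 : (profileZero z * (z ^ 2 / (1 + z ^ 2)) + 2 / z) * (z / (1 + z ^ 2)) =
            (profileZero z * z ^ 3 + 2 * (1 + z ^ 2)) / (1 + z ^ 2) ^ 2 := by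
          field_simp
        have h3 : -(2 * z ^ 2) ≤ ε * (1 - z ^ 2) := by
          nlinarith [sq_nonneg z, mul_nonneg (sub_nonneg.2 hε2) (sq_nonneg z)]
        have h4 : (1 + z ^ 2) / 2 ≤ 2 + profileZero z * z ^ 3 := by
          rcases le_or_gt (z ^ 2) 3 with h | h
          · have : 0 ≤ profileZero z * z ^ 3 := by positivity
            linarith
          · have hz1 : 3 / 2 < z := by nlinarith
            have hw : √(1 + z ^ 2) ≤ 1 + z := by
              rw [Real.sqrt_le_left (by positivity)]
              nlinarith
            have h5 : z / (2 + z) ≤ profileZero z := by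
              rw [profileZero]
              exact div_le_div_of_nonneg_left hz.le (by positivity) (by linarith)
            have h6 : z / (2 + z) * z ^ 3 ≤ profileZero z * z ^ 3 := by gcongr
            have h7 : z ^ 2 / 2 ≤ z / (2 + z) * z ^ 3 := by
              rw [div_mul_eq_mul_div, div_le_div_iff₀ (by positivity) (by positivity)]
              nlinarith [mul_pos hz (sq_pos_of_pos hz), sq_pos_of_pos hz,
                mul_pos (sq_pos_of_pos hz) (sq_pos_of_pos hz)]
            linarith
        have h8 : 1 / 2 * (1 / (1 + z ^ 2)) = (1 + z ^ 2) / 2 / (1 + z ^ 2) ^ 2 := by field_simp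
        have h9 : (1 + z ^ 2) / 2 / (1 + z ^ 2) ^ 2 ≤ (ε * (1 - z ^ 2) +
            (profileZero z * z ^ 3 + 2 * (1 + z ^ 2))) / (1 + z ^ 2) ^ 2 := by
          gcongr
          linarith
        rw [add_div (ε * _)] at h9
        rw [h8, ← mul_div_assoc]
        linarith
      have hε' : 0 < ε ^ 2 := by positivity
      have h10 : D * (2 * ε ^ 2 * (z / (1 + z ^ 2)) + σ * δ) < 0 := mul_neg_of_pos_of_neg hDpos hW
      have h11 := mul_le_mul_of_nonneg_left hbar hε'.le
      have h12 := mul_le_mul_of_nonneg_left (le_of_abs_le hσq) hε'.le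
      have h13 : 0 < ε * (2 * ε ^ 2 * ((1 * (1 + z ^ 2) - z * (((2 : ℕ) : ℝ) * z ^ (2 - 1) * 1)) /
          (1 + z ^ 2) ^ 2) + σ * ((-(δ * D) - ε ^ 2 * profileResidual z) / ε)) := by
        have h14 : (1 * (1 + z ^ 2) - z * (((2 : ℕ) : ℝ) * z ^ (2 - 1) * 1)) = 1 - z ^ 2 := by
          push_cast
          ring
        rw [h14]
        have h15 : ε * (2 * ε ^ 2 * ((1 - z ^ 2) / (1 + z ^ 2) ^ 2) +
            σ * ((-(δ * D) - ε ^ 2 * profileResidual z) / ε)) =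
            2 * (ε ^ 2 * (ε * ((1 - z ^ 2) / (1 + z ^ 2) ^ 2))) - σ * δ * D -
              ε ^ 2 * (σ * profileResidual z) := by
          field_simp
          ring
        rw [h15]
        linarith
      exact pos_of_mul_pos_right h13 hε.le
  rw [abs_le]
  constructor
  · have := key 1 (by simp)
    linarith
  · have := key (-1) (by simp)
    linarith

theorem abs_sub_profile_sub_le (hε : 0 < ε) (hε2 : ε ≤ 2) (hc : Continuous ρ) (h0 : ρ 0 = 0)
    (hnn : ∀ z, 0 ≤ z → 0 ≤ ρ z) (hle : ∀ z, 0 ≤ z → ρ z ≤ z / 2)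
    (hd : ∀ z, 0 < z → HasDerivAt ρ ((1 - ρ z ^ 2 - 2 * ρ z / z) / ε) z) {z : ℝ} (hz : 0 ≤ z) :
    |ρ z - (profileZero z + ε * profileOne z) - ε ^ 2 / (4 * (2 + ε)) * z| ≤
      3 / 2 * ε ^ 2 * z ^ 3 := by
  have key : ∀ σ : ℝ, |σ| = 1 → 0 ≤ 3 / 2 * ε ^ 2 * z ^ 3 +
      σ * (ρ z - (profileZero z + ε * profileOne z) - ε ^ 2 / (4 * (2 + ε)) * z) := by
    intro σ hσ
    have hcp := continuous_profileZero
    have hcp' := continuous_profileOne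
    have hc' : Continuous fun z : ℝ => 3 / 2 * ε ^ 2 * z ^ 3 +
        σ * (ρ z - (profileZero z + ε * profileOne z) - ε ^ 2 / (4 * (2 + ε)) * z) := by
      fun_prop
    refine nonneg_of_deriv_pos_of_neg (W := fun z => 3 / 2 * ε ^ 2 * z ^ 3 +
        σ * (ρ z - (profileZero z + ε * profileOne z) - ε ^ 2 / (4 * (2 + ε)) * z))
      hc'.continuousAt.continuousWithinAt ?_ (fun z hz =>
      (((hasDerivAt_id z).fun_pow 3).const_mul (3 / 2 * ε ^ 2)).fun_add
        (((hasDerivAt_sub_profile hε hd hz).fun_sub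
          ((hasDerivAt_id z).const_mul (ε ^ 2 / (4 * (2 + ε))))).const_mul σ)) ?_ hz
    · simp [h0, profileZero, profileOne]
    · intro z hz hW
      simp only [id] at hW ⊢
      have hp := profile_add_nonneg hε2 hz.le
      have hp0 := profileZero_nonneg hz.le
      have hp1 := profileZero_le hz.le
      have hq := abs_profileResidual_add_le hz.le
      have hρ := hnn z hz.le
      have hρ1 := hle z hz.le
      have hRle : profileZero z + ε * profileOne z ≤ z / 2 := by
        have : 0 ≤ ε * (profileZero z / (2 * (1 + z ^ 2))) := by positivity
        rw [profileOne_eq]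
        linarith
      set δ := ρ z - (profileZero z + ε * profileOne z)
      set R := profileZero z + ε * profileOne z
      have hR : 0 ≤ R := le_trans (by positivity) hp
      set D := ρ z + R + 2 / z with hD
      have hDpos : 0 < D := by positivity
      have hDz : D * z = (ρ z + R) * z + 2 := by rw [hD]; field_simp
      set d := ε ^ 2 / (4 * (2 + ε)) with hdd
      have hd1 : d * (2 + ε) = ε ^ 2 / 4 := by rw [hdd]; field_simp
      have hd0 : 0 ≤ d := by positivity
      have hd2 : d ≤ ε ^ 2 / 8 := by nlinarith
      have hε' : 0 < ε ^ 2 := by positivity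
      have hσq : |σ * (profileResidual z + 1 / 4)| ≤ 2 * z ^ 2 := by rwa [abs_mul, hσ, one_mul]
      have hσ' : |σ * ((ρ z + R) * z)| ≤ z ^ 2 := by
        rw [abs_mul, hσ, one_mul, abs_of_nonneg (by positivity)]
        nlinarith
      have h10 : D * (3 / 2 * ε ^ 2 * z ^ 3 + σ * (δ - d * z)) < 0 :=
        mul_neg_of_pos_of_neg hDpos hW
      have h12 := mul_le_mul_of_nonneg_left (le_of_abs_le hσq) hε'.le
      have h16 := mul_le_mul_of_nonneg_left (le_of_abs_le hσ') hd0
      have h17 : d * z ^ 2 ≤ ε ^ 2 / 8 * z ^ 2 := by gcongr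
      have hz2 : 0 < ε ^ 2 * z ^ 2 := by positivity
      have h18 : 0 ≤ ε ^ 2 * z ^ 2 * ((ρ z + R) * z) := by positivity
      have h19 : 0 < ε ^ 2 * z ^ 2 * ε := by positivity
      have h13 : 0 < ε * (3 / 2 * ε ^ 2 * (((3 : ℕ) : ℝ) * z ^ (3 - 1) * 1) +
          σ * ((-(δ * D) - ε ^ 2 * profileResidual z) / ε - d * 1)) := by
        have h15 : ε * (3 / 2 * ε ^ 2 * (((3 : ℕ) : ℝ) * z ^ (3 - 1) * 1) +
            σ * ((-(δ * D) - ε ^ 2 * profileResidual z) / ε - d * 1)) =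
            9 / 2 * (ε ^ 2 * z ^ 2 * ε) - D * (3 / 2 * ε ^ 2 * z ^ 3 + σ * (δ - d * z)) +
              3 / 2 * (ε ^ 2 * z ^ 2 * (D * z)) - σ * d * (D * z)
              - σ * ε * d - ε ^ 2 * (σ * profileResidual z) := by
          push_cast
          field_simp
          ring
        rw [h15, hDz]
        have h20 : σ * d * ((ρ z + R) * z + 2) + σ * ε * d + ε ^ 2 * (σ * profileResidual z) =
            d * (σ * ((ρ z + R) * z)) + ε ^ 2 * (σ * (profileResidual z + 1 / 4)) := by
          linear_combination σ * hd1
        linarith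
      exact pos_of_mul_pos_right h13 hε.le
  rw [abs_le]
  constructor
  · have := key 1 (by simp)
    linarith
  · have := key (-1) (by simp)
    linarith

end Riccati

theorem abs_arctan_mul_sub_le (a : ℝ) {x y : ℝ} (hx : 0 ≤ x) (hy : 0 ≤ y) :
    |Real.arctan (a * x) - Real.arctan (a * y) - a / (1 + (a * y) ^ 2) * (x - y)| ≤
      2 * |a| ^ 3 * (x + y) * |x - y| ^ 2 := by
  have hder : ∀ u : ℝ, HasDerivAt (fun u => Real.arctan (a * u) - a / (1 + (a * y) ^ 2) * u)
      (a / (1 + (a * u) ^ 2) - a / (1 + (a * y) ^ 2)) u := by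
    intro u
    refine (((hasDerivAt_id u).const_mul a).arctan.fun_sub
      ((hasDerivAt_id u).const_mul (a / (1 + (a * y) ^ 2)))).congr_deriv ?_
    simp only [id]
    ring
  have hb : ∀ u ∈ Set.uIcc y x, ‖a / (1 + (a * u) ^ 2) - a / (1 + (a * y) ^ 2)‖ ≤
      2 * |a| ^ 3 * (x + y) * |x - y| := by
    intro u hu
    have hu0 : 0 ≤ u := le_trans (le_min hy hx) hu.1
    have hu1 : u + y ≤ 2 * (x + y) := by
      have : max y x ≤ x + y := max_le (by linarith) (by linarith)
      linarith [hu.2]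
    have hu2 : |y - u| ≤ |x - y| := by
      rw [abs_sub_comm]
      exact Set.abs_sub_left_of_mem_uIcc hu
    have h1 : a / (1 + (a * u) ^ 2) - a / (1 + (a * y) ^ 2) =
        a ^ 3 * ((u + y) * (y - u)) / ((1 + (a * u) ^ 2) * (1 + (a * y) ^ 2)) := by
      field_simp
      ring
    rw [h1, Real.norm_eq_abs, abs_div, abs_of_nonneg
      (show 0 ≤ (1 + (a * u) ^ 2) * (1 + (a * y) ^ 2) by positivity), abs_mul, abs_mul, abs_pow,
      abs_of_nonneg (show 0 ≤ u + y by positivity)]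
    refine (div_le_self (by positivity) ?_).trans ?_
    · nlinarith [sq_nonneg (a * u), sq_nonneg (a * y), mul_nonneg (sq_nonneg (a * u))
        (sq_nonneg (a * y))]
    · calc |a| ^ 3 * ((u + y) * |y - u|) ≤ |a| ^ 3 * (2 * (x + y) * |x - y|) := by gcongr
        _ = _ := by ring
  have h := (convex_uIcc y x).norm_image_sub_le_of_norm_hasDerivWithin_le
    (fun u _ => (hder u).hasDerivWithinAt) hb Set.left_mem_uIcc Set.right_mem_uIcc
  rw [Real.norm_eq_abs, Real.norm_eq_abs] at h
  calc _ = _ := by congr 1; ring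
    _ ≤ _ := h
    _ = _ := by ring

/-- Half-integer order `ℓ + 1 / 2`. -/
noncomputable def halfOrder (ℓ : ℕ) : ℝ := (2 * ℓ + 1) / 2

theorem halfOrder_pos (ℓ : ℕ) : 0 < halfOrder ℓ := by
  rw [halfOrder]
  positivity

theorem inv_halfOrder_le (ℓ : ℕ) : (halfOrder ℓ)⁻¹ ≤ 2 := by
  rw [halfOrder, inv_div, div_le_iff₀ (by positivity)]
  have : (0 : ℝ) ≤ ℓ := ℓ.cast_nonneg
  linarith

/-- The leading term of the rescaled phase. -/
noncomputable def phaseZero (a z : ℝ) : ℝ := Real.arctan (a * profileZero z)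

/-- The first correction to the rescaled phase. -/
noncomputable def phaseOne (a z : ℝ) : ℝ := a * profileOne z / (1 + (a * profileZero z) ^ 2)

/-- The remainder of the rescaled phase. -/
noncomputable def phaseRem (a : ℝ) (ℓ : ℕ) (z : ℝ) : ℝ :=
  Real.arctan (a * besselRatio ℓ (halfOrder ℓ * z)) - phaseZero a z -
    (halfOrder ℓ)⁻¹ * phaseOne a z

/-- Linear coefficient of `phaseRem` at the origin, divided by `a`. -/
noncomputable def remCoeff (ℓ : ℕ) : ℝ :=
  (halfOrder ℓ)⁻¹ ^ 2 / (4 * (2 + (halfOrder ℓ)⁻¹))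

theorem abs_besselRatio_sub_profile_le (ℓ : ℕ) {z : ℝ} (hz : 0 ≤ z) :
    |besselRatio ℓ (halfOrder ℓ * z) - (profileZero z + (halfOrder ℓ)⁻¹ * profileOne z)| ≤
      2 * (halfOrder ℓ)⁻¹ ^ 2 * (z / (1 + z ^ 2)) ∧
    |besselRatio ℓ (halfOrder ℓ * z) - (profileZero z + (halfOrder ℓ)⁻¹ * profileOne z) -
      remCoeff ℓ * z| ≤ 3 / 2 * (halfOrder ℓ)⁻¹ ^ 2 * z ^ 3 ∧
    0 ≤ besselRatio ℓ (halfOrder ℓ * z) ∧ besselRatio ℓ (halfOrder ℓ * z) ≤ z / 2 := by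
  have hν := halfOrder_pos ℓ
  have hle : ∀ z, 0 ≤ z → besselRatio ℓ (halfOrder ℓ * z) ≤ z / 2 := by
    intro z hz
    refine (besselRatio_le ℓ (by positivity)).trans ?_
    rw [div_le_div_iff₀ (by positivity) (by positivity), halfOrder]
    nlinarith
  have hnn : ∀ z, 0 ≤ z → 0 ≤ besselRatio ℓ (halfOrder ℓ * z) := fun z hz =>
    besselRatio_nonneg ℓ (by positivity)
  have hc : Continuous fun z => besselRatio ℓ (halfOrder ℓ * z) := by
    have : Continuous (besselRatio ℓ) :=
      continuous_iff_continuousAt.2 fun z => (hasDerivAt_besselRatio ℓ z).continuousAt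
    fun_prop
  have hd : ∀ z, 0 < z → HasDerivAt (fun z => besselRatio ℓ (halfOrder ℓ * z))
      ((1 - besselRatio ℓ (halfOrder ℓ * z) ^ 2 - 2 * besselRatio ℓ (halfOrder ℓ * z) / z) /
        (halfOrder ℓ)⁻¹) z := by
    intro z hz
    refine ((hasDerivAt_besselRatio ℓ (halfOrder ℓ * z)).comp z
      ((hasDerivAt_id z).const_mul (halfOrder ℓ))).congr_deriv ?_
    have h1 := mul_besselRatioDiv ℓ (halfOrder ℓ * z)
    have h2 : (2 * (ℓ : ℝ) + 1) = 2 * halfOrder ℓ := by rw [halfOrder]; ring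
    have h3 : besselRatioDiv ℓ (halfOrder ℓ * z) = 2 * besselRatio ℓ (halfOrder ℓ * z) / z := by
      rw [h2] at h1
      rw [eq_div_iff hz.ne']
      refine mul_left_cancel₀ hν.ne' ?_
      linarith
    rw [h3, div_inv_eq_mul]
    ring
  have h0 : besselRatio ℓ (halfOrder ℓ * 0) = 0 := by rw [mul_zero, besselRatio_zero]
  exact ⟨abs_sub_profile_le (inv_pos.2 hν) (inv_halfOrder_le ℓ) hc h0 hnn hd hz,
    abs_sub_profile_sub_le (inv_pos.2 hν) (inv_halfOrder_le ℓ) hc h0 hnn hle hd hz,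
    hnn z hz, hle z hz⟩

theorem abs_div_one_add_sq_le (a y : ℝ) : |a / (1 + y ^ 2)| ≤ |a| := by
  rw [abs_div, abs_of_nonneg (show 0 ≤ 1 + y ^ 2 by positivity)]
  exact div_le_self (abs_nonneg a) (by nlinarith [sq_nonneg y])

theorem abs_div_one_add_sq_sub_le (a y : ℝ) :
    |a / (1 + (a * y) ^ 2) - a| ≤ |a| ^ 3 * y ^ 2 := by
  have h1 : a / (1 + (a * y) ^ 2) - a = -(a ^ 3 * y ^ 2 / (1 + (a * y) ^ 2)) := by
    field_simp
    ring
  rw [h1, abs_neg, abs_div, abs_mul, abs_pow, abs_of_nonneg (sq_nonneg y),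
    abs_of_nonneg (show 0 ≤ 1 + (a * y) ^ 2 by positivity)]
  exact div_le_self (by positivity) (by nlinarith [sq_nonneg (a * y)])

theorem abs_phaseRem_le (a : ℝ) (ℓ : ℕ) {z : ℝ} (hz : 0 < z) :
    |phaseRem a ℓ z - a * remCoeff ℓ * z| ≤
      (51 * |a| ^ 3 + 2 * |a|) * (halfOrder ℓ)⁻¹ ^ 2 * z ^ 3 ∧
    |phaseRem a ℓ z| ≤ (51 * |a| ^ 3 + 2 * |a|) * (halfOrder ℓ)⁻¹ ^ 2 * z⁻¹ := by
  obtain ⟨h1, h2, h3, h4⟩ := abs_besselRatio_sub_profile_le ℓ hz.le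
  have hν := halfOrder_pos ℓ
  have hε2 := inv_halfOrder_le ℓ
  have hp0 := profileZero_nonneg hz.le
  have hp1 := profileZero_le hz.le
  have hp2 := abs_profileOne_le hz.le
  have hT := abs_arctan_mul_sub_le a h3 hp0
  have hP := abs_div_one_add_sq_le a (a * profileZero z)
  have hP' := abs_div_one_add_sq_sub_le a (profileZero z)
  have hε : 0 < (halfOrder ℓ)⁻¹ := inv_pos.2 hν
  have hrem0 : 0 ≤ remCoeff ℓ := by rw [remCoeff]; positivity
  have hrem : remCoeff ℓ ≤ (halfOrder ℓ)⁻¹ ^ 2 / 8 := by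
    rw [remCoeff]
    gcongr
    linarith
  have hE : phaseRem a ℓ z = (Real.arctan (a * besselRatio ℓ (halfOrder ℓ * z)) -
      Real.arctan (a * profileZero z) - a / (1 + (a * profileZero z) ^ 2) *
        (besselRatio ℓ (halfOrder ℓ * z) - profileZero z)) + a / (1 + (a * profileZero z) ^ 2) *
      (besselRatio ℓ (halfOrder ℓ * z) - (profileZero z + (halfOrder ℓ)⁻¹ * profileOne z)) := by
    rw [phaseRem, phaseZero, phaseOne]
    ring
  rw [hE]
  set T := Real.arctan (a * besselRatio ℓ (halfOrder ℓ * z)) -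
      Real.arctan (a * profileZero z) - a / (1 + (a * profileZero z) ^ 2) *
        (besselRatio ℓ (halfOrder ℓ * z) - profileZero z)
  set P := a / (1 + (a * profileZero z) ^ 2)
  set ε := (halfOrder ℓ)⁻¹
  set ρ := besselRatio ℓ (halfOrder ℓ * z)
  set p := profileZero z
  have hdiff : |ρ - p| ≤ 5 * ε * (z / (1 + z ^ 2)) := by
    have e1 : ρ - p = (ρ - (p + ε * profileOne z)) + ε * profileOne z := by ring
    rw [e1]
    refine (abs_add_le _ _).trans ?_
    have e2 : |ε * profileOne z| ≤ ε * (z / (1 + z ^ 2)) := by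
      rw [abs_mul, abs_of_pos hε]
      gcongr
      refine hp2.trans ?_
      gcongr
      nlinarith [sq_nonneg z]
    have e3 : 2 * ε ^ 2 * (z / (1 + z ^ 2)) ≤ 4 * ε * (z / (1 + z ^ 2)) := by
      gcongr ?_ * _
      nlinarith
    linarith
  have hT' : |T| ≤ 50 * |a| ^ 3 * ε ^ 2 * (z * (z / (1 + z ^ 2)) ^ 2) := by
    refine hT.trans ?_
    calc 2 * |a| ^ 3 * (ρ + p) * |ρ - p| ^ 2
        ≤ 2 * |a| ^ 3 * z * (5 * ε * (z / (1 + z ^ 2))) ^ 2 := by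
          gcongr
          linarith
      _ = _ := by ring
  constructor
  · have e1 : T + P * (ρ - (p + ε * profileOne z)) - a * remCoeff ℓ * z =
        T + P * (ρ - (p + ε * profileOne z) - remCoeff ℓ * z) + (P - a) * (remCoeff ℓ * z) := by
      ring
    rw [e1]
    have e2 : |P * (ρ - (p + ε * profileOne z) - remCoeff ℓ * z)| ≤
        |a| * (3 / 2 * ε ^ 2 * z ^ 3) := by
      rw [abs_mul]
      gcongr
    have e3 : |(P - a) * (remCoeff ℓ * z)| ≤ |a| ^ 3 * (z / 2) ^ 2 * (ε ^ 2 / 8 * z) := by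
      rw [abs_mul, abs_of_nonneg (show 0 ≤ remCoeff ℓ * z by positivity)]
      have : |a| ^ 3 * p ^ 2 ≤ |a| ^ 3 * (z / 2) ^ 2 := by gcongr
      have := hP'.trans this
      gcongr
    have e4 : 50 * |a| ^ 3 * ε ^ 2 * (z * (z / (1 + z ^ 2)) ^ 2) ≤
        50 * |a| ^ 3 * ε ^ 2 * (z * z ^ 2) := by
      gcongr
      exact div_le_self hz.le (by nlinarith [sq_nonneg z])
    have e5 : 0 ≤ |a| ^ 3 * ε ^ 2 * z ^ 3 := by positivity
    have e6 : 0 ≤ |a| * ε ^ 2 * z ^ 3 := by positivity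
    refine (abs_add_three _ _ _).trans ?_
    nlinarith
  · refine (abs_add_le _ _).trans ?_
    have hz2 : z / (1 + z ^ 2) ≤ z⁻¹ := by
      rw [div_le_iff₀ (by positivity), mul_add, mul_one, pow_two, inv_mul_cancel_left₀ hz.ne']
      have : 0 < z⁻¹ := inv_pos.2 hz
      linarith
    have e2 : |P * (ρ - (p + ε * profileOne z))| ≤ |a| * (2 * ε ^ 2 * z⁻¹) := by
      rw [abs_mul]
      have : 2 * ε ^ 2 * (z / (1 + z ^ 2)) ≤ 2 * ε ^ 2 * z⁻¹ := by gcongr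
      have := h1.trans this
      gcongr
    have e4 : 50 * |a| ^ 3 * ε ^ 2 * (z * (z / (1 + z ^ 2)) ^ 2) ≤
        50 * |a| ^ 3 * ε ^ 2 * (z * z⁻¹ ^ 2) := by gcongr
    have e5 : z * z⁻¹ ^ 2 = z⁻¹ := by field_simp
    have e6 : 0 ≤ |a| ^ 3 * ε ^ 2 * z⁻¹ := by positivity
    rw [e5] at e4
    nlinarith

theorem abs_profileZero_sub_le {z : ℝ} (hz : 0 ≤ z) : |profileZero z - z / 2| ≤ z ^ 3 := by
  have h1 := one_le_sqrt_one_add_sq z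
  have h2 := sq_sqrt_one_add_sq z
  rw [profileZero]
  set w := √(1 + z ^ 2)
  have e : z / (1 + w) - z / 2 = -(z ^ 3 / (2 * (1 + w) ^ 2)) := by
    have : z ^ 3 = z * (w ^ 2 - 1) := by rw [h2]; ring
    rw [this]
    field_simp
    ring
  rw [e, abs_neg, abs_of_nonneg (by positivity)]
  exact div_le_self (by positivity) (by nlinarith)

theorem abs_phaseZero_le (a : ℝ) {z : ℝ} (hz : 0 < z) :
    |phaseZero a z - a / 2 * z| ≤ (2 * |a| ^ 3 + 2 * |a|) * z ^ 3 ∧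
    |phaseZero a z - Real.arctan a| ≤ (2 * |a| ^ 3 + 2 * |a|) * z⁻¹ := by
  have hp0 := profileZero_nonneg hz.le
  have hp1 := profileZero_le hz.le
  constructor
  · have h := abs_arctan_mul_sub_le a hp0 le_rfl
    simp only [mul_zero, Real.arctan_zero, sub_zero, ne_eq, OfNat.ofNat_ne_zero, not_false_eq_true,
      zero_pow, add_zero, div_one] at h
    have e1 : phaseZero a z - a / 2 * z = (Real.arctan (a * profileZero z) - a * profileZero z) +
        a * (profileZero z - z / 2) := by
      rw [phaseZero]
      ring
    rw [e1]
    refine (abs_add_le _ _).trans ?_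
    have e2 : |a * (profileZero z - z / 2)| ≤ |a| * z ^ 3 := by
      rw [abs_mul]
      have := abs_profileZero_sub_le hz.le
      gcongr
    have e3 : 2 * |a| ^ 3 * profileZero z * |profileZero z| ^ 2 ≤ 2 * |a| ^ 3 * z * z ^ 2 := by
      rw [abs_of_nonneg hp0]
      have : profileZero z ≤ z := by linarith
      gcongr
    have e4 : 0 ≤ |a| * z ^ 3 := by positivity
    nlinarith
  · have hlip : |Real.arctan (a * profileZero z) - Real.arctan (a * 1)| ≤
        |a| * |profileZero z - 1| := by
      have := (convex_univ (𝕜 := ℝ) (E := ℝ)).norm_image_sub_le_of_norm_hasDerivWithin_le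
        (f := fun u => Real.arctan (a * u)) (C := |a|) (x := 1) (y := profileZero z)
        (fun u _ => (((hasDerivAt_id u).const_mul a).arctan).hasDerivWithinAt)
        (fun u _ => by
          have := abs_div_one_add_sq_le a (a * u)
          simp only [id, mul_one, Real.norm_eq_abs]
          rwa [one_div_mul_eq_div]) trivial trivial
      simpa only [Real.norm_eq_abs] using this
    rw [mul_one] at hlip
    have h1 := one_le_sqrt_one_add_sq z
    have h3 : z ≤ √(1 + z ^ 2) := Real.le_sqrt_of_sq_le (by linarith)
    have hw : √(1 + z ^ 2) ≤ 1 + z := by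
      rw [Real.sqrt_le_left (by positivity)]
      nlinarith
    have h4 : |profileZero z - 1| ≤ 2 * z⁻¹ := by
      rw [abs_sub_comm, abs_of_nonneg (by linarith [profileZero_lt_one z]), profileZero,
        one_sub_div (by positivity), ← div_eq_mul_inv, div_le_div_iff₀ (by positivity) hz]
      nlinarith
    have h5 : 0 ≤ 2 * |a| ^ 3 * z⁻¹ := by positivity
    have h6 := mul_le_mul_of_nonneg_left h4 (abs_nonneg a)
    rw [phaseZero]
    nlinarith

theorem abs_phaseOne_le (a : ℝ) {z : ℝ} (hz : 0 < z) :
    |phaseOne a z - -(a / 4) * z| ≤ (|a| ^ 3 + 2 * |a|) * z ^ 3 ∧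
    |phaseOne a z| ≤ (|a| ^ 3 + 2 * |a|) * z⁻¹ := by
  have hp0 := profileZero_nonneg hz.le
  have hp1 := profileZero_le hz.le
  have hp2 := abs_profileOne_le hz.le
  have hpz := abs_profileZero_sub_le hz.le
  have hP := abs_div_one_add_sq_le a (a * profileZero z)
  have hP' := abs_div_one_add_sq_sub_le a (profileZero z)
  have hz3 : 0 < z ^ 3 := by positivity
  constructor
  · have e1 : phaseOne a z - -(a / 4) * z = (a / (1 + (a * profileZero z) ^ 2) - a) * profileOne z +
        a * (-((profileZero z - z / 2) / (2 * (1 + z ^ 2))) + z / 4 * (z ^ 2 / (1 + z ^ 2))) := by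
      rw [phaseOne, profileOne_eq]
      field_simp
      ring
    rw [e1]
    refine (abs_add_le _ _).trans ?_
    have e2 : |(a / (1 + (a * profileZero z) ^ 2) - a) * profileOne z| ≤ |a| ^ 3 * z ^ 2 * z := by
      rw [abs_mul]
      have h1 : |a| ^ 3 * profileZero z ^ 2 ≤ |a| ^ 3 * z ^ 2 := by
        have : profileZero z ≤ z := by linarith
        gcongr
      have h2 : z / (4 * (1 + z ^ 2)) ≤ z := div_le_self hz.le (by nlinarith [sq_nonneg z])
      have h3 := hP'.trans h1
      have h4 := hp2.trans h2
      gcongr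
    have e3 : |a * (-((profileZero z - z / 2) / (2 * (1 + z ^ 2))) +
        z / 4 * (z ^ 2 / (1 + z ^ 2)))| ≤ |a| * (z ^ 3 + z ^ 3) := by
      rw [abs_mul]
      gcongr
      refine (abs_add_le _ _).trans (add_le_add ?_ ?_)
      · rw [abs_neg, abs_div, abs_of_nonneg (show 0 ≤ 2 * (1 + z ^ 2) by positivity)]
        exact (div_le_self (abs_nonneg _) (by nlinarith [sq_nonneg z])).trans hpz
      · rw [abs_of_nonneg (by positivity)]
        have : z ^ 2 / (1 + z ^ 2) ≤ z ^ 2 :=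
          div_le_self (by positivity) (by nlinarith [sq_nonneg z])
        calc z / 4 * (z ^ 2 / (1 + z ^ 2)) ≤ z / 4 * z ^ 2 := by gcongr
          _ ≤ z ^ 3 := by nlinarith
    nlinarith
  · have e1 : phaseOne a z = a / (1 + (a * profileZero z) ^ 2) * profileOne z := by
      rw [phaseOne]
      ring
    have h2 : z / (4 * (1 + z ^ 2)) ≤ z⁻¹ := by
      rw [div_le_iff₀ (by positivity)]
      have : z⁻¹ * (4 * (1 + z ^ 2)) = 4 * z⁻¹ + 4 * z := by field_simp
      rw [this]
      have : 0 < z⁻¹ := inv_pos.2 hz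
      linarith
    have h3 : |phaseOne a z| ≤ |a| * z⁻¹ := by
      rw [e1, abs_mul]
      have := hp2.trans h2
      gcongr
    have h4 : 0 ≤ |a| ^ 3 * z⁻¹ := by positivity
    have h5 : 0 ≤ |a| * z⁻¹ := by positivity
    nlinarith

open Filter Topology MeasureTheory Set Asymptotics

/-- `G` is continuous, agrees with `c * z` up to `K * z ^ 3` and with `L` up to `K / z`. -/
structure IsPhaseLike (G : ℝ → ℝ) (c L K : ℝ) : Prop where
  continuous : Continuous G
  nonneg : 0 ≤ K
  abs_sub_linear_le : ∀ z, 0 < z → |G z - c * z| ≤ K * z ^ 3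
  abs_sub_limit_le : ∀ z, 0 < z → |G z - L| ≤ K * z⁻¹

/-- `G` with its linear part removed near `0` and its limit removed near infinity. -/
noncomputable def regularized (G : ℝ → ℝ) (c L : ℝ) (z : ℝ) : ℂ :=
  ((indicator (Iic 1) (fun z => G z - c * z) z + indicator (Ioi 1) (fun z => G z - L) z : ℝ) : ℂ)

theorem regularized_of_le (G : ℝ → ℝ) (c L : ℝ) {z : ℝ} (hz : z ≤ 1) :
    regularized G c L z = ((G z - c * z : ℝ) : ℂ) := by
  simp [regularized, hz, hz.not_gt]

theorem regularized_of_lt (G : ℝ → ℝ) (c L : ℝ) {z : ℝ} (hz : 1 < z) :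
    regularized G c L z = ((G z - L : ℝ) : ℂ) := by
  simp [regularized, hz, hz.not_ge]

/-- The Mellin transform at `-s` of the regularized function. -/
noncomputable def regMellin (G : ℝ → ℝ) (c L : ℝ) (s : ℂ) : ℂ := mellin (regularized G c L) (-s)

namespace IsPhaseLike

variable {G : ℝ → ℝ} {c L K : ℝ}

theorem locallyIntegrableOn (h : IsPhaseLike G c L K) :
    LocallyIntegrableOn (regularized G c L) (Ioi 0) := by
  have h1 : LocallyIntegrable (fun z => G z - c * z) :=
    (h.continuous.sub (continuous_const.mul continuous_id)).locallyIntegrable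
  have h2 : LocallyIntegrable (fun z => G z - L) :=
    (h.continuous.sub continuous_const).locallyIntegrable
  have h3 := (h1.indicator (measurableSet_Iic (a := (1 : ℝ)))).add
    (h2.indicator (measurableSet_Ioi (a := (1 : ℝ))))
  have h4 : LocallyIntegrable (regularized G c L) := by
    intro x
    obtain ⟨u, hu, hi⟩ := h3 x
    exact ⟨u, hu, hi.ofReal⟩
  exact h4.locallyIntegrableOn _

theorem isBigO_atTop (h : IsPhaseLike G c L K) :
    regularized G c L =O[atTop] (· ^ (-(1 : ℝ))) := by
  refine IsBigO.of_bound K ?_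
  filter_upwards [eventually_gt_atTop 1] with z hz
  have h0 : (0 : ℝ) < z := by linarith
  rw [regularized_of_lt _ _ _ hz, Complex.norm_real, Real.norm_eq_abs, Real.rpow_neg_one,
    Real.norm_eq_abs, abs_of_pos (inv_pos.2 h0)]
  exact h.abs_sub_limit_le z h0

theorem isBigO_zero (h : IsPhaseLike G c L K) :
    regularized G c L =O[𝓝[>] 0] (· ^ (-(-3 : ℝ))) := by
  refine IsBigO.of_bound K ?_
  filter_upwards [Ioo_mem_nhdsGT (zero_lt_one : (0 : ℝ) < 1)] with z hz
  rw [regularized_of_le _ _ _ hz.2.le, Complex.norm_real, Real.norm_eq_abs, neg_neg,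
    Real.norm_eq_abs, show (3 : ℝ) = ((3 : ℕ) : ℝ) by norm_num, Real.rpow_natCast,
    abs_of_pos (pow_pos hz.1 3)]
  exact h.abs_sub_linear_le z hz.1

theorem mellinConvergent (h : IsPhaseLike G c L K) {s : ℂ} (h1 : -1 < s.re) (h3 : s.re < 3) :
    MellinConvergent (regularized G c L) (-s) :=
  mellinConvergent_of_isBigO_rpow h.locallyIntegrableOn h.isBigO_atTop
    (by rw [Complex.neg_re]; linarith) h.isBigO_zero (by rw [Complex.neg_re]; linarith)

theorem differentiableAt_regMellin (h : IsPhaseLike G c L K) {s : ℂ} (h1 : -1 < s.re)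
    (h3 : s.re < 3) : DifferentiableAt ℂ (regMellin G c L) s := by
  have := mellin_differentiableAt_of_isBigO_rpow (s := -s) h.locallyIntegrableOn h.isBigO_atTop
    (by rw [Complex.neg_re]; linarith) h.isBigO_zero (by rw [Complex.neg_re]; linarith)
  exact this.comp s differentiableAt_id.neg

end IsPhaseLike

/-- An integrable majorant for the Mellin integrands in the strip `-1 / 2 ≤ re s ≤ 5 / 2`. -/
noncomputable def stripMajorant (z : ℝ) : ℝ :=
  indicator (Iic 1) (fun z => z ^ (-(1 / 2) : ℝ)) z +
    indicator (Ioi 1) (fun z => z ^ (-(3 / 2) : ℝ)) z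

theorem integrableOn_stripMajorant : IntegrableOn stripMajorant (Ioi 0) := by
  refine Integrable.add ?_ ?_
  · rw [← IntegrableOn, integrableOn_indicator_iff measurableSet_Iic, Iic_inter_Ioi,
      ← intervalIntegrable_iff_integrableOn_Ioc_of_le zero_le_one]
    exact intervalIntegral.intervalIntegrable_rpow' (by norm_num)
  · rw [← IntegrableOn, integrableOn_indicator_iff measurableSet_Ioi]
    exact (integrableOn_Ioi_rpow_of_lt (by norm_num) zero_lt_one).mono_set inter_subset_left

theorem IsPhaseLike.norm_regMellin_le {G : ℝ → ℝ} {c L K : ℝ} (h : IsPhaseLike G c L K) {s : ℂ}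
    (h1 : -(1 / 2) ≤ s.re) (h2 : s.re ≤ 5 / 2) :
    ‖regMellin G c L s‖ ≤ K * ∫ z in Ioi 0, stripMajorant z := by
  rw [regMellin, mellin, ← integral_const_mul]
  refine norm_integral_le_of_norm_le (integrableOn_stripMajorant.const_mul K) ?_
  refine (ae_restrict_iff' measurableSet_Ioi).2 (Eventually.of_forall fun z hz => ?_)
  have hz : 0 < z := hz
  rw [norm_smul, Complex.norm_cpow_eq_rpow_re_of_pos hz, Complex.sub_re, Complex.neg_re,
    Complex.one_re]
  rcases le_or_gt z 1 with hz1 | hz1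
  · have h3 : stripMajorant z = z ^ (-(1 / 2) : ℝ) := by
      simp [stripMajorant, hz1, hz1.not_gt]
    rw [h3, regularized_of_le _ _ _ hz1, Complex.norm_real, Real.norm_eq_abs]
    calc z ^ (-s.re - 1) * |G z - c * z| ≤ z ^ (-s.re - 1) * (K * z ^ 3) := by
          gcongr
          exact h.abs_sub_linear_le z hz
      _ = K * z ^ (2 - s.re) := by
          rw [mul_left_comm, ← Real.rpow_natCast, ← Real.rpow_add hz]
          congr 2
          push_cast
          ring
      _ ≤ _ := mul_le_mul_of_nonneg_left
          (Real.rpow_le_rpow_of_exponent_ge hz hz1 (by linarith)) h.nonneg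
  · have h3 : stripMajorant z = z ^ (-(3 / 2) : ℝ) := by
      simp [stripMajorant, hz1, hz1.not_ge]
    rw [h3, regularized_of_lt _ _ _ hz1, Complex.norm_real, Real.norm_eq_abs]
    calc z ^ (-s.re - 1) * |G z - L| ≤ z ^ (-s.re - 1) * (K * z⁻¹) := by
          gcongr
          exact h.abs_sub_limit_le z hz
      _ = K * z ^ (-s.re - 2) := by
          rw [mul_left_comm, ← Real.rpow_neg_one, ← Real.rpow_add hz]
          congr 2
          ring
      _ ≤ _ := mul_le_mul_of_nonneg_left
          (Real.rpow_le_rpow_of_exponent_le hz1.le (by linarith)) h.nonneg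

theorem hasMellin_indicator_Ioi (c L : ℝ) {s : ℂ} (hs : 1 < s.re) :
    HasMellin (indicator (Ioi 1) (fun z : ℝ => ((L - c * z : ℝ) : ℂ))) (-s)
      (c / (1 - s) + L / s) := by
  have hs0 : s ≠ 0 := by
    rintro rfl
    simp at hs
    linarith
  have hs1 : 1 - s ≠ 0 := by
    intro h
    have := congrArg Complex.re h
    simp at this
    linarith
  have hE : EqOn (fun z : ℝ => (z : ℂ) ^ (-s - 1) •
      indicator (Ioi 1) (fun z : ℝ => ((L - c * z : ℝ) : ℂ)) z)
      (indicator (Ioi 1) (fun z : ℝ => (L : ℂ) * (z : ℂ) ^ (-s - 1) - c * (z : ℂ) ^ (-s)))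
      (Ioi 0) := by
    intro z hz
    have hz' : (z : ℂ) ≠ 0 := Complex.ofReal_ne_zero.2 (ne_of_gt hz)
    by_cases h1 : z ∈ Ioi (1 : ℝ)
    · simp only [indicator_of_mem h1, smul_eq_mul]
      rw [Complex.cpow_sub _ _ hz', Complex.cpow_one]
      push_cast
      field_simp
    · simp only [indicator_of_notMem h1, smul_zero]
  have hi1 : IntegrableOn (fun z : ℝ => (L : ℂ) * (z : ℂ) ^ (-s - 1)) (Ioi 1) :=
    (integrableOn_Ioi_cpow_of_lt (by simp; linarith) zero_lt_one).const_mul _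
  have hi2 : IntegrableOn (fun z : ℝ => (c : ℂ) * (z : ℂ) ^ (-s)) (Ioi 1) :=
    (integrableOn_Ioi_cpow_of_lt (by simp; linarith) zero_lt_one).const_mul _
  have hinter : Ioi (1 : ℝ) ∩ Ioi 0 = Ioi 1 := by
    rw [Ioi_inter_Ioi]
    norm_num
  refine ⟨?_, ?_⟩
  · refine IntegrableOn.congr_fun ?_ hE.symm measurableSet_Ioi
    rw [integrableOn_indicator_iff measurableSet_Ioi, hinter]
    exact hi1.sub hi2
  · rw [mellin, setIntegral_congr_fun measurableSet_Ioi hE, setIntegral_indicator measurableSet_Ioi,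
      inter_comm, hinter, integral_sub hi1 hi2, integral_const_mul, integral_const_mul,
      integral_Ioi_cpow_of_lt (by simp; linarith) zero_lt_one,
      integral_Ioi_cpow_of_lt (by simp; linarith) zero_lt_one]
    have hs2 : -s + 1 ≠ 0 := by rwa [neg_add_eq_sub]
    simp only [Complex.ofReal_one, Complex.one_cpow, sub_add_cancel, neg_add_eq_sub]
    field_simp
    ring

theorem IsPhaseLike.hasMellin_sub_linear {G : ℝ → ℝ} {c L K : ℝ} (h : IsPhaseLike G c L K) {s : ℂ}
    (h1 : 1 < s.re) (h3 : s.re < 3) :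
    HasMellin (fun z => ((G z - c * z : ℝ) : ℂ)) (-s)
      (regMellin G c L s + (c / (1 - s) + L / s)) := by
  have h2 := hasMellin_add (h.mellinConvergent (s := s) (by linarith) h3)
    (hasMellin_indicator_Ioi c L h1).1
  rw [(hasMellin_indicator_Ioi c L h1).2] at h2
  rw [regMellin]
  convert h2 using 2 with z
  rcases le_or_gt z 1 with hz1 | hz1
  · rw [regularized_of_le _ _ _ hz1, indicator_of_notMem (by simpa using hz1), add_zero]
  · rw [regularized_of_lt _ _ _ hz1, indicator_of_mem (by simpa using hz1)]
    push_cast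
    ring

theorem image_div_one_add_Ioi : (fun t : ℝ => t / (1 + t)) '' Ioi 0 = Ioo 0 1 := by
  ext x
  constructor
  · rintro ⟨t, ht, rfl⟩
    have ht : 0 < t := ht
    exact ⟨by positivity, by rw [div_lt_one (by positivity)]; linarith⟩
  · rintro ⟨h0, h1⟩
    have h2 : 0 < 1 - x := by linarith
    refine ⟨x / (1 - x), div_pos h0 h2, ?_⟩
    field_simp
    ring

theorem mellin_inv_one_add {w : ℂ} (h0 : 0 < w.re) (h1 : w.re < 1) :
    mellin (fun t : ℝ => (1 / (1 + t) : ℂ)) w = Real.pi / Complex.sin (Real.pi * w) := by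
  have hb : Complex.betaIntegral w (1 - w) = Real.pi / Complex.sin (Real.pi * w) := by
    have h := Complex.Gamma_mul_Gamma_eq_betaIntegral h0 (t := 1 - w) (by simpa using h1)
    rw [Complex.Gamma_mul_Gamma_one_sub] at h
    simpa using h.symm
  rw [← hb, Complex.betaIntegral, intervalIntegral.integral_of_le zero_le_one,
    integral_Ioc_eq_integral_Ioo, ← image_div_one_add_Ioi,
    integral_image_eq_integral_abs_deriv_smul (f' := fun t => 1 / (1 + t) ^ 2) measurableSet_Ioi]
  · refine setIntegral_congr_fun measurableSet_Ioi fun t ht => ?_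
    have ht : 0 < t := ht
    have ht1 : 0 < 1 + t := by linarith
    have htc : ((1 + t : ℝ) : ℂ) ≠ 0 := Complex.ofReal_ne_zero.2 ht1.ne'
    have hsub : (1 : ℂ) - ((t / (1 + t) : ℝ) : ℂ) = (((1 + t)⁻¹ : ℝ) : ℂ) := by
      rw [← Complex.ofReal_one, ← Complex.ofReal_sub]
      congr 1
      field_simp
      ring
    simp only [smul_eq_mul, Complex.real_smul]
    rw [hsub, abs_of_pos (by positivity), div_eq_mul_inv t, Complex.ofReal_mul,
      Complex.mul_cpow_ofReal_nonneg ht.le (by positivity), mul_assoc, ← Complex.cpow_add _ _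
      (Complex.ofReal_ne_zero.2 (inv_ne_zero ht1.ne')),
      show w - 1 + (1 - w - 1) = -1 by ring, Complex.cpow_neg_one]
    push_cast at htc ⊢
    field_simp
  · intro t ht
    have ht : 0 < t := ht
    have h := ((hasDerivAt_id t).div ((hasDerivAt_id t).const_add 1)
      (by simp only [id]; linarith)).hasDerivWithinAt (s := Ioi 0)
    simp only [id] at h
    refine h.congr_deriv ?_
    congr 1
    ring
  · intro x hx y hy hxy
    have hx : 0 < x := hx
    have hy : 0 < y := hy
    simp only at hxy
    rw [div_eq_div_iff (by positivity) (by positivity)] at hxy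
    linarith

theorem mellin_inv_one_add_sq {w : ℂ} (h0 : 0 < w.re) (h2 : w.re < 2) :
    MellinConvergent (fun t : ℝ => (1 / (1 + t ^ 2) : ℂ)) w ∧
      mellin (fun t : ℝ => (1 / (1 + t ^ 2) : ℂ)) w =
        Real.pi / (2 * Complex.sin (Real.pi * w / 2)) := by
  have hnorm : ∀ t : ℝ, ‖(1 / (1 + t ^ 2) : ℂ)‖ = 1 / (1 + t ^ 2) := by
    intro t
    rw [show (1 / (1 + t ^ 2) : ℂ) = ((1 / (1 + t ^ 2) : ℝ) : ℂ) by push_cast; rfl,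
      Complex.norm_real, Real.norm_eq_abs, abs_of_pos (by positivity)]
  constructor
  · refine mellinConvergent_of_isBigO_rpow (a := 2) (b := 0) ?_ ?_ h2 ?_ h0
    · refine (Continuous.locallyIntegrable ?_).locallyIntegrableOn _
      refine continuous_const.div (by fun_prop) fun t ht => ?_
      have h3 : ((1 + t ^ 2 : ℝ) : ℂ) ≠ 0 := Complex.ofReal_ne_zero.2 (by positivity)
      push_cast at h3
      exact h3 ht
    · refine IsBigO.of_bound 1 ?_
      filter_upwards [eventually_gt_atTop 0] with t ht
      rw [hnorm, one_mul, Real.rpow_neg ht.le, Real.norm_eq_abs,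
        show (2 : ℝ) = ((2 : ℕ) : ℝ) by norm_num, Real.rpow_natCast, abs_of_pos (by positivity),
        ← one_div]
      gcongr
      linarith
    · refine IsBigO.of_bound 1 ?_
      filter_upwards with t
      rw [hnorm, neg_zero, Real.rpow_zero, norm_one, one_mul]
      rw [div_le_one (by positivity)]
      nlinarith [sq_nonneg t]
  · have h := mellin_comp_rpow (fun t : ℝ => (1 / (1 + t) : ℂ)) w 2
    have h' : mellin (fun t : ℝ => (1 / (1 + t ^ 2) : ℂ)) w =
        mellin (fun t : ℝ => (1 / (1 + (t ^ (2 : ℝ) : ℝ)) : ℂ)) w := by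
      congr 1
      ext t
      rw [show (2 : ℝ) = ((2 : ℕ) : ℝ) by norm_num, Real.rpow_natCast]
      push_cast
      rfl
    have hre : (w / ((2 : ℝ) : ℂ)).re = w.re / 2 := Complex.div_ofReal_re w 2
    rw [h', h, mellin_inv_one_add (by rw [hre]; linarith) (by rw [hre]; linarith)]
    rw [abs_of_pos two_pos, Complex.real_smul]
    push_cast
    rw [mul_div_assoc, ← div_div, inv_mul_eq_div, div_right_comm]

theorem arctan_le_self {x : ℝ} (hx : 0 ≤ x) : Real.arctan x ≤ x := by
  conv_rhs => rw [← Real.tan_arctan x]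
  exact Real.le_tan (Real.arctan_nonneg.2 hx) (Real.arctan_lt_pi_div_two x)

theorem isPhaseLike_arctan : IsPhaseLike Real.arctan 1 (Real.pi / 2) 2 where
  continuous := Real.continuous_arctan
  nonneg := by norm_num
  abs_sub_linear_le z hz := by
    have h := abs_arctan_mul_sub_le 1 hz.le le_rfl
    simp at h
    rw [one_mul]
    refine h.trans (le_of_eq ?_)
    ring
  abs_sub_limit_le z hz := by
    have h := Real.arctan_inv_of_pos hz
    have h1 := arctan_le_self (inv_pos.2 hz).le
    have h2 := Real.arctan_nonneg.2 (inv_pos.2 hz).le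
    have h3 := inv_pos.2 hz
    rw [abs_le]
    constructor <;> linarith

/-- The Mellin transform of `arctan u - u` in the strip `1 < re s < 3`. -/
theorem hasMellin_arctan_sub_self {s : ℂ} (h1 : 1 < s.re) (h3 : s.re < 3) :
    HasMellin (fun u : ℝ => ((Real.arctan u - u : ℝ) : ℂ)) (-s)
      (Real.pi / (2 * s * Complex.cos (Real.pi * s / 2))) := by
  have hs0 : s ≠ 0 := by
    rintro rfl
    simp at h1
    linarith
  have hconv : MellinConvergent (fun u : ℝ => ((Real.arctan u - u : ℝ) : ℂ)) (-s) := by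
    simpa using (isPhaseLike_arctan.hasMellin_sub_linear h1 h3).1
  refine ⟨hconv, ?_⟩
  obtain ⟨hc, hv⟩ := mellin_inv_one_add_sq (w := 3 - s) (by simp; linarith) (by simp; linarith)
  have hE : ∀ u ∈ Ioi (0 : ℝ), ((1 / (1 + u ^ 2) - 1 : ℝ) : ℂ) * (-(u : ℂ) ^ (-s) / s) =
      s⁻¹ * ((u : ℂ) ^ (3 - s - 1) • (1 / (1 + u ^ 2) : ℂ)) := by
    intro u hu
    have hu0 : (u : ℂ) ≠ 0 := Complex.ofReal_ne_zero.2 (ne_of_gt hu)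
    have h4 : ((1 + u ^ 2 : ℝ) : ℂ) ≠ 0 := Complex.ofReal_ne_zero.2 (by positivity)
    rw [show (3 : ℂ) - s - 1 = (2 : ℕ) + -s by push_cast; ring, Complex.cpow_add _ _ hu0,
      Complex.cpow_natCast, smul_eq_mul]
    push_cast at h4 ⊢
    field_simp
    ring
  have hibp := integral_Ioi_mul_deriv_eq_deriv_mul (a := 0) (a' := (0 : ℂ)) (b' := (0 : ℂ))
    (u := fun u : ℝ => ((Real.arctan u - u : ℝ) : ℂ))
    (u' := fun u : ℝ => ((1 / (1 + u ^ 2) - 1 : ℝ) : ℂ))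
    (v := fun u : ℝ => -(u : ℂ) ^ (-s) / s) (v' := fun u : ℝ => (u : ℂ) ^ (-s - 1))
    ?_ ?_ ?_ ?_ ?_ ?_
  · rw [mellin]
    simp only [smul_eq_mul]
    rw [setIntegral_congr_fun measurableSet_Ioi (fun u _ => mul_comm _ _), hibp,
      setIntegral_congr_fun measurableSet_Ioi hE, integral_const_mul]
    rw [mellin] at hv
    rw [hv, show (Real.pi : ℂ) * (3 - s) / 2 = Real.pi - (Real.pi * s / 2 - Real.pi / 2) by ring,
      Complex.sin_pi_sub, Complex.sin_sub_pi_div_two]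
    by_cases hcos : Complex.cos (Real.pi * s / 2) = 0
    · simp [hcos]
    · field_simp
      ring
  · intro u _
    exact ((Real.hasDerivAt_arctan u).sub (hasDerivAt_id u)).ofReal_comp
  · intro u hu
    have h := ((hasDerivAt_ofReal_cpow_const (ne_of_gt hu : u ≠ 0)
      (r := -s) (neg_ne_zero.2 hs0)).neg).div_const s
    refine h.congr_deriv ?_
    field_simp
  · rw [MellinConvergent] at hconv
    refine hconv.congr_fun (fun u _ => ?_) measurableSet_Ioi
    exact mul_comm _ _
  · rw [MellinConvergent] at hc
    exact IntegrableOn.congr_fun (hc.const_mul s⁻¹) (fun u hu => (hE u hu).symm) measurableSet_Ioi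
  · refine squeeze_zero_norm' (a := fun u : ℝ => 2 * u ^ (3 - s.re) / ‖s‖) ?_ ?_
    · filter_upwards [self_mem_nhdsWithin] with u hu
      have hu : 0 < u := hu
      have h := isPhaseLike_arctan.abs_sub_linear_le u hu
      rw [one_mul] at h
      simp only [Pi.mul_apply]
      rw [norm_mul, norm_div, norm_neg, Complex.norm_cpow_eq_rpow_re_of_pos hu, Complex.norm_real,
        Real.norm_eq_abs, Complex.neg_re, ← mul_div_assoc, sub_eq_add_neg 3 s.re, Real.rpow_add hu,
        show (3 : ℝ) = ((3 : ℕ) : ℝ) by norm_num, Real.rpow_natCast, ← mul_assoc]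
      gcongr
    · have h : Tendsto (fun u : ℝ => u ^ (3 - s.re)) (𝓝[>] 0) (𝓝 0) := by
        have := (Real.continuousAt_rpow_const 0 (3 - s.re) (Or.inr (by linarith))).tendsto
        rw [Real.zero_rpow (by linarith)] at this
        exact this.mono_left nhdsWithin_le_nhds
      simpa using (h.const_mul 2).div_const ‖s‖
  · refine squeeze_zero_norm' (a := fun u : ℝ => u ^ (-(s.re - 1)) / ‖s‖) ?_ ?_
    · filter_upwards [eventually_gt_atTop 0] with u hu
      have h : |Real.arctan u - u| ≤ u := by
        have h1 := arctan_le_self hu.le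
        have h2 := Real.arctan_nonneg.2 hu.le
        rw [abs_le]
        constructor <;> linarith
      simp only [Pi.mul_apply]
      rw [norm_mul, norm_div, norm_neg, Complex.norm_cpow_eq_rpow_re_of_pos hu, Complex.norm_real,
        Real.norm_eq_abs, Complex.neg_re, ← mul_div_assoc, show -(s.re - 1) = 1 + -s.re by ring,
        Real.rpow_add hu, Real.rpow_one]
      gcongr
    · simpa using (tendsto_rpow_neg_atTop (by linarith : 0 < s.re - 1)).div_const ‖s‖

/-- The reciprocal of the Mellin transform of `arctan u - u`. -/
noncomputable def mellinFactor (s : ℂ) : ℂ := 2 / Real.pi * s * Complex.cos (Real.pi * s / 2)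

theorem mellinFactor_mul {s : ℂ} (h1 : 1 < s.re) (h3 : s.re < 3) :
    mellinFactor s * (Real.pi / (2 * s * Complex.cos (Real.pi * s / 2))) = 1 := by
  have hs0 : s ≠ 0 := by
    rintro rfl
    simp at h1
    linarith
  have hpi : (Real.pi : ℂ) ≠ 0 := Complex.ofReal_ne_zero.2 Real.pi_ne_zero
  have hcos : Complex.cos (Real.pi * s / 2) ≠ 0 := by
    rw [Complex.cos_ne_zero_iff]
    intro k hk
    have hk' : s = ((2 * k + 1 : ℤ) : ℂ) := by
      push_cast
      field_simp at hk
      linear_combination hk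
    rw [hk', Complex.intCast_re] at h1 h3
    have h4 : 1 < 2 * k + 1 := by exact_mod_cast h1
    have h5 : 2 * k + 1 < 3 := by exact_mod_cast h3
    omega
  rw [mellinFactor]
  field_simp

theorem continuous_phaseZero (a : ℝ) : Continuous (phaseZero a) :=
  Real.continuous_arctan.comp (continuous_const.mul continuous_profileZero)

theorem continuous_phaseOne (a : ℝ) : Continuous (phaseOne a) :=
  (continuous_const.mul continuous_profileOne).div
    (continuous_const.add ((continuous_const.mul continuous_profileZero).pow 2))
    fun z => by positivity

theorem continuous_besselRatio (ℓ : ℕ) : Continuous (besselRatio ℓ) :=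
  continuous_iff_continuousAt.2 fun y => (hasDerivAt_besselRatio ℓ y).continuousAt

theorem continuous_phaseRem (a : ℝ) (ℓ : ℕ) : Continuous (phaseRem a ℓ) :=
  ((Real.continuous_arctan.comp (continuous_const.mul ((continuous_besselRatio ℓ).comp
    (continuous_const.mul continuous_id)))).sub (continuous_phaseZero a)).sub
    (continuous_const.mul (continuous_phaseOne a))

theorem isPhaseLike_phaseZero (a : ℝ) :
    IsPhaseLike (phaseZero a) (a / 2) (Real.arctan a) (2 * |a| ^ 3 + 2 * |a|) :=
  ⟨continuous_phaseZero a, by positivity, fun _ hz => (abs_phaseZero_le a hz).1,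
    fun _ hz => (abs_phaseZero_le a hz).2⟩

theorem isPhaseLike_phaseOne (a : ℝ) :
    IsPhaseLike (phaseOne a) (-(a / 4)) 0 (|a| ^ 3 + 2 * |a|) :=
  ⟨continuous_phaseOne a, by positivity, fun _ hz => (abs_phaseOne_le a hz).1,
    fun _ hz => by simpa using (abs_phaseOne_le a hz).2⟩

theorem isPhaseLike_phaseRem (a : ℝ) (ℓ : ℕ) :
    IsPhaseLike (phaseRem a ℓ) (a * remCoeff ℓ) 0
      ((51 * |a| ^ 3 + 2 * |a|) * (halfOrder ℓ)⁻¹ ^ 2) :=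
  ⟨continuous_phaseRem a ℓ, by positivity, fun _ hz => (abs_phaseRem_le a ℓ hz).1,
    fun _ hz => by simpa using (abs_phaseRem_le a ℓ hz).2⟩

/-- The power `sign x * |x| ^ (-s)`. -/
noncomputable def signedPow (x : ℝ) (s : ℂ) : ℂ := ((x / |x| : ℝ) : ℂ) * ((|x| : ℝ) : ℂ) ^ (-s)

theorem norm_signedPow {x : ℝ} (hx : x ≠ 0) (s : ℂ) : ‖signedPow x s‖ = |x| ^ (-s.re) := by
  rw [signedPow, norm_mul, Complex.norm_cpow_eq_rpow_re_of_pos (abs_pos.2 hx), Complex.norm_real,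
    Real.norm_eq_abs, abs_div, abs_abs, div_self (abs_ne_zero.2 hx), one_mul, Complex.neg_re]

instance countable_bagZeros (ℓ : ℕ) (a : ℝ) [NeZero a] : Countable (BagZeros ℓ a) := by
  have h := (summable_bagZeros_inv_sq ℓ (NeZero.ne a)).1.countable_support
  have h2 : Function.support (fun x : BagZeros ℓ a => 1 / (x : ℝ) ^ 2) = univ := by
    ext x
    simpa using bagZeros_ne_zero x
  rw [h2] at h
  exact countable_univ_iff.1 h

theorem two_mul_abs_mul_halfOrder_le {ℓ : ℕ} {a : ℝ} (x : BagZeros ℓ a) :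
    2 * |a| / (1 + a ^ 2) * halfOrder ℓ ≤ |(x : ℝ)| := by
  have h := abs_le_of_bagFun_eq_zero ℓ a x.2
  rw [halfOrder, div_mul_eq_mul_div, div_le_iff₀ (by positivity)]
  linarith

theorem rpow_neg_le_of_bagZeros {ℓ : ℕ} {a : ℝ} (ha : a ≠ 0) {σ : ℝ} (hσ : 2 ≤ σ)
    (x : BagZeros ℓ a) :
    |(x : ℝ)| ^ (-σ) ≤ (2 * |a| / (1 + a ^ 2) * halfOrder ℓ) ^ (2 - σ) * (1 / (x : ℝ) ^ 2) := by
  have hx : 0 < |(x : ℝ)| := abs_pos.2 (bagZeros_ne_zero x)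
  have hν := halfOrder_pos ℓ
  have ha' := abs_pos.2 ha
  rw [show -σ = (2 - σ) + -(2 : ℕ) by push_cast; ring, Real.rpow_add hx, Real.rpow_neg hx.le,
    Real.rpow_natCast, sq_abs, ← one_div]
  gcongr ?_ * _
  exact Real.rpow_le_rpow_of_nonpos (by positivity) (two_mul_abs_mul_halfOrder_le x) (by linarith)

theorem summable_bagZeros_rpow (ℓ : ℕ) {a : ℝ} (ha : a ≠ 0) {σ : ℝ} (hσ : 2 ≤ σ) :
    Summable fun x : BagZeros ℓ a => |(x : ℝ)| ^ (-σ) :=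
  Summable.of_nonneg_of_le (fun x => by positivity) (fun x => rpow_neg_le_of_bagZeros ha hσ x)
    ((summable_bagZeros_inv_sq ℓ ha).1.mul_left _)

theorem summable_halfOrder_rpow {σ : ℝ} (hσ : 1 < σ) :
    Summable fun ℓ : ℕ => halfOrder ℓ ^ (-σ) := by
  have h := (Real.summable_nat_rpow (p := -σ)).2 (by linarith)
  have h2 := ((summable_nat_add_iff 1).2 h).mul_left (2 ^ σ : ℝ)
  refine Summable.of_nonneg_of_le (fun ℓ => (Real.rpow_pos_of_pos (halfOrder_pos ℓ) _).le)
    (fun ℓ => ?_) h2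
  have h3 : (2 : ℝ) ^ σ = (1 / 2 : ℝ) ^ (-σ) := by
    rw [Real.rpow_neg (by norm_num), ← Real.inv_rpow (by norm_num)]
    norm_num
  rw [h3, ← Real.mul_rpow (by norm_num) (by positivity)]
  refine Real.rpow_le_rpow_of_nonpos (by positivity) ?_ (by linarith)
  rw [halfOrder]
  push_cast
  linarith [(Nat.cast_nonneg ℓ : (0 : ℝ) ≤ ℓ)]

theorem summable_sigma_bagZeros_rpow {a : ℝ} (ha : a ≠ 0) {σ : ℝ} (hσ : 2 < σ) :
    Summable fun p : (ℓ : ℕ) × BagZeros ℓ a => |(p.2 : ℝ)| ^ (-σ) := by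
  refine (summable_sigma_of_nonneg fun p => by positivity).2
    ⟨fun ℓ => summable_bagZeros_rpow ℓ ha hσ.le, ?_⟩
  have ha' := abs_pos.2 ha
  have hb : 0 < 2 * |a| / (1 + a ^ 2) := by positivity
  have hsum := (summable_halfOrder_rpow (σ := σ - 1) (by linarith)).mul_left
    ((2 * |a| / (1 + a ^ 2)) ^ (2 - σ) * ((1 + ((1 + a ^ 2) / (2 * a)) ^ 2) * (1 + a ^ 2)))
  refine Summable.of_nonneg_of_le (fun ℓ => tsum_nonneg fun x => by positivity) (fun ℓ => ?_) hsum
  have hν := halfOrder_pos ℓ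
  calc ∑' x : BagZeros ℓ a, |(x : ℝ)| ^ (-σ)
      ≤ ∑' x : BagZeros ℓ a, (2 * |a| / (1 + a ^ 2) * halfOrder ℓ) ^ (2 - σ) * (1 / (x : ℝ) ^ 2) :=
        (summable_bagZeros_rpow ℓ ha hσ.le).tsum_le_tsum
          (fun x => rpow_neg_le_of_bagZeros ha hσ.le x)
          ((summable_bagZeros_inv_sq ℓ ha).1.mul_left _)
    _ = (2 * |a| / (1 + a ^ 2) * halfOrder ℓ) ^ (2 - σ) * ∑' x : BagZeros ℓ a, 1 / (x : ℝ) ^ 2 :=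
        tsum_mul_left
    _ ≤ (2 * |a| / (1 + a ^ 2) * halfOrder ℓ) ^ (2 - σ) *
        ((1 + ((1 + a ^ 2) / (2 * a)) ^ 2) * (1 + a ^ 2) * (halfOrder ℓ)⁻¹) := by
        refine mul_le_mul_of_nonneg_left ((summable_bagZeros_inv_sq ℓ ha).2.trans ?_)
          (Real.rpow_nonneg (by positivity) _)
        rw [div_eq_mul_inv]
        gcongr
        rw [halfOrder]
        linarith [(Nat.cast_nonneg ℓ : (0 : ℝ) ≤ ℓ)]
    _ = _ := by
        rw [Real.mul_rpow hb.le hν.le, show -(σ - 1) = (2 - σ) + -1 by ring, Real.rpow_add hν,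
          Real.rpow_neg_one]
        ring

theorem hasMellin_arctan_div (ν : ℝ) (hν : 0 < ν) {x : ℝ} (hx : x ≠ 0) {s : ℂ} (h1 : 1 < s.re)
    (h3 : s.re < 3) :
    HasMellin (fun z : ℝ => ((Real.arctan (ν * z / x) - ν * z / x : ℝ) : ℂ)) (-s)
      ((ν : ℂ) ^ s * signedPow x s * (Real.pi / (2 * s * Complex.cos (Real.pi * s / 2)))) := by
  have hax : 0 < |x| := abs_pos.2 hx
  have hc : 0 < ν / |x| := div_pos hν hax
  have hg := hasMellin_arctan_sub_self h1 h3
  have hE : (fun z : ℝ => ((Real.arctan (ν * z / x) - ν * z / x : ℝ) : ℂ)) =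
      fun z : ℝ => ((x / |x| : ℝ) : ℂ) •
        ((Real.arctan (ν / |x| * z) - ν / |x| * z : ℝ) : ℂ) := by
    ext z
    rw [smul_eq_mul, ← Complex.ofReal_mul]
    congr 1
    rcases lt_or_gt_of_ne hx with h | h
    · rw [abs_of_neg h, div_neg, div_self hx, show ν * z / x = -(ν / -x * z) by
        rw [div_neg]; ring, Real.arctan_neg]
      ring
    · rw [abs_of_pos h, div_self hx, show ν * z / x = ν / x * z by ring]
      ring
  rw [hE]
  have h4 := hasMellin_const_smul ((MellinConvergent.comp_mul_left hc).2 hg.1)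
    ((x / |x| : ℝ) : ℂ)
  refine ⟨h4.1, h4.2.trans ?_⟩
  rw [mellin_comp_mul_left (fun u : ℝ => ((Real.arctan u - u : ℝ) : ℂ)) _ hc, hg.2, signedPow,
    neg_neg, div_eq_mul_inv ν, Complex.ofReal_mul, Complex.mul_cpow_ofReal_nonneg hν.le
    (inv_pos.2 hax).le, Complex.ofReal_inv, Complex.inv_cpow _ _ ?_, Complex.cpow_neg]
  · simp only [smul_eq_mul]
    ring
  · rw [Complex.arg_ofReal_of_nonneg hax.le]
    exact Real.pi_ne_zero.symm

theorem hasSum_mellin_arctan_div (ℓ : ℕ) {a : ℝ} (ha : a ≠ 0) {s : ℂ} (h2 : 2 ≤ s.re)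
    (h3 : s.re < 3) :
    HasSum (fun x : BagZeros ℓ a => mellin (fun z : ℝ =>
        ((Real.arctan (halfOrder ℓ * z / x) - halfOrder ℓ * z / x : ℝ) : ℂ)) (-s))
      (mellin (fun z : ℝ => ((Real.arctan (a * besselRatio ℓ (halfOrder ℓ * z)) -
        a * (halfOrder ℓ * z) / (2 * (ℓ + 1)) : ℝ) : ℂ)) (-s)) := by
  have : NeZero a := ⟨ha⟩
  have hν := halfOrder_pos ℓ
  have hmain := hasSum_integral_of_summable_integral_norm (μ := volume.restrict (Ioi (0 : ℝ)))
    (F := fun (x : BagZeros ℓ a) (z : ℝ) => (z : ℂ) ^ (-s - 1) •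
      ((Real.arctan (halfOrder ℓ * z / x) - halfOrder ℓ * z / x : ℝ) : ℂ))
    (fun x => (hasMellin_arctan_div _ hν (bagZeros_ne_zero x) (by linarith) h3).1) ?_
  · have hE : mellin (fun z : ℝ => ((Real.arctan (a * besselRatio ℓ (halfOrder ℓ * z)) -
        a * (halfOrder ℓ * z) / (2 * (ℓ + 1)) : ℝ) : ℂ)) (-s) =
        ∫ z in Ioi (0 : ℝ), ∑' x : BagZeros ℓ a, (z : ℂ) ^ (-s - 1) •
      ((Real.arctan (halfOrder ℓ * z / x) - halfOrder ℓ * z / x : ℝ) : ℂ) := by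
      refine setIntegral_congr_fun measurableSet_Ioi fun z hz => ?_
      have hz : 0 < z := hz
      have h := hasSum_arctan_bagZeros ℓ ha (y := halfOrder ℓ * z) (by positivity)
      exact ((Complex.hasSum_ofReal.2 h).const_smul ((z : ℂ) ^ (-s - 1))).tsum_eq.symm
    rw [hE]
    exact hmain
  · set H : ℝ → ℝ := fun u => ‖(u : ℂ) ^ (-s - 1) • ((Real.arctan u - u : ℝ) : ℂ)‖ with hH
    have hI : ∀ x : BagZeros ℓ a, ∫ z in Ioi (0 : ℝ), ‖(z : ℂ) ^ (-s - 1) •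
        ((Real.arctan (halfOrder ℓ * z / x) - halfOrder ℓ * z / x : ℝ) : ℂ)‖ =
        (halfOrder ℓ ^ s.re * ∫ u in Ioi (0 : ℝ), H u) * |(x : ℝ)| ^ (-s.re) := by
      intro x
      have hx := abs_pos.2 (bagZeros_ne_zero x)
      have hc : 0 < halfOrder ℓ / |(x : ℝ)| := by positivity
      have hE : EqOn (fun z : ℝ => ‖(z : ℂ) ^ (-s - 1) •
          ((Real.arctan (halfOrder ℓ * z / x) - halfOrder ℓ * z / x : ℝ) : ℂ)‖)
          (fun z => (halfOrder ℓ / |(x : ℝ)|) ^ (s.re + 1) * H (halfOrder ℓ / |(x : ℝ)| * z))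
          (Ioi 0) := by
        intro z hz
        have hz : 0 < z := hz
        have habs : |Real.arctan (halfOrder ℓ * z / x) - halfOrder ℓ * z / x| =
            |Real.arctan (halfOrder ℓ / |(x : ℝ)| * z) - halfOrder ℓ / |(x : ℝ)| * z| := by
          rcases lt_or_gt_of_ne (bagZeros_ne_zero x) with h | h
          · rw [abs_of_neg h, show halfOrder ℓ * z / x = -(halfOrder ℓ / -x * z) by
              rw [div_neg]; ring, Real.arctan_neg, ← abs_neg]
            congr 1
            ring
          · rw [abs_of_pos h, show halfOrder ℓ * z / x = halfOrder ℓ / x * z by ring]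
        simp only [hH, norm_smul, Complex.norm_real, Real.norm_eq_abs]
        rw [habs, Complex.norm_cpow_eq_rpow_re_of_pos hz, Complex.norm_cpow_eq_rpow_re_of_pos
          (mul_pos hc hz), Real.mul_rpow hc.le hz.le]
        simp only [Complex.sub_re, Complex.neg_re, Complex.one_re]
        rw [← mul_assoc, ← mul_assoc, ← Real.rpow_add hc, show s.re + 1 + (-s.re - 1) = 0 by ring,
          Real.rpow_zero, one_mul]
      rw [setIntegral_congr_fun measurableSet_Ioi hE, integral_const_mul,
        integral_comp_mul_left_Ioi H 0 hc, mul_zero, smul_eq_mul, ← mul_assoc,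
        Real.rpow_add_one hc.ne', mul_inv_cancel_right₀ hc.ne', Real.div_rpow hν.le hx.le,
        Real.rpow_neg hx.le]
      ring
    simp only [hI]
    exact (summable_bagZeros_rpow ℓ ha h2).mul_left _

theorem phase_sub_linear_eq (a : ℝ) (ℓ : ℕ) (z : ℝ) :
    Real.arctan (a * besselRatio ℓ (halfOrder ℓ * z)) - a * (halfOrder ℓ * z) / (2 * (ℓ + 1)) =
      phaseZero a z - a / 2 * z + (halfOrder ℓ)⁻¹ * (phaseOne a z - -(a / 4) * z) +
        (phaseRem a ℓ z - a * remCoeff ℓ * z) := by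
  have hν := (halfOrder_pos ℓ).ne'
  have hl : a * (halfOrder ℓ * z) / (2 * (ℓ + 1)) =
      (a / 2 - (halfOrder ℓ)⁻¹ * (a / 4) + a * remCoeff ℓ) * z := by
    have h1 : (2 * (ℓ : ℝ) + 1) ≠ 0 := by positivity
    have h2 : ((ℓ : ℝ) + 1) ≠ 0 := by positivity
    have h3 : (4 * (2 + ((2 * (ℓ : ℝ) + 1) / 2)⁻¹)) ≠ 0 := by positivity
    rw [remCoeff, halfOrder]
    field_simp
    ring
  rw [hl, phaseRem]
  ring

/-- The Mellin transform of the rescaled phase, split according to the powers of the order. -/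
noncomputable def phaseMellin (a : ℝ) (ℓ : ℕ) (s : ℂ) : ℂ :=
  (regMellin (phaseZero a) (a / 2) (Real.arctan a) s + (a / 2 / (1 - s) + Real.arctan a / s)) +
    ((halfOrder ℓ)⁻¹ : ℝ) * (regMellin (phaseOne a) (-(a / 4)) 0 s + -(a / 4) / (1 - s)) +
    (regMellin (phaseRem a ℓ) (a * remCoeff ℓ) 0 s + a * remCoeff ℓ / (1 - s))

theorem mellin_phase (a : ℝ) (ℓ : ℕ) {s : ℂ} (h1 : 1 < s.re) (h3 : s.re < 3) :
    mellin (fun z : ℝ => ((Real.arctan (a * besselRatio ℓ (halfOrder ℓ * z)) -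
      a * (halfOrder ℓ * z) / (2 * (ℓ + 1)) : ℝ) : ℂ)) (-s) = phaseMellin a ℓ s := by
  have h0 := (isPhaseLike_phaseZero a).hasMellin_sub_linear h1 h3
  have h1' := (isPhaseLike_phaseOne a).hasMellin_sub_linear h1 h3
  have h2 := (isPhaseLike_phaseRem a ℓ).hasMellin_sub_linear h1 h3
  have hs := hasMellin_const_smul h1'.1 (((halfOrder ℓ)⁻¹ : ℝ) : ℂ)
  have ha := hasMellin_add h0.1 hs.1
  have hb := hasMellin_add ha.1 h2.1
  have hE : (fun z : ℝ => ((Real.arctan (a * besselRatio ℓ (halfOrder ℓ * z)) -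
      a * (halfOrder ℓ * z) / (2 * (ℓ + 1)) : ℝ) : ℂ)) = fun z : ℝ =>
      ((phaseZero a z - a / 2 * z : ℝ) : ℂ) +
        (((halfOrder ℓ)⁻¹ : ℝ) : ℂ) • ((phaseOne a z - -(a / 4) * z : ℝ) : ℂ) +
        ((phaseRem a ℓ z - a * remCoeff ℓ * z : ℝ) : ℂ) := by
    ext z
    rw [phase_sub_linear_eq, smul_eq_mul]
    push_cast
    rfl
  rw [hE, hb.2, ha.2, hs.2, h0.2, h1'.2, h2.2, phaseMellin, smul_eq_mul]
  push_cast
  simp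

theorem hasSum_signedPow (ℓ : ℕ) {a : ℝ} (ha : a ≠ 0) {s : ℂ} (h2 : 2 ≤ s.re) (h3 : s.re < 3) :
    HasSum (fun x : BagZeros ℓ a => signedPow x s)
      (mellinFactor s * ((halfOrder ℓ : ℂ) ^ (-s) * phaseMellin a ℓ s)) := by
  have h := hasSum_mellin_arctan_div ℓ ha h2 h3
  rw [mellin_phase a ℓ (by linarith) h3] at h
  have hν := halfOrder_pos ℓ
  have hpow : (halfOrder ℓ : ℂ) ^ (-s) * (halfOrder ℓ : ℂ) ^ s = 1 := by
    rw [← Complex.cpow_add _ _ (Complex.ofReal_ne_zero.2 hν.ne'), neg_add_cancel,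
      Complex.cpow_zero]
  have h' := h.mul_left (mellinFactor s * (halfOrder ℓ : ℂ) ^ (-s))
  rw [mul_assoc] at h'
  refine h'.congr_fun fun x => ?_
  rw [(hasMellin_arctan_div _ hν (bagZeros_ne_zero x) (by linarith) h3).2]
  have hf := mellinFactor_mul (s := s) (by linarith) h3
  linear_combination (-signedPow x s * (halfOrder ℓ : ℂ) ^ (-s) * (halfOrder ℓ : ℂ) ^ s) * hf -
    signedPow x s * hpow

open HurwitzZeta

/-- The zeta function `∑ (ℓ + 1 / 2) ^ (-s)`. -/
noncomputable def halfZeta (s : ℂ) : ℂ := hurwitzZeta ((1 / 2 : ℝ) : UnitAddCircle) s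

theorem differentiableAt_halfZeta {s : ℂ} (hs : s ≠ 1) : DifferentiableAt ℂ halfZeta s :=
  differentiableAt_hurwitzZeta _ hs

theorem hasSum_halfZeta {s : ℂ} (hs : 1 < s.re) :
    HasSum (fun ℓ : ℕ => (halfOrder ℓ : ℂ) ^ (-s)) (halfZeta s) := by
  have h := hasSum_hurwitzZeta_of_one_lt_re (a := 1 / 2) (by norm_num) hs
  refine h.congr_fun fun ℓ => ?_
  rw [Complex.cpow_neg, ← one_div, halfOrder]
  congr 2
  push_cast
  ring

theorem halfZeta_zero : halfZeta 0 = 0 := by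
  have hne : ((1 / 2 : ℝ) : UnitAddCircle) ≠ 0 := by
    intro h
    rw [AddCircle.coe_eq_zero_iff] at h
    obtain ⟨n, hn⟩ := h
    rw [zsmul_eq_mul, mul_one] at hn
    have h2 : ((2 * n : ℤ) : ℝ) = ((1 : ℤ) : ℝ) := by
      push_cast
      linarith
    have h3 : 2 * n = 1 := by exact_mod_cast h2
    omega
  have hneg : -((1 / 2 : ℝ) : UnitAddCircle) = ((1 / 2 : ℝ) : UnitAddCircle) := by
    rw [← AddCircle.coe_neg, ← sub_eq_zero, ← AddCircle.coe_sub, AddCircle.coe_eq_zero_iff]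
    exact ⟨-1, by norm_num⟩
  have hodd := hurwitzZetaOdd_neg ((1 / 2 : ℝ) : UnitAddCircle) 0
  rw [hneg] at hodd
  have hodd' : hurwitzZetaOdd ((1 / 2 : ℝ) : UnitAddCircle) 0 = 0 := by
    linear_combination hodd / 2
  rw [halfZeta, hurwitzZeta, hurwitzZetaEven_apply_zero, if_neg hne, hodd', add_zero]

/-- The entire extension of `s * halfZeta (s + 1)`. -/
noncomputable def halfZetaShift (s : ℂ) : ℂ :=
  riemannZeta₁ (s + 1) + s * (halfZeta (s + 1) - hurwitzZeta 0 (s + 1))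

theorem differentiable_halfZetaShift : Differentiable ℂ halfZetaShift := by
  have h := differentiable_hurwitzZeta_sub_hurwitzZeta ((1 / 2 : ℝ) : UnitAddCircle) 0
  have h1 : Differentiable ℂ fun s : ℂ => s + 1 := by fun_prop
  exact (differentiable_riemannZeta₁.comp h1).add (differentiable_id.mul (h.comp h1))

theorem halfZetaShift_zero : halfZetaShift 0 = 1 := by
  simp [halfZetaShift]

theorem halfZetaShift_eq {s : ℂ} (hs : s ≠ 0) : halfZetaShift s = s * halfZeta (s + 1) := by
  have h := riemannZeta_eq_inv_sub_mul (s := s + 1) (by simpa using hs)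
  rw [halfZetaShift, hurwitzZeta_zero, h, add_sub_cancel_right]
  field_simp
  ring

theorem norm_halfOrder_cpow_le (ℓ : ℕ) {s : ℂ} (h1 : -(1 / 2) < s.re) (h2 : s.re < 5 / 2) :
    ‖(halfOrder ℓ : ℂ) ^ (-s)‖ * (halfOrder ℓ)⁻¹ ^ 2 ≤ 8 * halfOrder ℓ ^ (-(3 / 2) : ℝ) := by
  have hν := halfOrder_pos ℓ
  rw [Complex.norm_cpow_eq_rpow_re_of_pos hν, Complex.neg_re, ← Real.rpow_natCast (halfOrder ℓ)⁻¹ 2,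
    Real.inv_rpow hν.le, ← Real.rpow_neg hν.le, ← Real.rpow_add hν,
    show -s.re + -((2 : ℕ) : ℝ) = -(s.re + 1 / 2) + -(3 / 2) by push_cast; ring, Real.rpow_add hν]
  gcongr
  calc halfOrder ℓ ^ (-(s.re + 1 / 2)) = (halfOrder ℓ)⁻¹ ^ (s.re + 1 / 2) := by
        rw [Real.inv_rpow hν.le, Real.rpow_neg hν.le]
    _ ≤ 2 ^ (s.re + 1 / 2) :=
        Real.rpow_le_rpow (inv_pos.2 hν).le (inv_halfOrder_le ℓ) (by linarith)
    _ ≤ 2 ^ (3 : ℝ) := Real.rpow_le_rpow_of_exponent_le one_le_two (by linarith)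
    _ = 8 := by norm_num

theorem abs_remCoeff_le (ℓ : ℕ) : |remCoeff ℓ| ≤ (halfOrder ℓ)⁻¹ ^ 2 := by
  have hν := halfOrder_pos ℓ
  have hε := inv_pos.2 hν
  rw [remCoeff, abs_of_nonneg (by positivity)]
  refine div_le_self (by positivity) ?_
  linarith

/-- The summand of the remainder series. -/
noncomputable def remTerm (a : ℝ) (ℓ : ℕ) (s : ℂ) : ℂ :=
  (halfOrder ℓ : ℂ) ^ (-s) * regMellin (phaseRem a ℓ) (a * remCoeff ℓ) 0 s

/-- The summand of the linear part of the remainder series. -/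
noncomputable def linTerm (ℓ : ℕ) (s : ℂ) : ℂ := (halfOrder ℓ : ℂ) ^ (-s) * remCoeff ℓ

/-- The strip on which the continuation is given by the phase expansion. -/
def etaStrip : Set ℂ := {s : ℂ | -(1 / 2) < s.re ∧ s.re < 5 / 2}

theorem isOpen_etaStrip : IsOpen etaStrip :=
  (isOpen_lt continuous_const Complex.continuous_re).inter
    (isOpen_lt Complex.continuous_re continuous_const)

/-- The constant in the bound for `remTerm`. -/
noncomputable def remBound (a : ℝ) : ℝ :=
  (51 * |a| ^ 3 + 2 * |a|) * |∫ z in Ioi 0, stripMajorant z| * 8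

theorem norm_remTerm_le (a : ℝ) (ℓ : ℕ) {s : ℂ} (hs : s ∈ etaStrip) :
    ‖remTerm a ℓ s‖ ≤ remBound a * halfOrder ℓ ^ (-(3 / 2) : ℝ) := by
  have h1 := (isPhaseLike_phaseRem a ℓ).norm_regMellin_le hs.1.le hs.2.le
  have h2 := norm_halfOrder_cpow_le ℓ hs.1 hs.2
  have h3 := le_abs_self (∫ z in Ioi 0, stripMajorant z)
  have hν := halfOrder_pos ℓ
  rw [remTerm, norm_mul]
  calc _ ≤ ‖(halfOrder ℓ : ℂ) ^ (-s)‖ * ((51 * |a| ^ 3 + 2 * |a|) * (halfOrder ℓ)⁻¹ ^ 2 *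
        |∫ z in Ioi 0, stripMajorant z|) := by
        gcongr
        exact h1.trans (by gcongr)
    _ = (51 * |a| ^ 3 + 2 * |a|) * |∫ z in Ioi 0, stripMajorant z| *
        (‖(halfOrder ℓ : ℂ) ^ (-s)‖ * (halfOrder ℓ)⁻¹ ^ 2) := by ring
    _ ≤ (51 * |a| ^ 3 + 2 * |a|) * |∫ z in Ioi 0, stripMajorant z| *
        (8 * halfOrder ℓ ^ (-(3 / 2) : ℝ)) := by gcongr
    _ = _ := by rw [remBound]; ring

theorem norm_linTerm_le (ℓ : ℕ) {s : ℂ} (hs : s ∈ etaStrip) :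
    ‖linTerm ℓ s‖ ≤ 8 * halfOrder ℓ ^ (-(3 / 2) : ℝ) := by
  refine le_trans ?_ (norm_halfOrder_cpow_le ℓ hs.1 hs.2)
  rw [linTerm, norm_mul, Complex.norm_real, Real.norm_eq_abs]
  gcongr
  exact abs_remCoeff_le ℓ

theorem summable_halfOrder_three_halves (C : ℝ) :
    Summable fun ℓ : ℕ => C * halfOrder ℓ ^ (-(3 / 2) : ℝ) :=
  (summable_halfOrder_rpow (by norm_num)).mul_left C

theorem differentiable_halfOrder_cpow (ℓ : ℕ) :
    Differentiable ℂ fun s : ℂ => (halfOrder ℓ : ℂ) ^ (-s) := fun _ =>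
  (differentiableAt_id.neg).const_cpow (Or.inl (Complex.ofReal_ne_zero.2 (halfOrder_pos ℓ).ne'))

theorem differentiableOn_tsum_remTerm (a : ℝ) :
    DifferentiableOn ℂ (fun s => ∑' ℓ, remTerm a ℓ s) etaStrip := by
  refine Complex.differentiableOn_tsum_of_summable_norm
    (summable_halfOrder_three_halves (remBound a)) (fun ℓ s hs => ?_) isOpen_etaStrip
    (fun ℓ _ hs => norm_remTerm_le a ℓ hs)
  exact ((differentiable_halfOrder_cpow ℓ s).mul
    ((isPhaseLike_phaseRem a ℓ).differentiableAt_regMellin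
    (by linarith [hs.1]) (by linarith [hs.2]))).differentiableWithinAt

theorem differentiableOn_tsum_linTerm :
    DifferentiableOn ℂ (fun s => ∑' ℓ, linTerm ℓ s) etaStrip :=
  Complex.differentiableOn_tsum_of_summable_norm (summable_halfOrder_three_halves 8)
    (fun ℓ s _ => ((differentiable_halfOrder_cpow ℓ s).mul_const _).differentiableWithinAt)
    isOpen_etaStrip (fun ℓ _ hs => norm_linTerm_le ℓ hs)

/-- The continuation of the signed zeta function of one boundary condition. -/
noncomputable def etaCont (a : ℝ) (s : ℂ) : ℂ :=
  2 / Real.pi * Complex.cos (Real.pi * s / 2) *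
    (halfZeta s * (s * (regMellin (phaseZero a) (a / 2) (Real.arctan a) s + a / 2 / (1 - s)) +
        Real.arctan a) +
      halfZetaShift s * (regMellin (phaseOne a) (-(a / 4)) 0 s + -(a / 4) / (1 - s)) +
      s * (∑' ℓ, remTerm a ℓ s + (∑' ℓ, linTerm ℓ s) * (a / (1 - s))))

theorem differentiableAt_etaCont (a : ℝ) {s : ℂ} (hs : s ∈ etaStrip) (hs1 : s ≠ 1) :
    DifferentiableAt ℂ (etaCont a) s := by
  have hU := isOpen_etaStrip.mem_nhds hs
  have h1 := (differentiableOn_tsum_remTerm a).differentiableAt hU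
  have h2 := differentiableOn_tsum_linTerm.differentiableAt hU
  have h3 := (isPhaseLike_phaseZero a).differentiableAt_regMellin
    (by linarith [hs.1]) (by linarith [hs.2])
  have h4 := (isPhaseLike_phaseOne a).differentiableAt_regMellin
    (by linarith [hs.1]) (by linarith [hs.2])
  have h5 := differentiableAt_halfZeta hs1
  have h6 := differentiable_halfZetaShift s
  have hne : 1 - s ≠ 0 := sub_ne_zero.2 hs1.symm
  have hinv : ∀ c : ℂ, DifferentiableAt ℂ (fun s : ℂ => c / (1 - s)) s := fun c =>
    (differentiableAt_const c).div (by fun_prop) hne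
  have hcos : DifferentiableAt ℂ (fun s : ℂ => 2 / (Real.pi : ℂ) * Complex.cos (Real.pi * s / 2))
      s := by
    fun_prop
  exact hcos.mul (((h5.mul ((differentiableAt_id.mul (h3.add (hinv _))).add_const _)).add
    (h6.mul (h4.add (hinv _)))).add (differentiableAt_id.mul (h1.add (h2.mul (hinv _)))))

/-- The signed zeta function of one boundary condition. -/
noncomputable def etaSum (a : ℝ) (s : ℂ) : ℂ :=
  ∑' p : (ℓ : ℕ) × BagZeros ℓ a, signedPow p.2 s

theorem summable_norm_signedPow {a : ℝ} (ha : a ≠ 0) {s : ℂ} (hs : 2 < s.re) :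
    Summable fun p : (ℓ : ℕ) × BagZeros ℓ a => ‖signedPow p.2 s‖ := by
  simp only [norm_signedPow (bagZeros_ne_zero _)]
  exact summable_sigma_bagZeros_rpow ha hs

theorem etaSum_eq_etaCont {a : ℝ} (ha : a ≠ 0) {s : ℂ} (h2 : 2 < s.re) (h5 : s.re < 5 / 2) :
    etaSum a s = etaCont a s := by
  have hs0 : s ≠ 0 := by
    rintro rfl
    simp at h2
    linarith
  have hstrip : s ∈ etaStrip := ⟨by linarith, h5⟩
  have h1 : HasSum (fun ℓ : ℕ => mellinFactor s * ((halfOrder ℓ : ℂ) ^ (-s) * phaseMellin a ℓ s))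
      (etaSum a s) :=
    ((summable_norm_signedPow ha h2).of_norm.hasSum).sigma fun ℓ =>
      hasSum_signedPow ℓ ha h2.le (by linarith)
  have hz := hasSum_halfZeta (s := s) (by linarith)
  have hz1 := hasSum_halfZeta (s := s + 1) (by simp; linarith)
  have hr := (Summable.of_norm_bounded (summable_halfOrder_three_halves (remBound a))
    (fun ℓ => norm_remTerm_le a ℓ hstrip)).hasSum
  have hl := (Summable.of_norm_bounded (summable_halfOrder_three_halves 8)
    (fun ℓ => norm_linTerm_le ℓ hstrip)).hasSum
  have h3 := ((((hz.mul_right (regMellin (phaseZero a) (a / 2) (Real.arctan a) s +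
    (a / 2 / (1 - s) + Real.arctan a / s))).add
    (hz1.mul_right (regMellin (phaseOne a) (-(a / 4)) 0 s + -(a / 4) / (1 - s)))).add
    (hr.add (hl.mul_right (a / (1 - s))))).mul_left (mellinFactor s))
  refine (h1.unique (h3.congr_fun fun ℓ => ?_)).trans ?_
  · have hν : (halfOrder ℓ : ℂ) ≠ 0 := Complex.ofReal_ne_zero.2 (halfOrder_pos ℓ).ne'
    rw [phaseMellin, remTerm, linTerm, neg_add, Complex.cpow_add _ _ hν, Complex.cpow_neg_one,
      Complex.ofReal_inv]
    ring
  · rw [etaCont, mellinFactor, halfZetaShift_eq hs0]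
    field_simp
    ring

theorem differentiableAt_etaSum {a : ℝ} (ha : a ≠ 0) {s : ℂ} (hs : 2 < s.re) :
    DifferentiableAt ℂ (etaSum a) s := by
  obtain ⟨σ, h2, hσ⟩ := exists_between hs
  set U : Set ℂ := {w : ℂ | σ < w.re ∧ w.re < s.re + 1} with hU
  have hUo : IsOpen U := (isOpen_lt continuous_const Complex.continuous_re).inter
    (isOpen_lt Complex.continuous_re continuous_const)
  have hsum := (summable_sigma_bagZeros_rpow ha h2).add
    (summable_sigma_bagZeros_rpow ha (σ := s.re + 1) (by linarith))
  refine (Complex.differentiableOn_tsum_of_summable_norm (U := U) hsum (fun p w _ => ?_) hUo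
    (fun p w hw => ?_)).differentiableAt (hUo.mem_nhds ⟨hσ, by linarith⟩)
  · refine DifferentiableAt.differentiableWithinAt ?_
    exact ((differentiableAt_id.neg).const_cpow (Or.inl (Complex.ofReal_ne_zero.2
      (abs_ne_zero.2 (bagZeros_ne_zero p.2))))).const_mul _
  · have hx := abs_pos.2 (bagZeros_ne_zero p.2)
    rw [norm_signedPow (bagZeros_ne_zero _)]
    have e1 := Real.rpow_nonneg hx.le (-σ)
    have e2 := Real.rpow_nonneg hx.le (-(s.re + 1))
    rcases le_or_gt 1 |(p.2 : ℝ)| with h | h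
    · have := Real.rpow_le_rpow_of_exponent_le h (show -w.re ≤ -σ by linarith [hw.1])
      linarith
    · have := Real.rpow_le_rpow_of_exponent_ge hx h.le
        (show -(s.re + 1) ≤ -w.re by linarith [hw.2])
      linarith

theorem etaCont_zero (a : ℝ) :
    etaCont a 0 = 2 / Real.pi * (regMellin (phaseOne a) (-(a / 4)) 0 0 + -(a / 4)) := by
  simp [etaCont, halfZeta_zero, halfZetaShift_zero]

/-- An antiderivative of `-(a / 2) * (1 - r ^ 2) / ((1 + r ^ 2) * (1 + a ^ 2 * r ^ 2))`. -/
noncomputable def phasePrimitive (a r : ℝ) : ℝ :=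
  -(1 / 2) * (2 * a / (1 - a ^ 2) * Real.arctan r +
    (a ^ 2 + 1) / (a ^ 2 - 1) * Real.arctan (a * r))

theorem hasDerivAt_phasePrimitive {a : ℝ} (ha : a ^ 2 ≠ 1) (r : ℝ) :
    HasDerivAt (phasePrimitive a)
      (-(a / 2) * (1 - r ^ 2) / ((1 + r ^ 2) * (1 + (a * r) ^ 2))) r := by
  have h1 : 1 - a ^ 2 ≠ 0 := sub_ne_zero.2 ha.symm
  have h2 : a ^ 2 - 1 ≠ 0 := sub_ne_zero.2 ha
  have h3 : 1 + r ^ 2 ≠ 0 := by positivity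
  have h4 : 1 + (a * r) ^ 2 ≠ 0 := by positivity
  have e1 := (Real.hasDerivAt_arctan r).const_mul (2 * a / (1 - a ^ 2))
  have e2 := (((hasDerivAt_id r).const_mul a).arctan).const_mul ((a ^ 2 + 1) / (a ^ 2 - 1))
  refine ((e1.add e2).const_mul (-(1 / 2))).congr_deriv ?_
  simp only [id]
  rw [show a ^ 2 - 1 = -(1 - a ^ 2) by ring]
  field_simp
  ring

theorem hasDerivAt_phasePrimitive_profileZero {a : ℝ} (ha : a ^ 2 ≠ 1) {z : ℝ} (hz : 0 < z) :
    HasDerivAt (fun z => phasePrimitive a (profileZero z)) (z⁻¹ * phaseOne a z) z := by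
  refine ((hasDerivAt_phasePrimitive ha (profileZero z)).comp z
    (hasDerivAt_profileZero z)).congr_deriv ?_
  have hw := one_le_sqrt_one_add_sq z
  have hw2 := sq_sqrt_one_add_sq z
  have h4 : 1 + (a * profileZero z) ^ 2 ≠ 0 := by positivity
  rw [phaseOne, profileOne]
  set p := 1 + (a * profileZero z) ^ 2
  rw [profileZero]
  set w := √(1 + z ^ 2)
  have hz2 : z ^ 2 = w ^ 2 - 1 := by linarith
  have hw0 : 0 < w := by linarith
  have h5 : 1 + (z / (1 + w)) ^ 2 ≠ 0 := by positivity
  have h6 : (1 - (z / (1 + w)) ^ 2) = w⁻¹ * (1 + (z / (1 + w)) ^ 2) := by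
    rw [div_pow, hz2]
    field_simp
    ring
  have h7 : 1 + z ^ 2 = w ^ 2 := by linarith
  rw [h6, h7]
  field_simp

theorem tendsto_profileZero_atTop : Tendsto profileZero atTop (𝓝 1) := by
  have h : ∀ z : ℝ, 0 < z → |profileZero z - 1| ≤ 2 * z⁻¹ := by
    intro z hz
    have hw := one_le_sqrt_one_add_sq z
    have hw2 := sq_sqrt_one_add_sq z
    have h1 : √(1 + z ^ 2) ≤ 1 + z := Real.sqrt_le_iff.2 ⟨by positivity, by nlinarith⟩
    have h2 := (profileZero_lt_one z).le
    rw [abs_of_nonpos (by linarith), profileZero]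
    rw [show -(z / (1 + √(1 + z ^ 2)) - 1) = (1 + √(1 + z ^ 2) - z) / (1 + √(1 + z ^ 2)) by
      field_simp
      ring, ← div_eq_mul_inv]
    have h3 : z ≤ √(1 + z ^ 2) := Real.le_sqrt_of_sq_le (by linarith)
    exact div_le_div₀ (by norm_num) (by linarith) hz (by linarith)
  rw [tendsto_iff_dist_tendsto_zero]
  refine squeeze_zero' (Eventually.of_forall fun _ => dist_nonneg)
    ((eventually_gt_atTop 0).mono fun z hz => h z hz) ?_
  simpa using tendsto_inv_atTop_zero.const_mul (2 : ℝ)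

theorem regMellin_phaseOne_zero {a : ℝ} (ha : a ^ 2 ≠ 1) :
    regMellin (phaseOne a) (-(a / 4)) 0 0 = ((phasePrimitive a 1 + a / 4 : ℝ) : ℂ) := by
  have hconv := (isPhaseLike_phaseOne a).mellinConvergent (s := 0) (by simp) (by simp)
  set f : ℝ → ℝ := fun z => z⁻¹ *
    (indicator (Iic 1) (fun z => phaseOne a z - -(a / 4) * z) z +
      indicator (Ioi 1) (fun z => phaseOne a z - 0) z) with hf
  have hE : EqOn (fun z : ℝ => (z : ℂ) ^ (-(0 : ℂ) - 1) • regularized (phaseOne a) (-(a / 4)) 0 z)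
      (fun z => ((f z : ℝ) : ℂ)) (Ioi 0) := by
    intro z _
    simp only [hf, neg_zero, zero_sub, Complex.cpow_neg_one, smul_eq_mul, regularized]
    push_cast
    rfl
  have hfint : IntegrableOn f (Ioi 0) := by
    have h1 : IntegrableOn (fun z => ((f z : ℝ) : ℂ)) (Ioi 0) :=
      IntegrableOn.congr_fun hconv hE measurableSet_Ioi
    exact h1.re
  rw [regMellin, mellin, setIntegral_congr_fun measurableSet_Ioi hE, integral_complex_ofReal]
  congr 1
  have hp0 : profileZero 0 = 0 := by simp [profileZero]
  have hP0 : phasePrimitive a 0 = 0 := by simp [phasePrimitive]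
  have hcont : Continuous fun z => phasePrimitive a (profileZero z) :=
    (continuous_iff_continuousAt.2 fun r =>
      (hasDerivAt_phasePrimitive ha r).continuousAt).comp continuous_profileZero
  have hI1 : ∫ z in Ioc 0 1, f z = phasePrimitive a (profileZero 1) + a / 4 := by
    rw [← intervalIntegral.integral_of_le zero_le_one,
      intervalIntegral.integral_eq_sub_of_hasDerivAt_of_le zero_le_one
        (f := fun z => phasePrimitive a (profileZero z) + a / 4 * z)
        (hcont.add (continuous_const.mul continuous_id)).continuousOn]
    · simp [hp0, hP0]
    · intro z hz
      refine ((hasDerivAt_phasePrimitive_profileZero ha hz.1).add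
        ((hasDerivAt_id z).const_mul (a / 4))).congr_deriv ?_
      have hz0 : z ≠ 0 := hz.1.ne'
      simp only [hf, indicator_of_mem (mem_Iic.2 hz.2.le),
        indicator_of_notMem (notMem_Ioi.2 hz.2.le)]
      field_simp
      ring
    · exact (intervalIntegrable_iff_integrableOn_Ioc_of_le zero_le_one).2
        (hfint.mono_set Ioc_subset_Ioi_self)
  have hI2 : ∫ z in Ioi 1, f z = phasePrimitive a 1 - phasePrimitive a (profileZero 1) := by
    refine integral_Ioi_of_hasDerivAt_of_tendsto (f := fun z => phasePrimitive a (profileZero z))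
      hcont.continuousWithinAt (fun z hz => ?_) (hfint.mono_set (Ioi_subset_Ioi zero_le_one)) ?_
    · have hz1 : 1 < z := hz
      refine (hasDerivAt_phasePrimitive_profileZero ha (by linarith)).congr_deriv ?_
      simp only [hf, indicator_of_notMem (notMem_Iic.2 hz1), indicator_of_mem (mem_Ioi.2 hz1)]
      ring
    · exact (hasDerivAt_phasePrimitive ha 1).continuousAt.tendsto.comp tendsto_profileZero_atTop
  rw [← Ioc_union_Ioi_eq_Ioi zero_le_one, setIntegral_union (Ioc_disjoint_Ioi le_rfl)
    measurableSet_Ioi (hfint.mono_set Ioc_subset_Ioi_self)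
    (hfint.mono_set (Ioi_subset_Ioi zero_le_one)), hI1, hI2]
  ring

theorem regMellin_phaseOne_neg (a : ℝ) (s : ℂ) :
    regMellin (phaseOne (-a)) (-(-a / 4)) 0 s = -regMellin (phaseOne a) (-(a / 4)) 0 s := by
  have h : regularized (phaseOne (-a)) (-(-a / 4)) 0 =
      fun z => (-1 : ℂ) • regularized (phaseOne a) (-(a / 4)) 0 z := by
    have hp : ∀ z, phaseOne (-a) z = -phaseOne a z := by
      intro z
      rw [phaseOne, phaseOne]
      ring
    ext z
    rcases le_or_gt z 1 with hz | hz
    · rw [regularized_of_le _ _ _ hz, regularized_of_le _ _ _ hz, hp]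
      push_cast
      simp only [smul_eq_mul]
      ring
    · rw [regularized_of_lt _ _ _ hz, regularized_of_lt _ _ _ hz, hp]
      push_cast
      simp
  rw [regMellin, regMellin, h, mellin_const_smul]
  simp

theorem etaCont_zero_add (θ : ℝ) :
    etaCont (Real.exp θ) 0 + etaCont (-Real.exp (-θ)) 0 =
      ((-(1 / 2) * Real.tanh (θ / 2) : ℝ) : ℂ) := by
  rw [etaCont_zero, etaCont_zero]
  rcases eq_or_ne θ 0 with rfl | hθ
  · rw [neg_zero, Real.exp_zero, regMellin_phaseOne_neg]
    simp
    ring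
  · set t := Real.exp θ with ht
    have ht0 : 0 < t := Real.exp_pos θ
    have ht1 : t ≠ 1 := by
      rw [ht, Ne, Real.exp_eq_one_iff]
      exact hθ
    have htt : t ^ 2 ≠ 1 := by
      intro h
      rcases sq_eq_sq_iff_eq_or_eq_neg.1 (h.trans (one_pow 2).symm) with h | h
      · exact ht1 h
      · linarith
    have hinv : Real.exp (-θ) = t⁻¹ := Real.exp_neg θ
    have htt' : (-t⁻¹) ^ 2 ≠ 1 := by
      rw [neg_sq, inv_pow, Ne, inv_eq_one]
      exact htt
    have htanh : Real.tanh (θ / 2) = (t - 1) / (t + 1) := by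
      have h1 : t = Real.exp (θ / 2) * Real.exp (θ / 2) := by rw [← Real.exp_add, add_halves]
      have h2 := Real.exp_pos (θ / 2)
      rw [Real.tanh_eq_sinh_div_cosh, Real.sinh_eq, Real.cosh_eq, Real.exp_neg, h1]
      set q := Real.exp (θ / 2)
      field_simp
    rw [hinv, regMellin_phaseOne_zero htt, regMellin_phaseOne_zero htt', htanh]
    have hre : 2 / Real.pi * (phasePrimitive t 1 + phasePrimitive (-t⁻¹) 1) =
        -(1 / 2) * ((t - 1) / (t + 1)) := by
      have h1 : 1 - t ^ 2 ≠ 0 := sub_ne_zero.2 htt.symm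
      have h3 : t ^ 2 - 1 ≠ 0 := sub_ne_zero.2 htt
      have h4 : t + 1 ≠ 0 := by positivity
      have h5 : t - 1 ≠ 0 := sub_ne_zero.2 ht1
      have hpi := Real.pi_ne_zero
      have e1 : 2 * -t⁻¹ / (1 - (-t⁻¹) ^ 2) = -(2 * t) / (t ^ 2 - 1) := by
        rw [show 1 - (-t⁻¹) ^ 2 = (t ^ 2 - 1) / t ^ 2 by field_simp]
        field_simp
      have e2 : ((-t⁻¹) ^ 2 + 1) / ((-t⁻¹) ^ 2 - 1) = -(t ^ 2 + 1) / (t ^ 2 - 1) := by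
        rw [show (-t⁻¹) ^ 2 - 1 = -(t ^ 2 - 1) / t ^ 2 by field_simp; ring]
        field_simp
        ring
      rw [phasePrimitive, phasePrimitive, e1, e2, mul_one, mul_one, Real.arctan_neg,
        Real.arctan_inv_of_pos ht0, Real.arctan_one, show 1 - t ^ 2 = -(t ^ 2 - 1) by ring,
        show t ^ 2 - 1 = (t - 1) * (t + 1) by ring]
      field_simp
      ring
    rw [← hre]
    push_cast
    ring

theorem besselJn_eq_mul_besselA (ℓ : ℕ) (x : ℝ) :
    besselJn ℓ x = (x / 2) ^ ℓ * besselA ℓ (-1) x := by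
  rw [besselJn, besselA, besselCore, ← tsum_mul_left]
  refine tsum_congr fun k => ?_
  rw [mul_pow, ← pow_mul, pow_add]
  ring

theorem besselJn_succ_eq_mul_besselB (ℓ : ℕ) (x : ℝ) :
    besselJn (ℓ + 1) x = (x / 2) ^ ℓ * besselB ℓ (-1) x := by
  rw [besselJn_eq_mul_besselA, besselA, besselB, pow_succ]
  ring

theorem besselJn_sub_eq_zero_iff (ℓ : ℕ) (a : ℝ) {x : ℝ} (hx : 0 < x) :
    besselJn ℓ x - a * besselJn (ℓ + 1) x = 0 ↔ bagFun ℓ a x = 0 := by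
  have h : besselJn ℓ x - a * besselJn (ℓ + 1) x =
      (x / 2) ^ ℓ * (besselA ℓ (-1) x - a * besselB ℓ (-1) x) := by
    rw [besselJn_eq_mul_besselA, besselJn_succ_eq_mul_besselB]
    ring
  rw [h, mul_eq_zero_iff_left (by positivity), bagFun_ofReal_eq_zero_iff, sub_eq_zero]

theorem besselJn_add_eq_zero_iff (ℓ : ℕ) (a : ℝ) {x : ℝ} (hx : 0 < x) :
    besselJn ℓ x + a * besselJn (ℓ + 1) x = 0 ↔ bagFun ℓ (-a) x = 0 := by
  rw [← besselJn_sub_eq_zero_iff ℓ (-a) hx, neg_mul, sub_neg_eq_add]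

theorem bagFun_neg_ofReal_eq_zero_iff (ℓ : ℕ) (a x : ℝ) :
    bagFun ℓ a ((-x : ℝ) : ℂ) = 0 ↔ bagFun ℓ (-a) x = 0 := by
  rw [bagFun_ofReal_eq_zero_iff, bagFun_ofReal_eq_zero_iff, besselA_neg, besselB_neg, mul_neg,
    neg_mul]

theorem signedPow_of_pos {x : ℝ} (hx : 0 < x) (s : ℂ) : signedPow x s = (x : ℂ) ^ (-s) := by
  rw [signedPow, abs_of_pos hx, div_self hx.ne', Complex.ofReal_one, one_mul]

theorem signedPow_neg (x : ℝ) (s : ℂ) : signedPow (-x) s = -signedPow x s := by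
  rw [signedPow, signedPow, abs_neg, neg_div, Complex.ofReal_neg, neg_mul]

/-- The set of positive zeros of `bagFun ℓ a`. -/
def bagPos (a : ℝ) (ℓ : ℕ) : Set ℝ := {k | 0 < k ∧ bagFun ℓ a k = 0}

theorem bagFun_neg_of_mem_bagPos_neg {a : ℝ} {ℓ : ℕ} {k : ℝ} (hk : k ∈ bagPos (-a) ℓ) :
    bagFun ℓ a ((-k : ℝ) : ℂ) = 0 :=
  (bagFun_neg_ofReal_eq_zero_iff ℓ a k).2 hk.2

theorem summable_norm_bagPos {a : ℝ} (ha : a ≠ 0) {s : ℂ} (hs : 2 < s.re) :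
    Summable fun p : (ℓ : ℕ) × bagPos a ℓ => ‖((p.2 : ℝ) : ℂ) ^ (-s)‖ := by
  let i : ((ℓ : ℕ) × bagPos a ℓ) → (ℓ : ℕ) × BagZeros ℓ a := fun p => ⟨p.1, p.2, p.2.2.2⟩
  have hi : Function.Injective i := by
    rintro ⟨ℓ, k, hk⟩ ⟨ℓ', k', hk'⟩ h
    simp only [i, Sigma.mk.injEq] at h
    obtain ⟨rfl, h⟩ := h
    simpa using h
  refine ((summable_norm_signedPow ha hs).comp_injective hi).congr fun p => ?_
  simp only [Function.comp_apply, i, signedPow_of_pos p.2.2.1]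

theorem tsum_bagZeros_signedPow {a : ℝ} (ha : a ≠ 0) (ℓ : ℕ) {s : ℂ} (hs : 2 < s.re) :
    ∑' x : BagZeros ℓ a, signedPow x s =
      (∑' k : bagPos a ℓ, ((k : ℝ) : ℂ) ^ (-s)) - ∑' k : bagPos (-a) ℓ, ((k : ℝ) : ℂ) ^ (-s) := by
  let i : bagPos a ℓ ⊕ bagPos (-a) ℓ → BagZeros ℓ a :=
    Sum.elim (fun k => ⟨k, k.2.2⟩) fun k => ⟨-k, bagFun_neg_of_mem_bagPos_neg k.2⟩
  have hi : Function.Bijective i := by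
    constructor
    · rintro (⟨k, hk⟩ | ⟨k, hk⟩) (⟨k', hk'⟩ | ⟨k', hk'⟩) h <;>
        simp only [i, Sum.elim_inl, Sum.elim_inr, Subtype.mk.injEq] at h
      · simp [h]
      · exact absurd h (by linarith [hk.1, hk'.1])
      · exact absurd h (by linarith [hk.1, hk'.1])
      · simp [neg_injective h]
    · rintro x
      rcases (bagZeros_ne_zero x).lt_or_gt with hx | hx
      · refine ⟨Sum.inr ⟨-x, neg_pos.2 hx, ?_⟩, ?_⟩
        · rw [← bagFun_neg_ofReal_eq_zero_iff, neg_neg]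
          exact x.2
        · simp [i]
      · exact ⟨Sum.inl ⟨x, hx, x.2⟩, by simp [i]⟩
  have hp : ∀ k : bagPos a ℓ, signedPow k s = ((k : ℝ) : ℂ) ^ (-s) :=
    fun k => signedPow_of_pos k.2.1 s
  have hn : ∀ k : bagPos (-a) ℓ, signedPow (-k) s = -((k : ℝ) : ℂ) ^ (-s) := fun k => by
    rw [signedPow_neg, signedPow_of_pos k.2.1]
  have h1 : Summable fun k : bagPos a ℓ => ((k : ℝ) : ℂ) ^ (-s) :=
    (summable_norm_bagPos ha hs).of_norm.sigma_factor ℓ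
  have h2 : Summable fun k : bagPos (-a) ℓ => ((k : ℝ) : ℂ) ^ (-s) :=
    (summable_norm_bagPos (neg_ne_zero.2 ha) hs).of_norm.sigma_factor ℓ
  rw [← (Equiv.ofBijective i hi).tsum_eq, sub_eq_add_neg, ← tsum_neg]
  refine (HasSum.sum (f := fun c => signedPow (Equiv.ofBijective i hi c) s) ?_ ?_).tsum_eq
  · simpa only [Function.comp_def, Equiv.ofBijective_apply, i, Sum.elim_inl, hp] using h1.hasSum
  · simpa only [Function.comp_def, Equiv.ofBijective_apply, i, Sum.elim_inr, hn]
      using h2.neg.hasSum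

theorem hasSum_etaSum {a : ℝ} (ha : a ≠ 0) {s : ℂ} (hs : 2 < s.re) :
    HasSum (fun ℓ : ℕ => (∑' k : bagPos a ℓ, ((k : ℝ) : ℂ) ^ (-s)) -
      ∑' k : bagPos (-a) ℓ, ((k : ℝ) : ℂ) ^ (-s)) (etaSum a s) := by
  have h := (summable_norm_signedPow ha hs).of_norm
  simp only [← tsum_bagZeros_signedPow ha _ hs]
  exact h.hasSum.sigma fun ℓ => (h.sigma_factor ℓ).hasSum

/-- The eta function of one boundary parameter on `-1/2 < re s`. -/
noncomputable def etaFun (a : ℝ) (s : ℂ) : ℂ :=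
  if 2 < s.re then etaSum a s else etaCont a s

theorem etaFun_eq_etaCont {a : ℝ} (ha : a ≠ 0) {s : ℂ} (hs : s.re < 5 / 2) :
    etaFun a s = etaCont a s := by
  unfold etaFun
  split_ifs with h
  · exact etaSum_eq_etaCont ha h hs
  · rfl

theorem differentiableAt_etaFun {a : ℝ} (ha : a ≠ 0) {s : ℂ} (hs : -(1 / 2) < s.re)
    (hs1 : s ≠ 1) : DifferentiableAt ℂ (etaFun a) s := by
  rcases lt_or_ge s.re (5 / 2) with h | h
  · refine (differentiableAt_etaCont a ⟨hs, h⟩ hs1).congr_of_eventuallyEq ?_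
    filter_upwards [Complex.continuous_re.continuousAt.eventually_lt continuousAt_const h] with z hz
    exact etaFun_eq_etaCont ha hz
  · have h2 : 2 < s.re := by linarith
    refine (differentiableAt_etaSum ha h2).congr_of_eventuallyEq ?_
    filter_upwards [continuousAt_const.eventually_lt Complex.continuous_re.continuousAt h2]
      with z hz
    exact if_pos hz

theorem Z1p_eq_bagPos (θ : ℝ) : Z1p θ = bagPos (Real.exp θ) := by
  ext ℓ k
  exact and_congr_right fun hk => besselJn_sub_eq_zero_iff ℓ _ hk

theorem Z2p_eq_bagPos (θ : ℝ) : Z2p θ = bagPos (-Real.exp (-θ)) := by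
  ext ℓ k
  exact and_congr_right fun hk => besselJn_add_eq_zero_iff ℓ _ hk

theorem Z1m_eq_bagPos (θ : ℝ) : Z1m θ = bagPos (-Real.exp θ) := by
  ext ℓ k
  exact and_congr_right fun hk => besselJn_add_eq_zero_iff ℓ _ hk

theorem Z2m_eq_bagPos (θ : ℝ) : Z2m θ = bagPos (Real.exp (-θ)) := by
  ext ℓ k
  exact and_congr_right fun hk => besselJn_sub_eq_zero_iff ℓ _ hk

end DiskEta

/-- the eta function of the Dirac operator on the two-dimensional unit disk
with chiral bag boundary conditions converges absolutely for `Re s > 2`, extends to a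
function holomorphic on `{Re s > −1/2}` minus a finite set not containing `0`, and its
value at `0` (the spectral asymmetry) equals `−(1/2) tanh(θ/2)`. -/
theorem stmt_9 (θ : ℝ) :
    (∀ s : ℂ, 2 < s.re →
      (Summable fun p : (ℓ : ℕ) × ↥(Z1p θ ℓ) => ‖((p.2 : ℝ) : ℂ) ^ (-s)‖) ∧
      (Summable fun p : (ℓ : ℕ) × ↥(Z2p θ ℓ) => ‖((p.2 : ℝ) : ℂ) ^ (-s)‖) ∧
      (Summable fun p : (ℓ : ℕ) × ↥(Z1m θ ℓ) => ‖((p.2 : ℝ) : ℂ) ^ (-s)‖) ∧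
      (Summable fun p : (ℓ : ℕ) × ↥(Z2m θ ℓ) => ‖((p.2 : ℝ) : ℂ) ^ (-s)‖)) ∧
    ∃ (F : Finset ℂ) (h : ℂ → ℂ),
      (0 : ℂ) ∉ F ∧
      DifferentiableOn ℂ h ({s : ℂ | -(1 / 2) < s.re} \ (F : Set ℂ)) ∧
      (∀ s : ℂ, 2 < s.re →
        h s = ∑' ℓ : ℕ,
          ((∑' k : ↥(Z1p θ ℓ), ((k : ℝ) : ℂ) ^ (-s)) +
            (∑' k : ↥(Z2p θ ℓ), ((k : ℝ) : ℂ) ^ (-s)) -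
            (∑' k : ↥(Z1m θ ℓ), ((k : ℝ) : ℂ) ^ (-s)) -
            (∑' k : ↥(Z2m θ ℓ), ((k : ℝ) : ℂ) ^ (-s)))) ∧
      h 0 = ((-(1 / 2) * Real.tanh (θ / 2) : ℝ) : ℂ) := by
  have h1 : Real.exp θ ≠ 0 := (Real.exp_pos θ).ne'
  have h2 : Real.exp (-θ) ≠ 0 := (Real.exp_pos (-θ)).ne'
  have h1' : -Real.exp θ ≠ 0 := neg_ne_zero.2 h1
  have h2' : -Real.exp (-θ) ≠ 0 := neg_ne_zero.2 h2
  rw [Z1p_eq_bagPos, Z2p_eq_bagPos, Z1m_eq_bagPos, Z2m_eq_bagPos]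
  refine ⟨fun s hs => ⟨summable_norm_bagPos h1 hs, summable_norm_bagPos h2' hs,
    summable_norm_bagPos h1' hs, summable_norm_bagPos h2 hs⟩, {1},
    fun s => etaFun (Real.exp θ) s + etaFun (-Real.exp (-θ)) s, by simp, ?_, fun s hs => ?_, ?_⟩
  · rintro s ⟨hs, hs1⟩
    have hs1 : s ≠ 1 := by simpa using hs1
    exact ((differentiableAt_etaFun h1 hs hs1).add
      (differentiableAt_etaFun h2' hs hs1)).differentiableWithinAt
  · have h := (hasSum_etaSum h1 hs).add (hasSum_etaSum h2' hs)
    rw [neg_neg] at h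
    simp only [etaFun, if_pos hs]
    rw [← h.tsum_eq]
    exact tsum_congr fun ℓ => by ring
  · have h0 : (0 : ℂ).re < 5 / 2 := by norm_num
    simp only [etaFun_eq_etaCont h1 h0, etaFun_eq_etaCont h2' h0, etaCont_zero_add]
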